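/- arXiv:1705.01594 — 3 statements merged into one kernel-verified Lean document; each statement's English description precedes it below -/
import Mathlib

section
/- Let (R, m) be a commutative Noetherian local ring, I an ideal with cd(I, R) ≤ 1, and X• a (co)chain complex of I-cofinite R-modules. Then every cohomology module H^i(X•) is I-cofinite. -/
open CategoryTheory

noncomputable section

universe u

/-- `Tor_i^R(A, B)` as an object of `ModuleCat R`. -/
def TorMod (R : Type u) [CommRing R] (i : ℕ) (A B : ModuleCat.{u} R) : ModuleCat.{u} R :=
  ((Tor (ModuleCat.{u} R) i).obj A).obj B

/-- `Ext^i_R(A, B)` as an object of `ModuleCat R`. -/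
def ExtMod (R : Type u) [CommRing R] (i : ℕ) (A B : ModuleCat.{u} R) : ModuleCat.{u} R :=
  ((Ext R (ModuleCat.{u} R) i).obj (Opposite.op A)).obj B

/-- `H^i_I(M)`, the `i`-th local cohomology of `M` with support in `I`. -/
def LC (R : Type u) [CommRing R] (I : Ideal R) (i : ℕ) (M : ModuleCat.{u} R) : ModuleCat.{u} R :=
  (localCohomology I i).obj M

/-- `M` is `I`-cofinite: `Supp M ⊆ V(I)` and all `Ext^i_R(R/I, M)` are finitely generated. -/
def IsCofinite (R : Type u) [CommRing R] (I : Ideal R) (M : ModuleCat.{u} R) : Prop :=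
  Module.support R M ⊆ PrimeSpectrum.zeroLocus (I : Set R) ∧
    ∀ i : ℕ, Module.Finite R (ExtMod R i (ModuleCat.of R (R ⧸ I)) M)

/-- `Γ_I(M) = ⋃ₙ (0 :_M Iⁿ)`, the `I`-torsion submodule of `M`. -/
def torsionGamma (R : Type u) [CommRing R] (I : Ideal R) (M : Type u) [AddCommGroup M]
    [Module R M] : Submodule R M :=
  ⨆ n : ℕ, Submodule.torsionBySet R M ((I ^ n : Ideal R) : Set R)

namespace CofAux

variable {R : Type u} [CommRing R]

/-- the induced map on Hom complexes -/
def yonMap {P Q : ChainComplex (ModuleCat.{u} R) ℕ} (φ : P ⟶ Q) (M : ModuleCat.{u} R) :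
    Q.linearYonedaObj R M ⟶ P.linearYonedaObj R M :=
  (HomologicalComplex.unopFunctor _ _).map
    ((((linearYoneda R (ModuleCat.{u} R)).obj M).rightOp.mapHomologicalComplex _).map φ).op

lemma gen_comp {C : Type*} [Category* C] {a b c d e f : C} {x : a ⟶ b} {p1 : b ⟶ c} {q1 : a ⟶ d}
    {y : d ⟶ c} (h1 : x ≫ p1 = q1 ≫ y) (α : e ≅ d) (β : f ≅ c) {z : e ⟶ f}
    (h2 : α.hom ≫ y = z ≫ β.hom) :
    x ≫ (p1 ≫ β.inv) = (q1 ≫ α.inv) ≫ z := by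
  have : y ≫ β.inv = α.inv ≫ z := by
    rw [Iso.comp_inv_eq, Category.assoc, Iso.eq_inv_comp, h2]
  rw [← Category.assoc, h1, Category.assoc, this, Category.assoc]

lemma isoExt_nat {A' A : ModuleCat.{u} R} (f : A' ⟶ A) (P : ProjectiveResolution A')
    (Q : ProjectiveResolution A) (φ : P.complex ⟶ Q.complex)
    (comm : φ.f 0 ≫ Q.π.f 0 = P.π.f 0 ≫ f) (n : ℕ) (M : ModuleCat.{u} R) :
    ((Ext R (ModuleCat.{u} R) n).map f.op).app M ≫ (P.isoExt (R := R) n M).hom =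
      (Q.isoExt (R := R) n M).hom ≫ HomologicalComplex.homologyMap (yonMap φ M) n := by
  have h1 := congrArg Quiver.Hom.unop (ProjectiveResolution.isoLeftDerivedObj_inv_naturality f P Q φ comm
    ((linearYoneda R (ModuleCat.{u} R)).obj M).rightOp n)
  have h2 := congrArg Quiver.Hom.unop (HomologicalComplex.homologyOp_hom_naturality (yonMap φ M) n)
  exact gen_comp h1 ((HomologicalComplex.homologyOp (Q.complex.linearYonedaObj R M) n).unop)
    ((HomologicalComplex.homologyOp (P.complex.linearYonedaObj R M) n).unop) h2

end CofAux

namespace CofAux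

variable {R : Type u} [CommRing R]

/-- class of a cocycle in a complex of modules -/
lemma exists_class (K : CochainComplex (ModuleCat.{u} R) ℕ) (n : ℕ) :
    ∃ κ : LinearMap.ker (K.d n (n+1)).hom →ₗ[R] K.homology n, Function.Surjective κ ∧
      (∀ z, ∃ c, K.iCycles n c = z.1 ∧ κ z = K.homologyπ n c) ∧
      (∀ z, κ z = 0 ↔ ∃ y, K.d (n-1) n y = z.1 ∧ (n = 0 → y = 0)) := by
  set l := K.liftCycles
        (ModuleCat.ofHom (LinearMap.ker (K.d n (n+1)).hom).subtype) (n+1) (by simp)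
          (by ext x; exact x.2) with hl
  have hli : ∀ z, K.iCycles n (l z) = z.1 := by
    intro z
    have : l ≫ K.iCycles n = _ := K.liftCycles_i _ _ _ _
    exact congrArg (fun f => f.hom z) this
  have hi : Function.Injective (K.iCycles n) := by
    rw [← ModuleCat.mono_iff_injective]; infer_instance
  have hπ : Function.Surjective (K.homologyπ n) := by
    rw [← ModuleCat.epi_iff_surjective]; infer_instance
  have hdi : ∀ c, K.d n (n+1) (K.iCycles n c) = 0 := by
    intro c
    have := K.iCycles_d n (n+1)
    exact congrArg (fun f => f.hom c) this
  have hls : Function.Surjective l := fun c => ⟨⟨K.iCycles n c, hdi c⟩, hi (hli _)⟩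
  refine ⟨(l ≫ K.homologyπ n).hom, ?_, fun z => ⟨l z, hli z, rfl⟩, ?_⟩
  · exact hπ.comp hls
  · intro z
    rcases n with _ | n
    · have : IsIso (K.homologyπ 0) := by
        apply K.isIso_homologyπ 0 0 (by simp)
        apply K.shape; simp
      have hπi : Function.Injective (K.homologyπ 0) := by
        rw [← ModuleCat.mono_iff_injective]; infer_instance
      constructor
      · intro h
        have h1 : l z = 0 := hπi (by simpa using h)
        refine ⟨0, ?_, fun _ => rfl⟩
        rw [← hli z, h1]; simp
      · rintro ⟨y, hy, h0⟩
        have : z = 0 := by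
          ext; rw [← hy, h0 rfl]; simp
        rw [this]; simp
    · have hex : (ShortComplex.mk (K.toCycles n (n+1)) (K.homologyπ (n+1)) (by simp)).Exact :=
        ShortComplex.exact_of_g_is_cokernel _ (K.homologyIsCokernel n (n+1) (by simp))
      rw [ShortComplex.moduleCat_exact_iff] at hex
      constructor
      · intro h
        obtain ⟨y, hy⟩ := hex (l z) h
        refine ⟨y, ?_, by simp⟩
        rw [← hli z, ← hy]
        have := K.toCycles_i n (n+1)
        exact (congrArg (fun f => f.hom y) this).symm
      · rintro ⟨y, hy, -⟩
        have h1 : K.toCycles n (n+1) y = l z := by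
          apply hi
          rw [hli, ← hy]
          have := K.toCycles_i n (n+1)
          exact (congrArg (fun f => f.hom y) this)
        have h2 := K.toCycles_comp_homologyπ n (n+1)
        change K.homologyπ (n+1) (l z) = 0
        rw [← h1]
        exact (congrArg (fun f => f.hom y) h2)

lemma class_nat {K L : CochainComplex (ModuleCat.{u} R) ℕ} (ψ : K ⟶ L) (n : ℕ) (z : K.cycles n)
    (w : L.cycles n) (h : L.iCycles n w = ψ.f n (K.iCycles n z)) :
    L.homologyπ n w = HomologicalComplex.homologyMap ψ n (K.homologyπ n z) := by
  have e1 := HomologicalComplex.homologyπ_naturality ψ n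
  have e2 := HomologicalComplex.cyclesMap_i ψ n
  have hi : Function.Injective (L.iCycles n) := by
    rw [← ModuleCat.mono_iff_injective]; infer_instance
  have h1 : w = HomologicalComplex.cyclesMap ψ n z := by
    apply hi
    rw [h]
    exact (congrArg (fun g => g.hom z) e2).symm
  rw [h1]
  exact (congrArg (fun g => g.hom z) e1).symm

end CofAux

namespace CofAux

variable {R : Type u} [CommRing R]

lemma finite_of_two_surj {Z E F : Type u} [AddCommGroup Z] [Module R Z] [AddCommGroup E] [Module R E]
    [AddCommGroup F] [Module R F] (a : Z →ₗ[R] E) (b : Z →ₗ[R] F) (ha : Function.Surjective a)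
    (hb : Function.Surjective b) (h : ∀ z, a z = 0 ↔ b z = 0) : Module.Finite R E ↔ Module.Finite R F := by
  have hk : LinearMap.ker a = LinearMap.ker b := by ext z; exact h z
  exact Module.Finite.equiv_iff ((a.quotKerEquivOfSurjective ha).symm.trans
    ((Submodule.quotEquivOfEq _ _ hk).trans (b.quotKerEquivOfSurjective hb)))

lemma smul_extMk {A M : ModuleCat.{u} R} (P : ProjectiveResolution A) {n : ℕ} (r : R)
    (z : P.complex.X n ⟶ M) (hz : P.complex.d (n+1) n ≫ z = 0) :
    r • P.extMk z (n+1) rfl hz = P.extMk (r • z) (n+1) rfl (by simp [hz]) := by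
  rw [Abelian.Ext.smul_eq_comp_mk₀, P.extMk_comp_mk₀]
  simp

/-- cocycle map into Abelian.Ext -/
def toExt {A : ModuleCat.{u} R} (P : ProjectiveResolution A) (M : ModuleCat.{u} R) (n : ℕ) :
    LinearMap.ker ((P.complex.linearYonedaObj R M).d n (n+1)).hom →ₗ[R] Abelian.Ext A M n where
  toFun z := P.extMk z.1 (n+1) rfl z.2
  map_add' x y := (P.add_extMk x.1 y.1 (n+1) rfl x.2 y.2).symm
  map_smul' r x := by
    exact (smul_extMk P r _ x.2).symm

lemma fin_iff (A M : ModuleCat.{u} R) (n : ℕ) :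
    Module.Finite R (ExtMod R n A M) ↔ Module.Finite R (Abelian.Ext A M n) := by
  let P := projectiveResolution A
  obtain ⟨κ, hs, -, hk⟩ := exists_class (P.complex.linearYonedaObj R M) n
  have h1 : Module.Finite R (ExtMod R n A M) ↔ Module.Finite R ((P.complex.linearYonedaObj R M).homology n) :=
    Module.Finite.equiv_iff (P.isoExt (R := R) n M).toLinearEquiv
  rw [h1]
  rcases n with _ | n
  · let e : (A ⟶ M) →ₗ[R] LinearMap.ker ((P.complex.linearYonedaObj R M).d 0 1).hom :=
      { toFun := fun g => ⟨(P.π.f 0 ≫ g : P.complex.X 0 ⟶ M), by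
          change P.complex.d 1 0 ≫ (P.π.f 0 ≫ g) = 0
          have := P.complex_d_comp_π_f_zero
          exact (Category.assoc _ _ _).symm.trans ((congrArg (· ≫ g) this).trans Limits.zero_comp)⟩
        map_add' := fun x y => Subtype.ext (Preadditive.comp_add _ _ _ _ _ _)
        map_smul' := fun r x => Subtype.ext (Linear.comp_smul _ _ _ _ _ _) }
    rw [Module.Finite.equiv_iff (Abelian.Ext.linearEquiv₀ (R := R) (X := A) (Y := M))]
    refine finite_of_two_surj (κ.comp e) LinearMap.id (hs.comp ?_) Function.surjective_id ?_
    · intro z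
      have hz : P.complex.d 1 0 ≫ (z.1 : P.complex.X 0 ⟶ M) = 0 := z.2
      refine ⟨P.exact₀.desc (z.1 : P.complex.X 0 ⟶ M) hz, ?_⟩
      exact Subtype.ext (P.exact₀.g_desc _ _)
    · intro g
      simp only [LinearMap.comp_apply, LinearMap.id_apply]
      rw [hk]
      constructor
      · rintro ⟨y, hy, h0⟩
        rw [h0 rfl, map_zero] at hy
        have : P.π.f 0 ≫ g = P.π.f 0 ≫ 0 := by
          rw [Limits.comp_zero]; exact hy.symm
        exact (cancel_epi (P.π.f 0)).1 this
      · rintro rfl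
        exact ⟨0, by simp, fun _ => rfl⟩
  · refine finite_of_two_surj κ (toExt P M (n+1)) hs ?_ ?_
    · intro x
      obtain ⟨f, hf, h⟩ := P.extMk_surjective x (n+1+1) rfl
      exact ⟨⟨f, hf⟩, h⟩
    · intro z
      rw [hk]
      refine Iff.trans ?_ (P.extMk_eq_zero_iff z.1 (n+1+1) rfl z.2 n rfl).symm
      constructor
      · rintro ⟨y, hy, -⟩
        exact ⟨y, hy⟩
      · rintro ⟨y, hy⟩
        exact ⟨y, hy, by simp⟩

/-- naturality of vanishing -/
lemma comp_zero_of_ext {A M : ModuleCat.{u} R} (n : ℕ) (x : Abelian.Ext A M (n+1)) :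
    ∃ e : ExtMod R (n+1) A M, ∀ (A' : ModuleCat.{u} R) (f : A' ⟶ A),
      (((Ext R (ModuleCat.{u} R) (n+1)).map f.op).app M) e = 0 →
        (Abelian.Ext.mk₀ f).comp x (zero_add _) = 0 := by
  let Q := projectiveResolution A
  obtain ⟨z, hz, rfl⟩ := Q.extMk_surjective x (n+1+1) rfl
  obtain ⟨κ, hs, hκ, hk⟩ := exists_class (Q.complex.linearYonedaObj R M) (n+1)
  refine ⟨(Q.isoExt (R := R) (n+1) M).inv (κ ⟨z, hz⟩), ?_⟩
  intro A' f h
  let P := projectiveResolution A'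
  obtain ⟨κ', hs', hκ', hk'⟩ := exists_class (P.complex.linearYonedaObj R M) (n+1)
  let φ := ProjectiveResolution.lift f P Q
  have hcomm : φ ≫ Q.π = P.π ≫ (ChainComplex.single₀ _).map f :=
    ProjectiveResolution.lift_commutes f P Q
  have hcomm0 : φ.f 0 ≫ Q.π.f 0 = P.π.f 0 ≫ f := by
    have := congrArg (fun g => g.f 0) hcomm
    simpa using this
  have hnat := isoExt_nat f P Q φ hcomm0 (n+1) M
  have h2 : HomologicalComplex.homologyMap (yonMap φ M) (n+1) (κ ⟨z, hz⟩) = 0 := by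
    have := congrArg (fun g => g.hom ((Q.isoExt (R := R) (n+1) M).inv (κ ⟨z, hz⟩))) hnat
    have h3 : (P.isoExt (R := R) (n+1) M).hom ((((Ext R (ModuleCat.{u} R) (n+1)).map f.op).app M) ((Q.isoExt (R := R) (n+1) M).inv (κ ⟨z, hz⟩)))
      = HomologicalComplex.homologyMap (yonMap φ M) (n+1) ((Q.isoExt (R := R) (n+1) M).hom ((Q.isoExt (R := R) (n+1) M).inv (κ ⟨z, hz⟩))) := this
    rw [h] at h3
    have h4 : (Q.isoExt (R := R) (n+1) M).hom ((Q.isoExt (R := R) (n+1) M).inv (κ ⟨z, hz⟩)) = κ ⟨z, hz⟩ :=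
      congrArg (fun g => g.hom (κ ⟨z, hz⟩)) (Q.isoExt (R := R) (n+1) M).inv_hom_id
    rw [h4] at h3
    rw [← h3, map_zero]
  have hz' : P.complex.d (n+1+1) (n+1) ≫ (φ.f (n+1) ≫ z) = 0 := by
    rw [← Category.assoc, ← φ.comm, Category.assoc, hz, Limits.comp_zero]
  have h5 : κ' ⟨φ.f (n+1) ≫ z, hz'⟩ = 0 := by
    obtain ⟨c, hc, hc'⟩ := hκ ⟨z, hz⟩
    obtain ⟨d, hd, hd'⟩ := hκ' ⟨φ.f (n+1) ≫ z, hz'⟩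
    rw [← h2, hc', hd']
    apply class_nat
    rw [hd, hc]
    rfl
  rw [hk'] at h5
  obtain ⟨y, hy, -⟩ := h5
  let Φ : ProjectiveResolution.Hom P Q f := { hom := φ, hom_f_zero_comp_π_f_zero := hcomm0 }
  rw [ProjectiveResolution.mk₀_comp_extMk z (n+1+1) rfl hz Φ]
  rw [P.extMk_eq_zero_iff _ _ _ _ n rfl]
  exact ⟨y, hy⟩

end CofAux

namespace CofAux

variable {R : Type u} [CommRing R]

/-- quotient ring as module -/
abbrev Q (J : Ideal R) : ModuleCat.{u} R := ModuleCat.of R (R ⧸ J)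

/-- projection maps -/
def ρ {J' J : Ideal R} (h : J' ≤ J) : Q J' ⟶ Q J :=
  ModuleCat.ofHom (Submodule.mapQ J' J LinearMap.id h)

lemma ρ_comp {J'' J' J : Ideal R} (h : J'' ≤ J') (h' : J' ≤ J) : ρ h ≫ ρ h' = ρ (h.trans h') := by
  ext
  rfl

open Limits in
lemma lc_elem (I : Ideal R) (i : ℕ) (M : ModuleCat.{u} R) (h : Subsingleton (LC R I i M)) (m : ℕ)
    (e : ExtMod R i (Q (I ^ m)) M) :
    ∃ n, ∃ hmn : m ≤ n, (((Ext R (ModuleCat.{u} R) i).map (ρ (Ideal.pow_le_pow_right (I := I) hmn)).op).app M) e = 0 := by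
  have := localCohomology.hasColimitDiagram.{u, 0} (localCohomology.idealPowersDiagram I) i
  let D := localCohomology.diagram (localCohomology.idealPowersDiagram I) i
  let ev := (evaluation (ModuleCat.{u} R) (ModuleCat.{u} R)).obj M
  have hc := isColimitOfPreserves ev (colimit.isColimit D)
  have h0 : (ev.mapCocone (colimit.cocone D)).ι.app (Opposite.op (Opposite.op m)) e =
    (ev.mapCocone (colimit.cocone D)).ι.app (Opposite.op (Opposite.op m)) (0 : ExtMod R i (Q (I ^ m)) M) := 
    h.elim _ _
  have : PreservesFilteredColimitsOfSize.{0, 0} (forget (ModuleCat.{u} R)) :=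
    preservesSmallestFilteredColimits_of_preservesFilteredColimits _
  obtain ⟨k, f, g, hfg⟩ := Concrete.isColimit_exists_of_rep_eq (D ⋙ ev) hc _ _ h0
  refine ⟨k.unop.unop, f.unop.unop.down.down, ?_⟩
  exact hfg.trans (map_zero ((D ⋙ ev).map g).hom)

lemma lc_van [IsNoetherianRing R] (I : Ideal R) (i : ℕ) (h : Subsingleton (LC R I (i+1) (ModuleCat.of R R))) (m : ℕ) :
    ∃ n, ∃ hmn : m ≤ n, ∀ x : Abelian.Ext (Q (I ^ m)) (ModuleCat.of R R) (i+1),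
      (Abelian.Ext.mk₀ (ρ (Ideal.pow_le_pow_right (I := I) hmn))).comp x (zero_add _) = 0 := by
  have h1 : ∀ x : Abelian.Ext (Q (I ^ m)) (ModuleCat.of R R) (i+1),
    ∃ n, ∃ hmn : m ≤ n, (Abelian.Ext.mk₀ (ρ (Ideal.pow_le_pow_right (I := I) hmn))).comp x (zero_add _) = 0 := by
    intro x
    obtain ⟨e, he⟩ := comp_zero_of_ext i x
    obtain ⟨n, hmn, hn⟩ := lc_elem I (i+1) _ h m e
    exact ⟨n, hmn, he _ _ hn⟩
  choose N hN hN' using h1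
  have hf : Module.Finite R (Abelian.Ext (Q (I ^ m)) (ModuleCat.of R R) (i+1)) := by
    exact ModuleCat.finite_ext R _ _ _
  obtain ⟨s, hs⟩ := hf.1
  have hm : m ≤ s.sup N + m := Nat.le_add_left _ _
  refine ⟨s.sup N + m, hm, ?_⟩
  intro x
  have hx : x ∈ Submodule.span R (s : Set _) := by rw [hs]; trivial
  induction hx using Submodule.span_induction with
  | mem x hx =>
    have hle : N x ≤ s.sup N + m := (Finset.le_sup (f := N) hx).trans (Nat.le_add_right _ _)
    rw [← ρ_comp (Ideal.pow_le_pow_right (I := I) hle) (Ideal.pow_le_pow_right (I := I) (hN x)),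
      ← Abelian.Ext.mk₀_comp_mk₀, Abelian.Ext.comp_assoc_of_second_deg_zero, hN' x]
    simp
  | zero => simp
  | add x y _ _ hx hy => simp [hx, hy]
  | smul r x _ hx => simp [hx]

end CofAux

namespace CofAux

variable {R : Type u} [CommRing R]

/-- `f` induces zero on `Ext^j(-, M)` for every `M` -/
def Null (j : ℕ) {A B : ModuleCat.{u} R} (f : A ⟶ B) : Prop :=
  ∀ (M : ModuleCat.{u} R) (x : Abelian.Ext B M j),
    (Abelian.Ext.mk₀ f).comp x (zero_add _) = 0

lemma Null.pre {j : ℕ} {A B C : ModuleCat.{u} R} {g : B ⟶ C} (hg : Null j g) (f : A ⟶ B) :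
    Null j (f ≫ g) := by
  intro M x
  rw [← Abelian.Ext.mk₀_comp_mk₀, Abelian.Ext.comp_assoc_of_second_deg_zero, hg M x,
    Abelian.Ext.comp_zero]

lemma Null.post {j : ℕ} {A B C : ModuleCat.{u} R} {f : A ⟶ B} (hf : Null j f) (g : B ⟶ C) :
    Null j (f ≫ g) := by
  intro M x
  rw [← Abelian.Ext.mk₀_comp_mk₀, Abelian.Ext.comp_assoc_of_second_deg_zero, hf M _]

lemma Null.succ {j : ℕ} {A B : ModuleCat.{u} R} {f : A ⟶ B} (hf : Null j f) : Null (j + 1) f := by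
  intro M x
  let S : ShortComplex (ModuleCat.{u} R) :=
    ShortComplex.mk (Injective.ι M) (Limits.cokernel.π (Injective.ι M)) (by simp)
  have hS : S.ShortExact :=
    { exact := ShortComplex.exact_of_g_is_cokernel _ (Limits.cokernelIsCokernel _)
      mono_f := by dsimp [S]; infer_instance
      epi_g := by dsimp [S]; infer_instance }
  have h0 : x.comp (Abelian.Ext.mk₀ S.f) (add_zero _) = 0 := by
    have : Injective S.X₂ := by dsimp [S]; infer_instance
    exact Abelian.Ext.eq_zero_of_injective _
  obtain ⟨y, hy⟩ := Abelian.Ext.covariant_sequence_exact₁ B hS x h0 rfl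
  rw [← hy, ← Abelian.Ext.comp_assoc (h₁₂ := zero_add _) (h₂₃ := rfl) (h := by omega), hf]
  simp

lemma Null.mono {j k : ℕ} {A B : ModuleCat.{u} R} {f : A ⟶ B} (hf : Null j f) (h : j ≤ k) :
    Null k f := by
  induction h with
  | refl => exact hf
  | step _ ih => exact ih.succ

lemma null_of_projective {j : ℕ} {A B : ModuleCat.{u} R} (f : A ⟶ B) [Projective B] :
    Null (j + 1) f := by
  intro M x
  rw [Abelian.Ext.eq_zero_of_projective x]
  simp

lemma null_ses {j : ℕ} {S S' S'' : ShortComplex (ModuleCat.{u} R)} (hS' : S'.ShortExact)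
    (hS'' : S''.ShortExact) (ψ : S'' ⟶ S') (φ : S' ⟶ S) (h2 : Null (j + 1) φ.τ₂)
    (h1 : Null j ψ.τ₁) : Null (j + 1) (ψ.τ₃ ≫ φ.τ₃) := by
  intro M x
  have e : (Abelian.Ext.mk₀ S'.g).comp ((Abelian.Ext.mk₀ φ.τ₃).comp x (zero_add _)) (zero_add _)
      = 0 := by
    rw [← Abelian.Ext.comp_assoc_of_second_deg_zero, Abelian.Ext.mk₀_comp_mk₀, ← φ.comm₂₃,
      ← Abelian.Ext.mk₀_comp_mk₀, Abelian.Ext.comp_assoc_of_second_deg_zero, h2]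
  obtain ⟨y, hy⟩ := Abelian.Ext.contravariant_sequence_exact₃ hS' M _ e (add_comm 1 j)
  rw [← Abelian.Ext.mk₀_comp_mk₀, Abelian.Ext.comp_assoc_of_second_deg_zero, ← hy,
    ← Abelian.Ext.comp_assoc (h₁₂ := zero_add _) (h₂₃ := add_comm 1 j) (h := by omega),
    ← ShortComplex.ShortExact.extClass_naturality hS'' hS' ψ,
    Abelian.Ext.comp_assoc (h₁₂ := add_zero _) (h₂₃ := zero_add j) (h := by omega), h1]
  simp

lemma factor_fg [IsNoetherianRing R] (j : ℕ) : ∀ (B M : ModuleCat.{u} R) [Module.Finite R B]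
    (x : Abelian.Ext B M j), ∃ (K : ModuleCat.{u} R) (_ : Module.Finite R K)
      (c : Abelian.Ext B K j) (g : K ⟶ M), x = c.comp (Abelian.Ext.mk₀ g) (add_zero _) := by
  induction j with
  | zero =>
    intro B M _ x
    obtain ⟨g, rfl⟩ := Abelian.Ext.addEquiv₀.symm.surjective x
    exact ⟨B, inferInstance, Abelian.Ext.mk₀ (𝟙 B), g, by simp⟩
  | succ j ih =>
    intro B M _ x
    obtain ⟨N, _, _, _, _, f, surjf⟩ := Module.exists_finite_presentation R B
    have exac := LinearMap.shortExact_shortComplexKer surjf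
    obtain ⟨y, hy⟩ := precomp_extClass_surjective_of_projective_X₂ M exac j x
    have : Module.Finite R f.shortComplexKer.X₁ := by dsimp; infer_instance
    obtain ⟨K, hK, c, g, rfl⟩ := ih _ M y
    refine ⟨K, hK, exac.extClass.comp c (add_comm 1 j), g, ?_⟩
    rw [← hy]
    exact (Abelian.Ext.comp_assoc_of_third_deg_zero _ _ _ _).symm

lemma null_of_fg [IsNoetherianRing R] {j : ℕ} {A B : ModuleCat.{u} R} [Module.Finite R B]
    (f : A ⟶ B)
    (h : ∀ (M : ModuleCat.{u} R) [Module.Finite R M] (x : Abelian.Ext B M j),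
      (Abelian.Ext.mk₀ f).comp x (zero_add _) = 0) : Null j f := by
  intro M x
  obtain ⟨K, hK, c, g, rfl⟩ := factor_fg j B M x
  rw [← Abelian.Ext.comp_assoc_of_third_deg_zero, h K c, Abelian.Ext.zero_comp]

end CofAux

namespace CofAux

variable {R : Type u} [CommRing R]

lemma exists_factor {A B C : Type*} [AddCommGroup A] [Module R A] [AddCommGroup B] [Module R B]
    [AddCommGroup C] [Module R C] (μ : A →ₗ[R] B) (hμ : Function.Surjective μ) (ν : A →ₗ[R] C)
    (h : LinearMap.ker μ ≤ LinearMap.ker ν) : ∃ s : B →ₗ[R] C, ∀ t, s (μ t) = ν t := by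
  refine ⟨((LinearMap.ker μ).liftQ ν h).comp (μ.quotKerEquivOfSurjective hμ).symm.toLinearMap, ?_⟩
  intro t
  have : (μ.quotKerEquivOfSurjective hμ).symm (μ t) = (LinearMap.ker μ).mkQ t := by
    rw [LinearEquiv.symm_apply_eq]
    simp
  simp [this]

/-- the map R/L → R/J -/
abbrev qm {L J : Ideal R} (h : L ≤ J) : (R ⧸ L) →ₗ[R] (R ⧸ J) := Submodule.mapQ L J LinearMap.id h

lemma qm_surj {L J : Ideal R} (h : L ≤ J) : Function.Surjective (qm h) := by
  intro y
  obtain ⟨y, rfl⟩ := Submodule.mkQ_surjective _ y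
  exact ⟨Submodule.mkQ _ y, rfl⟩

lemma qm_mk {L J : Ideal R} (h : L ≤ J) (t : R) :
    qm h (Submodule.Quotient.mk t) = Submodule.Quotient.mk t := rfl

/-- short exact sequence of R/L → R/J -/
abbrev SQ {L J : Ideal R} (h : L ≤ J) : ShortComplex (ModuleCat.{u} R) := (qm h).shortComplexKer

lemma SQ_exact {L J : Ideal R} (h : L ≤ J) : (SQ h).ShortExact :=
  LinearMap.shortExact_shortComplexKer (qm_surj h)

lemma ker_aux {L J L' J' : Ideal R} (h : L ≤ J) (h' : L' ≤ J') (hL : L' ≤ L) (hJ : J' ≤ J) :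
    ∀ z ∈ LinearMap.ker (qm h'), qm hL z ∈ LinearMap.ker (qm h) := by
  intro z hz
  obtain ⟨t, rfl⟩ := Submodule.mkQ_surjective _ z
  have ht : t ∈ J' := (Submodule.Quotient.mk_eq_zero J').1 hz
  exact (Submodule.Quotient.mk_eq_zero J).2 (hJ ht)

/-- functoriality -/
def SQmap {L J L' J' : Ideal R} (h : L ≤ J) (h' : L' ≤ J') (hL : L' ≤ L) (hJ : J' ≤ J) :
    SQ h' ⟶ SQ h where
  τ₁ := ModuleCat.ofHom ((qm hL).restrict (ker_aux h h' hL hJ))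
  τ₂ := ρ hL
  τ₃ := ρ hJ
  comm₁₂ := by ext; rfl
  comm₂₃ := by
    ext
    rfl

lemma ker_factor [IsNoetherianRing R] {j : ℕ} {L'' L' : Ideal R} (h : L'' ≤ L') (x : R) (m : ℕ)
    (hn : Null j (ρ h)) : ∃ c, ∀ (hJ : L'' ⊔ Ideal.span {x ^ (m + c)} ≤ L' ⊔ Ideal.span {x ^ m}),
      Null j (SQmap (le_sup_left : L' ≤ L' ⊔ Ideal.span {x ^ m})
        (le_sup_left : L'' ≤ L'' ⊔ Ideal.span {x ^ (m + c)}) h hJ).τ₁ := by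
  let F : ℕ →o Ideal R :=
    { toFun := fun n => Submodule.comap (LinearMap.mulLeft R (x ^ n)) L''
      monotone' := by
        intro a b hab t ht
        simp only [Submodule.mem_comap, LinearMap.mulLeft_apply] at ht ⊢
        obtain ⟨d, rfl⟩ := Nat.exists_eq_add_of_le hab
        rw [pow_add, mul_comm (x ^ a), mul_assoc]
        exact L''.mul_mem_left _ ht }
  obtain ⟨c, hc⟩ := monotone_stabilizes_iff_noetherian.2 ‹_› F
  refine ⟨c, fun hJ => ?_⟩
  have hst : ∀ t, x ^ (m + c) * t ∈ L'' → x ^ c * t ∈ L'' := by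
    intro t ht
    have : t ∈ F (m + c) := ht
    rw [← hc (m + c) (by omega)] at this
    exact this
  let μ : R →ₗ[R] LinearMap.ker (qm (le_sup_left : L'' ≤ L'' ⊔ Ideal.span {x ^ (m + c)})) :=
    LinearMap.codRestrict _ ((Submodule.mkQ L'').comp (LinearMap.mulLeft R (x ^ (m + c)))) (by
      intro t
      rw [LinearMap.mem_ker]
      refine (Submodule.Quotient.mk_eq_zero _).2 (Ideal.mem_sup_right ?_)
      exact Ideal.mul_mem_right _ _ (Ideal.mem_span_singleton_self _))
  have hμ : Function.Surjective μ := by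
    rintro ⟨z, hz⟩
    obtain ⟨t, rfl⟩ := Submodule.mkQ_surjective _ z
    have ht : t ∈ L'' ⊔ Ideal.span {x ^ (m + c)} := (Submodule.Quotient.mk_eq_zero _).1 hz
    obtain ⟨l, hl, w, hw, rfl⟩ := Submodule.mem_sup.1 ht
    obtain ⟨w, rfl⟩ := Ideal.mem_span_singleton.1 hw
    refine ⟨w, Subtype.ext ?_⟩
    refine (Submodule.Quotient.eq _).2 ?_
    simpa using hl
  obtain ⟨s, hs⟩ := exists_factor μ hμ ((Submodule.mkQ L'').comp (LinearMap.mulLeft R (x ^ c))) (by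
    intro t ht
    have h1 : x ^ (m + c) * t ∈ L'' := (Submodule.Quotient.mk_eq_zero _).1 (congrArg Subtype.val ht)
    exact (Submodule.Quotient.mk_eq_zero _).2 (hst t h1))
  let v : (R ⧸ L') →ₗ[R] LinearMap.ker (qm (le_sup_left : L' ≤ L' ⊔ Ideal.span {x ^ m})) :=
    LinearMap.codRestrict _ (x ^ m • LinearMap.id) (by
      intro z
      obtain ⟨t, rfl⟩ := Submodule.mkQ_surjective _ z
      rw [LinearMap.mem_ker]
      refine (Submodule.Quotient.mk_eq_zero _).2 (Ideal.mem_sup_right ?_)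
      exact Ideal.mul_mem_right _ _ (Ideal.mem_span_singleton_self _))
  have key : (SQmap (le_sup_left : L' ≤ L' ⊔ Ideal.span {x ^ m})
        (le_sup_left : L'' ≤ L'' ⊔ Ideal.span {x ^ (m + c)}) h hJ).τ₁ =
      (ModuleCat.ofHom s ≫ ρ h) ≫ ModuleCat.ofHom v := by
    apply ModuleCat.hom_ext
    apply LinearMap.ext
    intro z
    obtain ⟨t, rfl⟩ := hμ z
    apply Subtype.ext
    change qm h (Submodule.Quotient.mk (x ^ (m + c) * t)) = x ^ m • (qm h (s (μ t)))
    rw [hs]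
    change Submodule.Quotient.mk (x ^ (m + c) * t) =
      (Submodule.Quotient.mk (x ^ m * (x ^ c * t)) : R ⧸ L')
    rw [pow_add, mul_assoc]
  rw [key]
  exact (hn.pre _).post _

/-- pro-nullity -/
def PN (I : Ideal R) (j : ℕ) : Prop :=
  ∀ m : ℕ, ∃ n, ∃ hmn : m ≤ n, Null j (ρ (Ideal.pow_le_pow_right (I := I) hmn))

lemma PN_step [IsNoetherianRing R] (I : Ideal R) (x : R) (j : ℕ) (h : PN I j) :
    PN (I ⊔ Ideal.span {x}) (j + 1) := by
  intro m
  obtain ⟨a, hma, ha⟩ := h m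
  obtain ⟨b, hab, hb⟩ := h a
  obtain ⟨c, hc⟩ := ker_factor (Ideal.pow_le_pow_right (I := I) hab) x m hb
  have hJ2 : I ^ b ⊔ Ideal.span {x ^ (m + c)} ≤ I ^ a ⊔ Ideal.span {x ^ m} :=
    sup_le_sup (Ideal.pow_le_pow_right hab) (by
      rw [Ideal.span_singleton_le_span_singleton, pow_add]
      exact Dvd.intro _ rfl)
  have hJ1 : I ^ a ⊔ Ideal.span {x ^ m} ≤ I ^ m ⊔ Ideal.span {x ^ m} :=
    sup_le_sup (Ideal.pow_le_pow_right hma) le_rfl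
  have hN := null_ses (SQ_exact _) (SQ_exact _) _ (SQmap (le_sup_left : I ^ m ≤ I ^ m ⊔ Ideal.span {x ^ m})
    (le_sup_left : I ^ a ≤ I ^ a ⊔ Ideal.span {x ^ m}) (Ideal.pow_le_pow_right hma) hJ1)
    ha.succ (hc hJ2)
  have hin : (I ⊔ Ideal.span {x}) ^ (b + (m + c)) ≤ I ^ b ⊔ Ideal.span {x ^ (m + c)} := by
    rw [← Ideal.span_singleton_pow]
    exact Ideal.sup_pow_add_le_pow_sup_pow
  have hout : I ^ m ⊔ Ideal.span {x ^ m} ≤ (I ⊔ Ideal.span {x}) ^ m := by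
    rw [← Ideal.span_singleton_pow]
    exact sup_le (Ideal.pow_right_mono le_sup_left _) (Ideal.pow_right_mono le_sup_right _)
  refine ⟨b + (m + c), by omega, ?_⟩
  have := (hN.pre (ρ hin)).post (ρ hout)
  change Null (j + 1) ((ρ hin ≫ (ρ hJ2 ≫ ρ hJ1)) ≫ ρ hout) at this
  rwa [ρ_comp, ρ_comp, ρ_comp] at this

lemma PN_bot : PN (⊥ : Ideal R) 1 := by
  intro m
  refine ⟨m + 1, by omega, ?_⟩
  have h0 : (⊥ : Ideal R) ^ (m + 1) = ⊥ := by simp [pow_succ]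
  have e : Projective (Q (⊥ : Ideal R)) := by
    have : Module.Projective R (R ⧸ (⊥ : Ideal R)) :=
      Module.Projective.of_equiv (Submodule.quotEquivOfEqBot (⊥ : Ideal R) rfl).symm
    infer_instance
  have e' : Projective (Q ((⊥ : Ideal R) ^ (m + 1))) := by rw [h0]; exact e
  intro M x
  exact Abelian.Ext.eq_zero_of_projective _

lemma exists_PN [IsNoetherianRing R] (I : Ideal R) : ∃ r, PN I r := by
  obtain ⟨s, hs⟩ := (isNoetherianRing_iff_ideal_fg R).1 ‹_› I
  subst hs
  classical
  induction s using Finset.induction_on with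
  | empty => exact ⟨1, by simpa using PN_bot⟩
  | insert x s _ ih =>
    obtain ⟨r, hr⟩ := ih
    refine ⟨r + 1, ?_⟩
    have := PN_step _ x r hr
    rwa [Finset.coe_insert, ← Set.union_singleton, Ideal.span_union]

end CofAux

namespace CofAux

variable {R : Type u} [CommRing R]

lemma free_van {j p : ℕ} {A B : ModuleCat.{u} R} (f : A ⟶ B)
    (h : ∀ x : Abelian.Ext B (ModuleCat.of R R) j, (Abelian.Ext.mk₀ f).comp x (zero_add _) = 0)
    (y : Abelian.Ext B (ModuleCat.of R (Fin p → R)) j) :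
    (Abelian.Ext.mk₀ f).comp y (zero_add _) = 0 := by
  have hid : 𝟙 (ModuleCat.of R (Fin p → R)) = ∑ i : Fin p,
      (ModuleCat.ofHom (LinearMap.proj i : (Fin p → R) →ₗ[R] R) ≫
        ModuleCat.ofHom (LinearMap.single R (fun _ : Fin p => R) i)) := by
    apply ModuleCat.hom_ext
    apply LinearMap.ext
    intro v
    rw [ModuleCat.hom_sum]
    simp only [ModuleCat.hom_id, LinearMap.id_apply, LinearMap.sum_apply, ModuleCat.hom_comp,
      LinearMap.comp_apply, ModuleCat.hom_ofHom, LinearMap.proj_apply, LinearMap.single_apply]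
    exact (Finset.univ_sum_single v).symm
  have e : y = ∑ i : Fin p, (y.comp (Abelian.Ext.mk₀ (ModuleCat.ofHom (LinearMap.proj i : (Fin p → R) →ₗ[R] R))) (add_zero _)).comp
        (Abelian.Ext.mk₀ (ModuleCat.ofHom (LinearMap.single R (fun _ : Fin p => R) i))) (add_zero _) := by
    conv_lhs => rw [← Abelian.Ext.comp_mk₀_id y, hid, Abelian.Ext.mk₀_sum, Abelian.Ext.comp_sum]
    refine Finset.sum_congr rfl fun i _ => ?_
    rw [← Abelian.Ext.mk₀_comp_mk₀, Abelian.Ext.comp_assoc_of_third_deg_zero]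
  rw [e, Abelian.Ext.comp_sum]
  refine Finset.sum_eq_zero fun i _ => ?_
  rw [← Abelian.Ext.comp_assoc_of_third_deg_zero, h, Abelian.Ext.zero_comp]

lemma PN_descend [IsNoetherianRing R] (I : Ideal R) (i : ℕ)
    (h : Subsingleton (LC R I (i+1) (ModuleCat.of R R))) (hP : PN I (i + 2)) : PN I (i + 1) := by
  intro m
  obtain ⟨n, hmn, hn⟩ := hP m
  obtain ⟨k, hnk, hk⟩ := lc_van I i h n
  refine ⟨k, hmn.trans hnk, ?_⟩
  rw [← ρ_comp (Ideal.pow_le_pow_right (I := I) hnk) (Ideal.pow_le_pow_right (I := I) hmn)]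
  apply null_of_fg
  intro M _ x
  obtain ⟨p, f, hf⟩ := Module.Finite.exists_fin' R M
  have exac := LinearMap.shortExact_shortComplexKer hf
  have h0 : ((Abelian.Ext.mk₀ (ρ (Ideal.pow_le_pow_right (I := I) hmn))).comp x (zero_add _)).comp
      exac.extClass rfl = 0 := by
    rw [Abelian.Ext.comp_assoc (h₁₂ := zero_add _) (h₂₃ := rfl) (h := by omega)]
    exact hn _ _
  obtain ⟨y, hy⟩ := Abelian.Ext.covariant_sequence_exact₃ _ exac _ rfl h0
  rw [← Abelian.Ext.mk₀_comp_mk₀, Abelian.Ext.comp_assoc_of_second_deg_zero, ← hy,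
    ← Abelian.Ext.comp_assoc_of_third_deg_zero]
  have := free_van _ hk y
  rw [this, Abelian.Ext.zero_comp]

lemma PN_two [IsNoetherianRing R] (I : Ideal R)
    (hcd : ∀ i : ℕ, 2 ≤ i → Subsingleton (LC R I i (ModuleCat.of R R))) : PN I 2 := by
  obtain ⟨r, hr⟩ := exists_PN I
  have h1 : PN I (r + 2) := by
    intro m
    obtain ⟨n, hmn, hn⟩ := hr m
    exact ⟨n, hmn, hn.succ.succ⟩
  clear hr
  induction r with
  | zero => exact h1
  | succ r ih => exact ih (PN_descend I (r + 1) (hcd _ (by omega)) h1)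

end CofAux

namespace CofAux

variable {R : Type u} [CommRing R]

lemma fin_mid [IsNoetherianRing R] {A B C : Type*} [AddCommGroup A] [Module R A]
    [AddCommGroup B] [Module R B] [AddCommGroup C] [Module R C] (f : A →ₗ[R] B) (g : B →ₗ[R] C)
    (h : ∀ b, g b = 0 → ∃ a, f a = b) (hA : Module.Finite R A) (hC : Module.Finite R C) :
    Module.Finite R B := by
  have hA' : IsNoetherian R A := inferInstance
  have hC' : IsNoetherian R C := inferInstance
  have h1 : LinearMap.ker g ≤ LinearMap.range f := fun b hb => h b hb
  have h2 : IsNoetherian R (LinearMap.range f) := inferInstance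
  have h3 : IsNoetherian R (LinearMap.ker g) := isNoetherian_of_le h1
  have h4 : IsNoetherian R B := isNoetherian_of_range_eq_ker (LinearMap.ker g).subtype g (by simp)
  infer_instance

/-- finiteness of Ext -/
abbrev FE (A M : ModuleCat.{u} R) (n : ℕ) : Prop := Module.Finite R (Abelian.Ext A M n)

lemma cov2 [IsNoetherianRing R] {S : ShortComplex (ModuleCat.{u} R)} (hS : S.ShortExact)
    (X : ModuleCat.{u} R) (n : ℕ) (h1 : FE X S.X₁ n) (h3 : FE X S.X₃ n) : FE X S.X₂ n :=
  fin_mid ((Abelian.Ext.mk₀ S.f).postcompOfLinear R X (add_zero n))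
    ((Abelian.Ext.mk₀ S.g).postcompOfLinear R X (add_zero n))
    (fun b hb => Abelian.Ext.covariant_sequence_exact₂ X hS b hb) h1 h3

lemma cov1 [IsNoetherianRing R] {S : ShortComplex (ModuleCat.{u} R)} (hS : S.ShortExact)
    (X : ModuleCat.{u} R) (n : ℕ) (h1 : FE X S.X₃ n) (h3 : FE X S.X₂ (n + 1)) : FE X S.X₁ (n + 1) :=
  fin_mid (hS.extClass.postcompOfLinear R X rfl)
    ((Abelian.Ext.mk₀ S.f).postcompOfLinear R X (add_zero (n + 1)))
    (fun b hb => Abelian.Ext.covariant_sequence_exact₁ X hS b hb rfl) h1 h3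

lemma cov3 [IsNoetherianRing R] {S : ShortComplex (ModuleCat.{u} R)} (hS : S.ShortExact)
    (X : ModuleCat.{u} R) (n : ℕ) (h1 : FE X S.X₂ n) (h3 : FE X S.X₁ (n + 1)) : FE X S.X₃ n :=
  fin_mid ((Abelian.Ext.mk₀ S.g).postcompOfLinear R X (add_zero n))
    (hS.extClass.postcompOfLinear R X rfl)
    (fun b hb => Abelian.Ext.covariant_sequence_exact₃ X hS b rfl hb) h1 h3

lemma cov0 [IsNoetherianRing R] {S : ShortComplex (ModuleCat.{u} R)} (hS : S.ShortExact)
    (X : ModuleCat.{u} R) (h : FE X S.X₂ 0) : FE X S.X₁ 0 :=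
  have := hS.mono_f
  Module.Finite.of_injective ((Abelian.Ext.mk₀ S.f).postcompOfLinear R X (add_zero 0))
    (Abelian.Ext.postcomp_mk₀_injective_of_mono X S.f)

lemma con2 [IsNoetherianRing R] {S : ShortComplex (ModuleCat.{u} R)} (hS : S.ShortExact)
    (X : ModuleCat.{u} R) (n : ℕ) (h1 : FE S.X₃ X n) (h3 : FE S.X₁ X n) : FE S.X₂ X n :=
  fin_mid ((Abelian.Ext.mk₀ S.g).precompOfLinear R X (zero_add n))
    ((Abelian.Ext.mk₀ S.f).precompOfLinear R X (zero_add n))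
    (fun b hb => Abelian.Ext.contravariant_sequence_exact₂ hS X b hb) h1 h3

lemma con3 [IsNoetherianRing R] {S : ShortComplex (ModuleCat.{u} R)} (hS : S.ShortExact)
    (X : ModuleCat.{u} R) (n : ℕ) (h1 : FE S.X₁ X n) (h3 : FE S.X₂ X (n + 1)) : FE S.X₃ X (n + 1) :=
  fin_mid (hS.extClass.precompOfLinear R X (add_comm 1 n))
    ((Abelian.Ext.mk₀ S.g).precompOfLinear R X (zero_add (n + 1)))
    (fun b hb => Abelian.Ext.contravariant_sequence_exact₃ hS X b hb (add_comm 1 n)) h1 h3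

lemma con0 [IsNoetherianRing R] {S : ShortComplex (ModuleCat.{u} R)} (hS : S.ShortExact)
    (X : ModuleCat.{u} R) (h : FE S.X₂ X 0) : FE S.X₃ X 0 :=
  have := hS.epi_g
  Module.Finite.of_injective ((Abelian.Ext.mk₀ S.g).precompOfLinear R X (zero_add 0))
    (Abelian.Ext.precomp_mk₀_injective_of_epi X S.g)

lemma FE_iso {A B M : ModuleCat.{u} R} (e : A ≅ B) (n : ℕ) (h : FE B M n) : FE A M n := by
  refine Module.Finite.of_surjective ((Abelian.Ext.mk₀ e.hom).precompOfLinear R M (zero_add n)) ?_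
  intro x
  refine ⟨(Abelian.Ext.mk₀ e.inv).comp x (zero_add n), ?_⟩
  change (Abelian.Ext.mk₀ e.hom).comp ((Abelian.Ext.mk₀ e.inv).comp x (zero_add n)) (zero_add n) = x
  rw [← Abelian.Ext.comp_assoc_of_second_deg_zero, Abelian.Ext.mk₀_comp_mk₀, e.hom_inv_id,
    Abelian.Ext.mk₀_id_comp]

/-- devissage statement -/
def TT (I : Ideal R) (M : ModuleCat.{u} R) (i : ℕ) : Prop :=
  ∀ (N : Type u) [AddCommGroup N] [Module R N] [Module.Finite R N] (k : ℕ),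
    (∀ a ∈ I ^ k, ∀ z : N, a • z = 0) → FE (ModuleCat.of R N) M i

lemma devissage [IsNoetherianRing R] (I : Ideal R) (M : ModuleCat.{u} R) (i : ℕ)
    (hi : ∀ j, i = j + 1 → TT I M j) (h : FE (Q I) M i) : TT I M i := by
  intro N _ _ hN
  induction hN using IsNoetherianRing.induction_on_isQuotientEquivQuotientPrime R with
  | subsingleton N =>
    intro k _
    have hz : 𝟙 (ModuleCat.of R N) = 0 := by
      ext x
      exact Subsingleton.elim (α := N) _ _
    have : Subsingleton (Abelian.Ext (ModuleCat.of R N) M i) := by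
      refine subsingleton_of_forall_eq 0 fun x => ?_
      rw [← Abelian.Ext.mk₀_id_comp x, hz, Abelian.Ext.mk₀_zero, Abelian.Ext.zero_comp]
    infer_instance
  | quotient N p e =>
    intro k hk
    refine FE_iso e.toModuleIso i ?_
    have hIp : I ≤ p.1 := by
      have : I ^ k ≤ p.1 := by
        intro a ha
        have h1 := congrArg e (hk a ha (e.symm (Submodule.Quotient.mk 1)))
        rw [map_smul, e.apply_symm_apply, map_zero, ← Submodule.Quotient.mk_smul,
          Submodule.Quotient.mk_eq_zero] at h1
        simpa using h1
      exact Ideal.IsPrime.le_of_pow_le this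
    cases i with
    | zero => exact con0 (SQ_exact hIp) M h
    | succ j =>
      refine con3 (SQ_exact hIp) M j ?_ h
      refine hi j rfl (LinearMap.ker (qm hIp)) 1 ?_
      rintro a ha ⟨z, hz⟩
      rw [pow_one] at ha
      apply Subtype.ext
      change a • z = 0
      obtain ⟨t, rfl⟩ := Submodule.mkQ_surjective _ z
      exact (Submodule.Quotient.mk_eq_zero _).2 (I.mul_mem_right _ ha)
  | exact N₁ N₂ N₃ f g hf hg hfg h₁ h₃ =>
    intro k hk
    have hS : (ShortComplex.mk (ModuleCat.ofHom f) (ModuleCat.ofHom g)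
        (by ext x; exact hfg.apply_apply_eq_zero x)).ShortExact :=
      { exact := (ShortComplex.ShortExact.moduleCat_exact_iff_function_exact _).mpr hfg
        mono_f := (ModuleCat.mono_iff_injective _).mpr hf
        epi_g := (ModuleCat.epi_iff_surjective _).mpr hg }
    refine con2 hS M i (h₃ k ?_) (h₁ k ?_)
    · intro a ha z
      obtain ⟨z, rfl⟩ := hg z
      rw [← map_smul, hk a ha, map_zero]
    · intro a ha z
      apply hf
      rw [map_smul, hk a ha, map_zero]

lemma criterion [IsNoetherianRing R] (I : Ideal R)
    (hcd : ∀ i : ℕ, 2 ≤ i → Subsingleton (LC R I i (ModuleCat.of R R))) (M : ModuleCat.{u} R)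
    (h0 : FE (Q I) M 0) (h1 : FE (Q I) M 1) (i : ℕ) : FE (Q I) M i := by
  obtain ⟨n, hn, hN⟩ := PN_two I hcd 1
  have t0 : TT I M 0 := devissage I M 0 (fun j hj => by omega) h0
  have t1 : TT I M 1 := devissage I M 1 (fun j hj => by
    obtain rfl : j = 0 := by omega
    exact t0) h1
  have hle : I ^ n ≤ I := by simpa using Ideal.pow_le_pow_right (I := I) hn
  have hN' : Null 2 (ρ hle) := by
    have e : I ^ 1 = I := pow_one I
    have := hN.post (ρ e.le)
    rwa [ρ_comp] at this
  have t : ∀ j, TT I M (j + 1) := by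
    intro j
    induction j with
    | zero => exact t1
    | succ j ih =>
      refine devissage I M (j + 2) (fun k hk => ?_) ?_
      · obtain rfl : k = j + 1 := by omega
        exact ih
      · have hk : FE (SQ hle).X₁ M (j + 1) := by
          refine ih (LinearMap.ker (qm hle)) n ?_
          rintro a ha ⟨z, hz⟩
          apply Subtype.ext
          change a • z = 0
          obtain ⟨t, rfl⟩ := Submodule.mkQ_surjective _ z
          exact (Submodule.Quotient.mk_eq_zero _).2 ((I ^ n).mul_mem_right _ ha)
        refine Module.Finite.of_surjective
          ((SQ_exact hle).extClass.precompOfLinear R M (add_comm 1 (j + 1))) ?_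
        intro x
        exact Abelian.Ext.contravariant_sequence_exact₃ (SQ_exact hle) M x
          (hN'.mono (show 2 ≤ j + 2 by omega) M x) (add_comm 1 (j + 1))
  have tt : ∀ i, TT I M i := fun i => by
    cases i with
    | zero => exact t0
    | succ j => exact t j
  refine tt i (R ⧸ I) 1 ?_
  intro a ha z
  rw [pow_one] at ha
  obtain ⟨t, rfl⟩ := Submodule.mkQ_surjective _ z
  exact (Submodule.Quotient.mk_eq_zero _).2 (I.mul_mem_right _ ha)

end CofAux

namespace CofAux

variable {R : Type u} [CommRing R]

lemma FE_iso' {X A B : ModuleCat.{u} R} (e : A ≅ B) (n : ℕ) (h : FE X A n) : FE X B n := by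
  refine Module.Finite.of_surjective ((Abelian.Ext.mk₀ e.hom).postcompOfLinear R X (add_zero n)) ?_
  intro x
  refine ⟨x.comp (Abelian.Ext.mk₀ e.inv) (add_zero n), ?_⟩
  change (x.comp (Abelian.Ext.mk₀ e.inv) (add_zero n)).comp (Abelian.Ext.mk₀ e.hom) (add_zero n) = x
  rw [Abelian.Ext.comp_assoc_of_third_deg_zero, Abelian.Ext.mk₀_comp_mk₀, e.inv_hom_id,
    Abelian.Ext.comp_mk₀_id]

lemma ker_range [IsNoetherianRing R] (I : Ideal R)
    (hcd : ∀ i : ℕ, 2 ≤ i → Subsingleton (LC R I i (ModuleCat.of R R)))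
    {A B : Type u} [AddCommGroup A] [Module R A] [AddCommGroup B] [Module R B] (f : A →ₗ[R] B)
    (hA : ∀ i, FE (Q I) (ModuleCat.of R A) i) (hB : FE (Q I) (ModuleCat.of R B) 0) :
    (∀ i, FE (Q I) (ModuleCat.of R (LinearMap.ker f)) i) ∧
      ∀ i, FE (Q I) (ModuleCat.of R (LinearMap.range f)) i := by
  have hS := LinearMap.shortExact_shortComplexKer f.surjective_rangeRestrict
  have hr0 : FE (Q I) (ModuleCat.of R (LinearMap.range f)) 0 := by
    have : Mono (ModuleCat.ofHom (LinearMap.range f).subtype) :=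
      (ModuleCat.mono_iff_injective _).mpr (LinearMap.range f).injective_subtype
    exact Module.Finite.of_injective
      ((Abelian.Ext.mk₀ (ModuleCat.ofHom (LinearMap.range f).subtype)).postcompOfLinear R (Q I)
        (add_zero 0))
      (Abelian.Ext.postcomp_mk₀_injective_of_mono (Q I) _)
  have hk := criterion I hcd _ (cov0 hS (Q I) (hA 0)) (cov1 hS (Q I) 0 hr0 (hA 1))
  refine ⟨fun i => ?_, fun i => cov3 hS (Q I) i (hA i) (hk (i + 1))⟩
  have := hk i
  dsimp at this
  rwa [LinearMap.ker_rangeRestrict] at this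

lemma quot_fin [IsNoetherianRing R] (I : Ideal R) {B : Type u} [AddCommGroup B] [Module R B]
    (N : Submodule R B) (hB : ∀ i, FE (Q I) (ModuleCat.of R B) i)
    (hN : ∀ i, FE (Q I) (ModuleCat.of R N) i) (i : ℕ) : FE (Q I) (ModuleCat.of R (B ⧸ N)) i := by
  have hS := LinearMap.shortExact_shortComplexKer N.mkQ_surjective
  refine cov3 hS (Q I) i (hB i) ?_
  have := hN (i + 1)
  dsimp
  rwa [Submodule.ker_mkQ]

lemma sc_cofinite [IsNoetherianRing R] (I : Ideal R)
    (hcd : ∀ i : ℕ, 2 ≤ i → Subsingleton (LC R I i (ModuleCat.of R R)))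
    (S : ShortComplex (ModuleCat.{u} R)) (h1 : IsCofinite R I S.X₁) (h2 : IsCofinite R I S.X₂)
    (h3 : IsCofinite R I S.X₃) : IsCofinite R I S.homology := by
  have f1 : ∀ i, FE (Q I) S.X₁ i := fun i => (fin_iff _ _ _).1 (h1.2 i)
  have f2 : ∀ i, FE (Q I) S.X₂ i := fun i => (fin_iff _ _ _).1 (h2.2 i)
  have f3 : ∀ i, FE (Q I) S.X₃ i := fun i => (fin_iff _ _ _).1 (h3.2 i)
  have hk := (ker_range I hcd S.g.hom f2 (f3 0)).1
  have hb := (ker_range I hcd S.moduleCatToCycles f1 (hk 0)).2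
  have hq := quot_fin I (LinearMap.range S.moduleCatToCycles) hk hb
  refine ⟨?_, fun i => (fin_iff _ _ _).2 (FE_iso' S.moduleCatHomologyIso.symm i (hq i))⟩
  refine subset_trans ?_ h2.1
  rw [S.moduleCatHomologyIso.toLinearEquiv.support_eq]
  exact (Module.support_subset_of_surjective _
    (LinearMap.range S.moduleCatToCycles).mkQ_surjective).trans
    (Module.support_subset_of_injective _ (LinearMap.ker S.g.hom).injective_subtype)

end CofAux


theorem stmt6 (R : Type u) [CommRing R] [IsNoetherianRing R] [IsLocalRing R] (I : Ideal R)
    (hcd : ∀ i : ℕ, 2 ≤ i → Subsingleton (LC R I i (ModuleCat.of R R)))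
    (X : CochainComplex (ModuleCat.{u} R) ℤ)
    (hX : ∀ i : ℤ, IsCofinite R I (X.X i)) :
    ∀ i : ℤ, IsCofinite R I (X.homology i) := by 
  intro i
  exact CofAux.sc_cofinite I hcd (X.sc i) (hX _) (hX _) (hX _)
end
end

section
/- Let (R, m) be a commutative Noetherian local ring, I an ideal with cd(I, R) ≤ 1, M an I-cofinite R-module, and N a finitely generated R-module. Then Tor_i^R(N, M) and Ext_R^i(N, M) are I-cofinite for all i ≥ 0. -/
open CategoryTheory

noncomputable section

universe u

section PartA
open Limits Opposite
variable {R : Type u} [CommRing R]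

/-- the Hom complex -/
abbrev homCx {A : ModuleCat.{u} R} (P : ProjectiveResolution A) (Y : ModuleCat.{u} R) :
    CochainComplex (ModuleCat.{u} R) ℕ := P.complex.linearYonedaObj R Y

/-- the morphism underlying a cycle -/
def cycHom {A : ModuleCat.{u} R} (P : ProjectiveResolution A) (Y : ModuleCat.{u} R) (n : ℕ) :
    (homCx P Y).cycles n →ₗ[R] (P.complex.X n ⟶ Y) := ((homCx P Y).iCycles n).hom

lemma cycHom_injective {A : ModuleCat.{u} R} (P : ProjectiveResolution A) (Y : ModuleCat.{u} R)
    (n : ℕ) : Function.Injective (cycHom P Y n) := by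
  have : Mono ((homCx P Y).iCycles n) := inferInstance
  exact (ModuleCat.mono_iff_injective _).1 this

lemma cycHom_d {A : ModuleCat.{u} R} (P : ProjectiveResolution A) (Y : ModuleCat.{u} R) (n : ℕ)
    (z : (homCx P Y).cycles n) : P.complex.d (n+1) n ≫ cycHom P Y n z = 0 := by
  have h := (homCx P Y).iCycles_d n (n+1)
  have := congrArg (fun f => f.hom z) h
  exact this

lemma cycHom_surj {A : ModuleCat.{u} R} (P : ProjectiveResolution A) (Y : ModuleCat.{u} R) (n : ℕ)
    (f : P.complex.X n ⟶ Y) (hf : P.complex.d (n+1) n ≫ f = 0) : ∃ z, cycHom P Y n z = f := by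
  have h := ShortComplex.exact_of_f_is_kernel
    (ShortComplex.mk ((homCx P Y).iCycles n) ((homCx P Y).d n (n+1))
      ((homCx P Y).iCycles_d n (n+1)))
    ((homCx P Y).cyclesIsKernel n (n+1) (by simp))
  rw [ShortComplex.moduleCat_exact_iff] at h
  exact h f hf

lemma pi_surj {A : ModuleCat.{u} R} (P : ProjectiveResolution A) (Y : ModuleCat.{u} R) (n : ℕ) :
    Function.Surjective ((homCx P Y).homologyπ n).hom := by
  have : Epi ((homCx P Y).homologyπ n) := inferInstance
  exact (ModuleCat.epi_iff_surjective _).1 this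

lemma pi_eq_zero {A : ModuleCat.{u} R} (P : ProjectiveResolution A) (Y : ModuleCat.{u} R) (n m : ℕ)
    (hm : (ComplexShape.up ℕ).prev n = m)
    (z : (homCx P Y).cycles n) : ((homCx P Y).homologyπ n).hom z = 0 ↔
      ∃ g : P.complex.X m ⟶ Y, P.complex.d n m ≫ g = cycHom P Y n z := by
  have h := ShortComplex.exact_of_g_is_cokernel
    (ShortComplex.mk ((homCx P Y).toCycles m n) ((homCx P Y).homologyπ n) (by simp))
    ((homCx P Y).homologyIsCokernel m n hm)
  rw [ShortComplex.moduleCat_exact_iff] at h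
  constructor
  · intro hz
    obtain ⟨g, hg⟩ := h z hz
    refine ⟨g, ?_⟩
    rw [← hg]
    exact (congrArg (fun f => f.hom g) ((homCx P Y).toCycles_i m n)).symm
  · rintro ⟨g, hg⟩
    have : z = ((homCx P Y).toCycles m n).hom g := by
      apply cycHom_injective
      rw [← hg]
      exact (congrArg (fun f => f.hom g) ((homCx P Y).toCycles_i m n)).symm
    rw [this]
    exact congrArg (fun f => f.hom g) ((homCx P Y).toCycles_comp_homologyπ m n)

/-- class map to the derived Ext -/
def newCls {A : ModuleCat.{u} R} (P : ProjectiveResolution A) (Y : ModuleCat.{u} R) (n : ℕ) :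
    (homCx P Y).cycles n →ₗ[R] Abelian.Ext A Y n where
  toFun z := P.extMk (cycHom P Y n z) (n+1) rfl (cycHom_d P Y n z)
  map_add' x y := by simp [ProjectiveResolution.add_extMk]
  map_smul' r x := by
    rw [RingHom.id_apply, Abelian.Ext.smul_eq_comp_mk₀, ProjectiveResolution.extMk_comp_mk₀]
    congr 1
    simp

lemma newCls_surj {A : ModuleCat.{u} R} (P : ProjectiveResolution A) (Y : ModuleCat.{u} R) (n : ℕ) :
    Function.Surjective (newCls P Y n) := by
  intro a
  obtain ⟨f, hf, rfl⟩ := P.extMk_surjective a (n+1) rfl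
  obtain ⟨z, rfl⟩ := cycHom_surj P Y n f hf
  exact ⟨z, rfl⟩

lemma newCls_eq_zero {A : ModuleCat.{u} R} (P : ProjectiveResolution A) (Y : ModuleCat.{u} R)
    (n : ℕ) (z : (homCx P Y).cycles n) : newCls P Y n z = 0 ↔
      ((homCx P Y).homologyπ n).hom z = 0 := by
  rcases n with _ | n
  · rw [pi_eq_zero P Y 0 0 (by simp)]
    have e : P.complex.d 0 0 = 0 := P.complex.shape _ _ (by simp)
    simp only [e, zero_comp, exists_const]
    constructor
    · intro h
      symm
      have h1 : P.extMk (cycHom P Y 0 z) (0+1) rfl (cycHom_d P Y 0 z) = 0 := h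
      rw [← P.extEquivCohomologyClass.apply_eq_iff_eq,
        ProjectiveResolution.extEquivCohomologyClass_extMk,
        ProjectiveResolution.extEquivCohomologyClass_zero,
        CochainComplex.HomComplex.CohomologyClass.mk_eq_zero_iff,
        CochainComplex.HomComplex.Cocycle.toSingleMk_mem_coboundaries_iff _ _ _ _ _ 1 (by simp)] at h1
      obtain ⟨g, hg⟩ := h1
      have hz : IsZero (P.cochainComplex.X 1) := P.cochainComplex.isZero_of_isStrictlyLE 0 1 (by simp)
      rw [hz.eq_of_src g 0, comp_zero] at hg
      rw [← cancel_epi (P.cochainComplexXIso (-(0:ℕ)) 0 rfl).hom, ← hg, comp_zero]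
    · intro h
      have : z = 0 := cycHom_injective P Y 0 (by rw [← h, map_zero])
      rw [this, map_zero]
  · rw [pi_eq_zero P Y (n+1) n (by simp)]
    exact P.extMk_eq_zero_iff (cycHom P Y (n+1) z) (n+2) rfl (cycHom_d P Y _ z) n rfl

/-- class map to the old Ext -/
def oldCls {A : ModuleCat.{u} R} (P : ProjectiveResolution A) (Y : ModuleCat.{u} R) (n : ℕ) :
    (homCx P Y).cycles n →ₗ[R] ExtMod R n A Y :=
  ((homCx P Y).homologyπ n ≫ (P.isoExt (R := R) n Y).inv).hom

lemma oldCls_surj {A : ModuleCat.{u} R} (P : ProjectiveResolution A) (Y : ModuleCat.{u} R) (n : ℕ) :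
    Function.Surjective (oldCls P Y n) := by
  have : Epi ((homCx P Y).homologyπ n ≫ (P.isoExt (R := R) n Y).inv) := inferInstance
  exact (ModuleCat.epi_iff_surjective _).1 this

lemma oldCls_eq_zero {A : ModuleCat.{u} R} (P : ProjectiveResolution A) (Y : ModuleCat.{u} R)
    (n : ℕ) (z : (homCx P Y).cycles n) : oldCls P Y n z = 0 ↔
      ((homCx P Y).homologyπ n).hom z = 0 := by
  have : Mono (P.isoExt (R := R) n Y).inv := inferInstance
  have := (ModuleCat.mono_iff_injective _).1 this
  exact map_eq_zero_iff (P.isoExt (R := R) n Y).inv.hom this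

theorem exists_extEquiv (A Y : ModuleCat.{u} R) (n : ℕ) :
    Nonempty (ExtMod R n A Y ≃ₗ[R] Abelian.Ext A Y n) := by
  let P := projectiveResolution A
  have h : LinearMap.ker (oldCls P Y n) = LinearMap.ker (newCls P Y n) := by
    ext z
    rw [LinearMap.mem_ker, LinearMap.mem_ker, oldCls_eq_zero, newCls_eq_zero]
  exact ⟨((oldCls P Y n).quotKerEquivOfSurjective (oldCls_surj P Y n)).symm.trans
    ((Submodule.quotEquivOfEq _ _ h).trans
      ((newCls P Y n).quotKerEquivOfSurjective (newCls_surj P Y n)))⟩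

/-- functoriality of the Hom complex -/
def homCxMap {A A' : ModuleCat.{u} R} {P : ProjectiveResolution A} {P' : ProjectiveResolution A'}
    (φ : P'.complex ⟶ P.complex) (Y : ModuleCat.{u} R) : homCx P Y ⟶ homCx P' Y :=
  (HomologicalComplex.unopFunctor _ _).map
    ((((linearYoneda R (ModuleCat.{u} R)).obj Y).rightOp.mapHomologicalComplex _).map φ).op

lemma chase_aux {V : Type*} [Category V] {X Y Z W X' Y' : V} (a : X ⟶ Y) (b : Y ⟶ Z) (c : Z ⟶ W)
    (p : Y ⟶ Y') (q : Y' ⟶ W) (r : X ⟶ X') (s : X' ⟶ Y') (h1 : b ≫ c = p ≫ q)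
    (h2 : a ≫ p = r ≫ s) : (a ≫ b) ≫ c = r ≫ s ≫ q := by
  rw [Category.assoc, h1, ← Category.assoc, h2, Category.assoc]

lemma isoExt_inv_naturality {A A' : ModuleCat.{u} R} {P : ProjectiveResolution A}
    {P' : ProjectiveResolution A'} {g : A' ⟶ A}
    (φ : ProjectiveResolution.Hom P' P g) (Y : ModuleCat.{u} R) (n : ℕ) :
    (P.isoExt (R := R) n Y).inv ≫ ((Ext R (ModuleCat.{u} R) n).map g.op).app Y =
      HomologicalComplex.homologyMap (homCxMap φ.hom Y) n ≫ (P'.isoExt (R := R) n Y).inv := by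
  let F := ((linearYoneda R (ModuleCat.{u} R)).obj Y).rightOp
  have h1 := ProjectiveResolution.isoLeftDerivedObj_hom_naturality g P' P φ.hom
    φ.hom_f_zero_comp_π_f_zero F n
  have h2 := HomologicalComplex.homologyOp_hom_naturality (homCxMap φ.hom Y) n
  have h1' := congrArg Quiver.Hom.unop h1
  have h2' := congrArg Quiver.Hom.unop h2
  exact chase_aux _ _ _ _ _ _ _ h1' h2'

lemma oldCls_naturality {A A' : ModuleCat.{u} R} {P : ProjectiveResolution A}
    {P' : ProjectiveResolution A'} {g : A' ⟶ A}
    (φ : ProjectiveResolution.Hom P' P g) (Y : ModuleCat.{u} R) (n : ℕ)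
    (z : (homCx P Y).cycles n) (z' : (homCx P' Y).cycles n)
    (h : cycHom P' Y n z' = φ.hom.f n ≫ cycHom P Y n z) :
    (((Ext R (ModuleCat.{u} R) n).map g.op).app Y).hom (oldCls P Y n z) = oldCls P' Y n z' := by
  have hz : z' = (HomologicalComplex.cyclesMap (homCxMap φ.hom Y) n).hom z := by
    apply cycHom_injective
    rw [h]
    exact (congrArg (fun f => f.hom z) (HomologicalComplex.cyclesMap_i (homCxMap φ.hom Y) n)).symm
  have h1 := isoExt_inv_naturality φ Y n
  have h2 : ((homCx P Y).homologyπ n ≫ (P.isoExt (R := R) n Y).inv) ≫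
      ((Ext R (ModuleCat.{u} R) n).map g.op).app Y =
      HomologicalComplex.cyclesMap (homCxMap φ.hom Y) n ≫
        ((homCx P' Y).homologyπ n ≫ (P'.isoExt (R := R) n Y).inv) := by
    rw [Category.assoc, h1, HomologicalComplex.homologyπ_naturality_assoc]
  rw [hz]
  exact congrArg (fun f => f.hom z) h2

/-- every class that dies in the old Ext dies in the derived Ext -/
lemma new_dies {A : ModuleCat.{u} R} (Y : ModuleCat.{u} R) (n : ℕ) (a : Abelian.Ext A Y n) :
    ∃ b : ExtMod R n A Y, ∀ (A' : ModuleCat.{u} R) (g : A' ⟶ A),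
      (((Ext R (ModuleCat.{u} R) n).map g.op).app Y).hom b = 0 →
        (Abelian.Ext.mk₀ g).comp a (zero_add n) = 0 := by
  let P := projectiveResolution A
  obtain ⟨z, rfl⟩ := newCls_surj P Y n a
  refine ⟨oldCls P Y n z, fun A' g hg => ?_⟩
  let P' := projectiveResolution A'
  let φ : ProjectiveResolution.Hom P' P g :=
    { hom := ProjectiveResolution.lift g P' P
      hom_f_zero_comp_π_f_zero := by
        rw [← HomologicalComplex.comp_f, ProjectiveResolution.lift_commutes,
          HomologicalComplex.comp_f] }
  have hd : P'.complex.d (n+1) n ≫ φ.hom.f n ≫ cycHom P Y n z = 0 := by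
    rw [← φ.hom.comm_assoc, cycHom_d, comp_zero]
  obtain ⟨z', hz'⟩ := cycHom_surj P' Y n _ hd
  have hg : newCls P' Y n z' = 0 := by
    rw [newCls_eq_zero, ← oldCls_eq_zero]
    exact (oldCls_naturality φ Y n z z' hz').symm.trans hg
  change (Abelian.Ext.mk₀ g).comp (P.extMk (cycHom P Y n z) (n+1) rfl (cycHom_d P Y n z)) _ = 0
  rw [ProjectiveResolution.mk₀_comp_extMk _ _ _ _ φ, ← hg]
  change _ = P'.extMk (cycHom P' Y n z') (n+1) rfl (cycHom_d P' Y n z')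
  congr 1
  exact hz'.symm

/-- the projection `R/J → R/J'` -/
def prj {J J' : Ideal R} (h : J ≤ J') : ModuleCat.of R (R ⧸ J) ⟶ ModuleCat.of R (R ⧸ J') :=
  ModuleCat.ofHom (Submodule.mapQ J J' LinearMap.id h)

lemma lc_dies (I : Ideal R) (Y : ModuleCat.{u} R) (n : ℕ) (h : Subsingleton (LC R I n Y))
    (t : ℕ) (a : Abelian.Ext (ModuleCat.of R (R ⧸ I ^ t)) Y n) :
    ∃ (k : ℕ) (hk : t ≤ k), (Abelian.Ext.mk₀ (prj (Ideal.pow_le_pow_right (I := I) hk))).comp a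
      (zero_add n) = 0 := by
  obtain ⟨b, hb⟩ := new_dies Y n a
  let F := localCohomology.diagram (localCohomology.idealPowersDiagram I) n
  let G := (evaluation (ModuleCat.{u} R) (ModuleCat.{u} R)).obj Y
  have hc : IsColimit (G.mapCocone (colimit.cocone F)) :=
    isColimitOfPreserves G (colimit.isColimit F)
  have hs : Subsingleton (G.mapCocone (colimit.cocone F)).pt := h
  have : PreservesFilteredColimitsOfSize.{0, 0} (forget (ModuleCat.{u} R)) :=
    preservesFilteredColimitsOfSize_shrink.{0, u, 0, u} _
  have : PreservesColimitsOfShape ℕᵒᵖᵒᵖ (forget (ModuleCat.{u} R)) :=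
    PreservesFilteredColimitsOfSize.preserves_filtered_colimits _
  obtain ⟨k, f, g, hfg⟩ := Concrete.isColimit_exists_of_rep_eq (F ⋙ G) hc (i := op (op t))
    (j := op (op t)) b (0 : ExtMod R n (ModuleCat.of R (R ⧸ I ^ t)) Y)
    (hs.elim _ _)
  refine ⟨k.unop.unop, f.unop.unop.down.down, hb _ _ ?_⟩
  have : ((F ⋙ G).map g).hom (0 : ExtMod R n (ModuleCat.of R (R ⧸ I ^ t)) Y) = 0 := map_zero _
  exact hfg.trans this

end PartA

section PartB
open Opposite Abelian.Ext
variable {R : Type u} [CommRing R]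

/-- a short complex from linear maps -/
abbrev mkS {A B C : Type u} [AddCommGroup A] [Module R A] [AddCommGroup B] [Module R B]
    [AddCommGroup C] [Module R C] (f : A →ₗ[R] B) (g : B →ₗ[R] C) (h : Function.Exact f g) :
    ShortComplex (ModuleCat.{u} R) :=
  ShortComplex.mk (ModuleCat.ofHom f) (ModuleCat.ofHom g) (by
    rw [← ModuleCat.ofHom_comp, h.linearMap_comp_eq_zero]; rfl)

lemma mkS_shortExact {A B C : Type u} [AddCommGroup A] [Module R A] [AddCommGroup B] [Module R B]
    [AddCommGroup C] [Module R C] (f : A →ₗ[R] B) (g : B →ₗ[R] C) (h : Function.Exact f g)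
    (hf : Function.Injective f) (hg : Function.Surjective g) : (mkS f g h).ShortExact where
  exact := by
    rw [ShortComplex.ShortExact.moduleCat_exact_iff_function_exact]
    exact h
  mono_f := (ModuleCat.mono_iff_injective _).2 hf
  epi_g := (ModuleCat.epi_iff_surjective _).2 hg

/-- all Ext finite -/
def FE (A Y : ModuleCat.{u} R) (n : ℕ) : Prop := Module.Finite R (Abelian.Ext A Y n)

section fin
lemma finite_mid [IsNoetherianRing R] {A B C : Type*} [AddCommGroup A] [Module R A] [AddCommGroup B] [Module R B]
    [AddCommGroup C] [Module R C] (f : A →ₗ[R] B) (g : B →ₗ[R] C)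
    (hA : Module.Finite R A) (hC : Module.Finite R C) (h : Function.Exact f g) :
    Module.Finite R B := by
  have : IsNoetherian R A := isNoetherian_of_isNoetherianRing_of_finite R A
  have : IsNoetherian R C := isNoetherian_of_isNoetherianRing_of_finite R C
  have := isNoetherian_of_range_eq_ker f g h.linearMap_ker_eq.symm
  infer_instance


lemma exact_contra₁ {S : ShortComplex (ModuleCat.{u} R)} (hS : S.ShortExact) (Y : ModuleCat.{u} R)
    (n m : ℕ) (h : 1 + n = m) : Function.Exact
    ((mk₀ S.f).precompOfLinear R Y (zero_add n)) (hS.extClass.precompOfLinear R Y h) := by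
  intro x
  constructor
  · intro hx
    exact contravariant_sequence_exact₁ hS Y x h hx
  · rintro ⟨y, rfl⟩
    exact hS.extClass_comp_assoc (h := h) y

lemma exact_contra₂ {S : ShortComplex (ModuleCat.{u} R)} (hS : S.ShortExact) (Y : ModuleCat.{u} R)
    (n : ℕ) : Function.Exact
    ((mk₀ S.g).precompOfLinear R Y (zero_add n)) ((mk₀ S.f).precompOfLinear R Y (zero_add n)) := by
  intro x
  constructor
  · intro hx
    exact contravariant_sequence_exact₂ hS Y x hx
  · rintro ⟨y, rfl⟩
    change (mk₀ S.f).comp ((mk₀ S.g).comp y (zero_add n)) (zero_add n) = 0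
    rw [mk₀_comp_mk₀_assoc, S.zero, mk₀_zero, zero_comp]

lemma exact_contra₃ {S : ShortComplex (ModuleCat.{u} R)} (hS : S.ShortExact) (Y : ModuleCat.{u} R)
    (n m : ℕ) (h : 1 + n = m) : Function.Exact
    (hS.extClass.precompOfLinear R Y h) ((mk₀ S.g).precompOfLinear R Y (zero_add m)) := by
  intro x
  constructor
  · intro hx
    exact contravariant_sequence_exact₃ hS Y x hx h
  · rintro ⟨y, rfl⟩
    exact hS.comp_extClass_assoc y h

lemma exact_cov₁ {S : ShortComplex (ModuleCat.{u} R)} (hS : S.ShortExact) (Y : ModuleCat.{u} R)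
    (n m : ℕ) (h : n + 1 = m) : Function.Exact
    (hS.extClass.postcompOfLinear R Y h) ((mk₀ S.f).postcompOfLinear R Y (add_zero m)) := by
  intro x
  constructor
  · intro hx
    exact covariant_sequence_exact₁ Y hS x hx h
  · rintro ⟨y, rfl⟩
    change (y.comp hS.extClass h).comp (mk₀ S.f) (add_zero m) = 0
    rw [comp_assoc_of_third_deg_zero, hS.extClass_comp, comp_zero]

lemma exact_cov₂ {S : ShortComplex (ModuleCat.{u} R)} (hS : S.ShortExact) (Y : ModuleCat.{u} R)
    (n : ℕ) : Function.Exact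
    ((mk₀ S.f).postcompOfLinear R Y (add_zero n)) ((mk₀ S.g).postcompOfLinear R Y (add_zero n)) := by
  intro x
  constructor
  · intro hx
    exact covariant_sequence_exact₂ Y hS x hx
  · rintro ⟨y, rfl⟩
    change (y.comp (mk₀ S.f) (add_zero n)).comp (mk₀ S.g) (add_zero n) = 0
    rw [comp_assoc_of_third_deg_zero, mk₀_comp_mk₀, S.zero, mk₀_zero, comp_zero]

lemma exact_cov₃ {S : ShortComplex (ModuleCat.{u} R)} (hS : S.ShortExact) (Y : ModuleCat.{u} R)
    (n m : ℕ) (h : n + 1 = m) : Function.Exact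
    ((mk₀ S.g).postcompOfLinear R Y (add_zero n)) (hS.extClass.postcompOfLinear R Y h) := by
  intro x
  constructor
  · intro hx
    exact covariant_sequence_exact₃ Y hS x h hx
  · rintro ⟨y, rfl⟩
    change (y.comp (mk₀ S.g) (add_zero n)).comp hS.extClass h = 0
    rw [comp_assoc_of_second_deg_zero, hS.comp_extClass, comp_zero]

lemma FE_contra₂ [IsNoetherianRing R] {S : ShortComplex (ModuleCat.{u} R)} (hS : S.ShortExact) (Y : ModuleCat.{u} R)
    {n : ℕ} (h1 : FE S.X₁ Y n) (h3 : FE S.X₃ Y n) : FE S.X₂ Y n :=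
  finite_mid _ _ h3 h1 (exact_contra₂ hS Y n)

lemma FE_contra₃ [IsNoetherianRing R] {S : ShortComplex (ModuleCat.{u} R)} (hS : S.ShortExact) (Y : ModuleCat.{u} R)
    {n : ℕ} (h1 : FE S.X₁ Y n) (h2 : FE S.X₂ Y (n+1)) : FE S.X₃ Y (n+1) :=
  finite_mid _ _ h1 h2 (exact_contra₃ hS Y n (n+1) (add_comm _ _))

lemma FE_contra₃_zero [IsNoetherianRing R] {S : ShortComplex (ModuleCat.{u} R)} (hS : S.ShortExact) (Y : ModuleCat.{u} R)
    (h2 : FE S.X₂ Y 0) : FE S.X₃ Y 0 := by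
  have := hS.epi_g
  have : Module.Finite R (Abelian.Ext S.X₂ Y 0) := h2
  exact Module.Finite.of_injective ((mk₀ S.g).precompOfLinear R Y (zero_add 0))
    (precomp_mk₀_injective_of_epi Y S.g)

lemma FE_cov₂ [IsNoetherianRing R] {S : ShortComplex (ModuleCat.{u} R)} (hS : S.ShortExact) (Y : ModuleCat.{u} R)
    {n : ℕ} (h1 : FE Y S.X₁ n) (h3 : FE Y S.X₃ n) : FE Y S.X₂ n :=
  finite_mid _ _ h1 h3 (exact_cov₂ hS Y n)

lemma FE_cov₃ [IsNoetherianRing R] {S : ShortComplex (ModuleCat.{u} R)} (hS : S.ShortExact) (Y : ModuleCat.{u} R)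
    {n : ℕ} (h2 : FE Y S.X₂ n) (h1 : FE Y S.X₁ (n+1)) : FE Y S.X₃ n :=
  finite_mid _ _ h2 h1 (exact_cov₃ hS Y n (n+1) rfl)

lemma FE_cov₁ [IsNoetherianRing R] {S : ShortComplex (ModuleCat.{u} R)} (hS : S.ShortExact) (Y : ModuleCat.{u} R)
    {n : ℕ} (h3 : FE Y S.X₃ n) (h2 : FE Y S.X₂ (n+1)) : FE Y S.X₁ (n+1) :=
  finite_mid _ _ h3 h2 (exact_cov₁ hS Y n (n+1) rfl)

lemma FE_cov₁_zero [IsNoetherianRing R] {S : ShortComplex (ModuleCat.{u} R)} (hS : S.ShortExact) (Y : ModuleCat.{u} R)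
    (h2 : FE Y S.X₂ 0) : FE Y S.X₁ 0 := by
  have := hS.mono_f
  have : Module.Finite R (Abelian.Ext Y S.X₂ 0) := h2
  exact Module.Finite.of_injective ((mk₀ S.f).postcompOfLinear R Y (add_zero 0))
    (postcomp_mk₀_injective_of_mono Y S.f)

end fin

lemma prj_surj {J J' : Ideal R} (h : J ≤ J') :
    Function.Surjective (Submodule.mapQ J J' LinearMap.id h) := by
  intro y
  obtain ⟨y, rfl⟩ := Submodule.mkQ_surjective _ y
  exact ⟨Submodule.Quotient.mk y, by simp⟩

lemma prj_comp {J J' J'' : Ideal R} (h : J ≤ J') (h' : J' ≤ J'') :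
    prj h ≫ prj h' = prj (h.trans h') := by
  refine ModuleCat.hom_ext (LinearMap.ext fun x => ?_)
  obtain ⟨x, rfl⟩ := Submodule.mkQ_surjective _ x
  rfl

/-- kernel sequence of a surjection -/
abbrev kerS {A B : Type u} [AddCommGroup A] [Module R A] [AddCommGroup B] [Module R B]
    (g : A →ₗ[R] B) : ShortComplex (ModuleCat.{u} R) :=
  mkS (LinearMap.ker g).subtype g (LinearMap.exact_subtype_ker_map g)

lemma kerS_shortExact {A B : Type u} [AddCommGroup A] [Module R A] [AddCommGroup B] [Module R B]
    (g : A →ₗ[R] B) (hg : Function.Surjective g) : (kerS g).ShortExact :=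
  mkS_shortExact _ _ _ (Submodule.subtype_injective _) hg

lemma subsingleton_ext_left (A Y : ModuleCat.{u} R) [Subsingleton A] (n : ℕ) :
    Subsingleton (Abelian.Ext A Y n) := by
  refine ⟨fun a b => ?_⟩
  have h : 𝟙 A = 0 := by ext x; exact Subsingleton.elim _ _
  rw [← mk₀_id_comp a, ← mk₀_id_comp b, h, mk₀_zero, Abelian.Ext.zero_comp, Abelian.Ext.zero_comp]

lemma subsingleton_ext_right (A Y : ModuleCat.{u} R) [Subsingleton Y] (n : ℕ) :
    Subsingleton (Abelian.Ext A Y n) := by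
  refine ⟨fun a b => ?_⟩
  have h : 𝟙 Y = 0 := by ext x; exact Subsingleton.elim _ _
  rw [← comp_mk₀_id a, ← comp_mk₀_id b, h, mk₀_zero, comp_zero, comp_zero]

lemma support_quot (I : Ideal R) : Module.support R (R ⧸ I) = PrimeSpectrum.zeroLocus (I : Set R) := by
  rw [Module.support_eq_zeroLocus, Ideal.annihilator_quotient]

lemma FE_of_supp [IsNoetherianRing R] (I : Ideal R) (Y : ModuleCat.{u} R) (n : ℕ)
    (h : ∀ j ≤ n, FE (ModuleCat.of R (R ⧸ I)) Y j) :
    ∀ (T : Type u) [AddCommGroup T] [Module R T] [Module.Finite R T],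
      Module.support R T ⊆ PrimeSpectrum.zeroLocus (I : Set R) → FE (ModuleCat.of R T) Y n := by
  induction n with
  | zero =>
    intro T _ _ hT
    induction hT using IsNoetherianRing.induction_on_isQuotientEquivQuotientPrime R with
    | subsingleton N =>
      intro _
      have := subsingleton_ext_left (ModuleCat.of R N) Y 0
      exact Module.Finite.of_finite
    | quotient N p f =>
      intro hN
      rw [LinearEquiv.support_eq f, support_quot] at hN
      have hIp : I ≤ p.1 := hN (show p ∈ _ from fun x hx => hx)
      let g : (R ⧸ I) →ₗ[R] N := f.symm.toLinearMap ∘ₗ Submodule.mapQ I p.1 LinearMap.id hIp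
      exact FE_contra₃_zero (kerS_shortExact g (f.symm.surjective.comp (prj_surj _))) Y (h 0 le_rfl)
    | exact N₁ N₂ N₃ f g hf hg hfg h₁ h₃ =>
      intro hN
      exact FE_contra₂ (mkS_shortExact f g hfg hf hg) Y
        (h₁ ((Module.support_subset_of_injective f hf).trans hN))
        (h₃ ((Module.support_subset_of_surjective g hg).trans hN))
  | succ n ih =>
    intro T _ _ hT
    induction hT using IsNoetherianRing.induction_on_isQuotientEquivQuotientPrime R with
    | subsingleton N =>
      intro _
      have := subsingleton_ext_left (ModuleCat.of R N) Y (n+1)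
      exact Module.Finite.of_finite
    | quotient N p f =>
      intro hN
      rw [LinearEquiv.support_eq f, support_quot] at hN
      have hIp : I ≤ p.1 := hN (show p ∈ _ from fun x hx => hx)
      let g : (R ⧸ I) →ₗ[R] N := f.symm.toLinearMap ∘ₗ Submodule.mapQ I p.1 LinearMap.id hIp
      refine FE_contra₃ (kerS_shortExact g (f.symm.surjective.comp (prj_surj _))) Y ?_ (h _ le_rfl)
      refine ih (fun j hj => h j (by omega)) (LinearMap.ker g) ?_
      rw [← support_quot]
      exact Module.support_subset_of_injective _ (Submodule.subtype_injective _)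
    | exact N₁ N₂ N₃ f g hf hg hfg h₁ h₃ =>
      intro hN
      exact FE_contra₂ (mkS_shortExact f g hfg hf hg) Y
        (h₁ ((Module.support_subset_of_injective f hf).trans hN))
        (h₃ ((Module.support_subset_of_surjective g hg).trans hN))

end PartB

section PartC
open Opposite Abelian.Ext
variable {R : Type u} [CommRing R]

/-- small projections -/
def PSmall {J' J : Ideal R} (h : J' ≤ J) (n : ℕ) : Prop :=
  ∀ i, n < i → ∀ (Y : ModuleCat.{u} R) (e : Abelian.Ext (ModuleCat.of R (R ⧸ J)) Y i),
    (mk₀ (prj h)).comp e (zero_add i) = 0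

lemma PSmall.post {J'' J' J : Ideal R} {h' : J'' ≤ J'} {n : ℕ} (H : PSmall h' n) (h : J' ≤ J) :
    PSmall (h'.trans h) n := by
  intro i hi Y e
  rw [← prj_comp h' h, ← mk₀_comp_mk₀_assoc]
  exact H i hi Y _

/-- auxiliary kernel sequence -/
abbrev LS (J : Ideal R) (y : R) : ShortComplex (ModuleCat.{u} R) :=
  kerS (Submodule.mapQ J (J ⊔ Ideal.span {y}) LinearMap.id le_sup_left)

lemma LS_exact (J : Ideal R) (y : R) : (LS J y).ShortExact :=
  kerS_shortExact _ (prj_surj _)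

/-- multiplication into the kernel -/
def multL (J : Ideal R) (y : R) :
    (R ⧸ J) →ₗ[R] LinearMap.ker (Submodule.mapQ J (J ⊔ Ideal.span {y}) LinearMap.id le_sup_left) :=
  LinearMap.codRestrict _ (LinearMap.lsmul R (R ⧸ J) y) (by
    intro a
    obtain ⟨a, rfl⟩ := Submodule.mkQ_surjective _ a
    rw [LinearMap.mem_ker]
    change (Submodule.Quotient.mk (y * a) : R ⧸ (J ⊔ Ideal.span {y})) = 0
    rw [Submodule.Quotient.mk_eq_zero]
    exact Ideal.mem_sup_right (Ideal.mul_mem_right _ _ (Ideal.mem_span_singleton_self _)))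

lemma multL_surj (J : Ideal R) (y : R) : Function.Surjective (multL J y) := by
  rintro ⟨a, ha⟩
  obtain ⟨a, rfl⟩ := Submodule.mkQ_surjective _ a
  rw [LinearMap.mem_ker] at ha
  change (Submodule.Quotient.mk a : R ⧸ (J ⊔ Ideal.span {y})) = 0 at ha
  rw [Submodule.Quotient.mk_eq_zero] at ha
  obtain ⟨j, hj, z, hz, rfl⟩ := Submodule.mem_sup.1 ha
  obtain ⟨b, rfl⟩ := Ideal.mem_span_singleton.1 hz
  refine ⟨Submodule.Quotient.mk b, Subtype.ext ?_⟩
  change (Submodule.Quotient.mk (y * b) : R ⧸ J) = Submodule.Quotient.mk (j + y * b)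
  rw [Submodule.Quotient.eq]
  simpa using hj

lemma small_step {J2 J1 J0 : Ideal R} (h21 : J2 ≤ J1) (h10 : J1 ≤ J0) (n : ℕ)
    (H21 : PSmall h21 n) (H10 : PSmall h10 n) (x : R) (t c : ℕ)
    (hc : ∀ a, x ^ (t + c) * a ∈ J2 → x ^ c * a ∈ J2)
    (h : J2 ⊔ Ideal.span {x ^ (t + c)} ≤ J0 ⊔ Ideal.span {x ^ t}) : PSmall h (n + 1) := by
  intro i hi Y e
  obtain ⟨j, rfl⟩ : ∃ j, i = 1 + j := ⟨i - 1, by omega⟩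
  have ha : J1 ⊔ Ideal.span {x ^ t} ≤ J0 ⊔ Ideal.span {x ^ t} := sup_le_sup_right h10 _
  have hb : J2 ⊔ Ideal.span {x ^ (t + c)} ≤ J1 ⊔ Ideal.span {x ^ t} := by
    refine sup_le_sup h21 ?_
    rw [Ideal.span_singleton_le_span_singleton]
    exact pow_dvd_pow _ (by omega)
  rw [← prj_comp hb ha, ← mk₀_comp_mk₀_assoc]
  obtain ⟨f, hf⟩ := contravariant_sequence_exact₃ (LS_exact J1 (x ^ t)) Y
    ((mk₀ (prj ha)).comp e (zero_add _)) (by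
      have : (mk₀ (LS J1 (x^t)).g).comp ((mk₀ (prj ha)).comp e (zero_add _)) (zero_add _)
        = (mk₀ (prj h10)).comp ((mk₀ (prj (le_sup_left (b := Ideal.span {x ^ t})))).comp e (zero_add _)) (zero_add _) := by
        rw [mk₀_comp_mk₀_assoc, mk₀_comp_mk₀_assoc, prj_comp]
        rw [← prj_comp le_sup_left ha]
        rfl
      rw [this]
      exact H10 _ (by omega) Y _) rfl
  rw [← hf]
  let τ : LinearMap.ker (Submodule.mapQ J2 (J2 ⊔ Ideal.span {x ^ (t + c)}) LinearMap.id le_sup_left)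
      →ₗ[R] LinearMap.ker (Submodule.mapQ J1 (J1 ⊔ Ideal.span {x ^ t}) LinearMap.id le_sup_left) :=
    LinearMap.restrict (Submodule.mapQ J2 J1 LinearMap.id h21) (by
      intro a ha
      obtain ⟨a, rfl⟩ := Submodule.mkQ_surjective _ a
      rw [LinearMap.mem_ker] at ha ⊢
      change (Submodule.Quotient.mk a : R ⧸ (J2 ⊔ Ideal.span {_})) = 0 at ha
      change (Submodule.Quotient.mk a : R ⧸ (J1 ⊔ Ideal.span {_})) = 0
      rw [Submodule.Quotient.mk_eq_zero] at ha ⊢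
      exact hb ha)
  let φ : LS J2 (x ^ (t + c)) ⟶ LS J1 (x ^ t) :=
    { τ₁ := ModuleCat.ofHom τ
      τ₂ := prj h21
      τ₃ := prj hb
      comm₁₂ := rfl
      comm₂₃ := by
        change prj h21 ≫ prj le_sup_left = prj le_sup_left ≫ prj hb
        rw [prj_comp, prj_comp] }
  have hnat := ShortComplex.ShortExact.extClass_naturality (LS_exact J2 (x ^ (t + c)))
    (LS_exact J1 (x ^ t)) φ
  let u := multL J2 (x ^ (t + c))
  let ρ0 : ((R ⧸ J2) ⧸ LinearMap.ker u) →ₗ[R] (R ⧸ J2) :=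
    (LinearMap.ker u).liftQ (LinearMap.lsmul R (R ⧸ J2) (x ^ c)) (by
      intro a ha
      obtain ⟨a, rfl⟩ := Submodule.mkQ_surjective _ a
      rw [LinearMap.mem_ker] at ha ⊢
      have ha' := congrArg Subtype.val ha
      change (Submodule.Quotient.mk (x ^ (t + c) * a) : R ⧸ J2) = 0 at ha'
      change (Submodule.Quotient.mk (x ^ c * a) : R ⧸ J2) = 0
      rw [Submodule.Quotient.mk_eq_zero] at ha' ⊢
      exact hc a ha')
  let ρ := ρ0 ∘ₗ (u.quotKerEquivOfSurjective (multL_surj _ _)).symm.toLinearMap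
  have hρ : ∀ a, ρ (u a) = x ^ c • a := by
    intro a
    have : (u.quotKerEquivOfSurjective (multL_surj _ _)).symm (u a) = Submodule.Quotient.mk a := by
      rw [LinearEquiv.symm_apply_eq]
      rfl
    change ρ0 ((u.quotKerEquivOfSurjective (multL_surj _ _)).symm (u a)) = _
    rw [this]
    rfl
  have hτ : ModuleCat.ofHom τ =
      ModuleCat.ofHom ρ ≫ prj h21 ≫ ModuleCat.ofHom (multL J1 (x ^ t)) := by
    refine ModuleCat.hom_ext (LinearMap.ext fun l => ?_)
    obtain ⟨a, rfl⟩ := multL_surj _ _ l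
    change τ (u a) = multL J1 (x ^ t) (Submodule.mapQ J2 J1 LinearMap.id h21 (ρ (u a)))
    rw [hρ]
    obtain ⟨a, rfl⟩ := Submodule.mkQ_surjective _ a
    refine Subtype.ext ?_
    change (Submodule.Quotient.mk (x ^ (t + c) * a) : R ⧸ J1) =
      Submodule.Quotient.mk (x ^ t * (x ^ c * a))
    rw [pow_add, mul_assoc]
  have hz : (mk₀ (ModuleCat.ofHom τ)).comp f (zero_add _) = 0 := by
    rw [hτ, ← mk₀_comp_mk₀_assoc, ← mk₀_comp_mk₀_assoc]
    rw [H21 j (by omega) Y ((mk₀ (ModuleCat.ofHom (multL J1 (x ^ t)))).comp f (zero_add _))]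
    rw [Abelian.Ext.comp_zero]
  calc _ = ((mk₀ φ.τ₃).comp (LS_exact J1 (x ^ t)).extClass (zero_add 1)).comp f rfl :=
        (comp_assoc _ _ _ _ _ (by omega)).symm
    _ = (LS_exact J2 (x ^ (t + c))).extClass.comp ((mk₀ φ.τ₁).comp f (zero_add _)) rfl := by
        rw [← hnat]
        exact comp_assoc _ _ _ _ _ (by omega)
    _ = 0 := by
        change (LS_exact J2 (x ^ (t + c))).extClass.comp
          ((mk₀ (ModuleCat.ofHom τ)).comp f (zero_add _)) rfl = 0
        rw [hz, Abelian.Ext.comp_zero]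

lemma exists_small [IsNoetherianRing R] (s : Finset R) : ∃ n, ∀ J : Ideal R,
    (∃ t, (Ideal.span (s : Set R)) ^ t ≤ J) → ∃ (J' : Ideal R) (h : J' ≤ J),
      (∃ k, (Ideal.span (s : Set R)) ^ k ≤ J') ∧ PSmall h n := by
  classical
  induction s using Finset.induction with
  | empty =>
    refine ⟨0, fun J _ => ⟨⊥, bot_le, ⟨1, by simp⟩, ?_⟩⟩
    intro i hi Y e
    have : Module.Projective R (R ⧸ (⊥ : Ideal R)) :=
      Module.Projective.of_equiv (Submodule.quotEquivOfEqBot (⊥ : Ideal R) rfl).symm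
    have : Projective (ModuleCat.of R (R ⧸ (⊥ : Ideal R))) :=
      (IsProjective.iff_projective _).1 this
    obtain ⟨j, rfl⟩ : ∃ j, i = j + 1 := ⟨i - 1, by omega⟩
    exact Abelian.Ext.eq_zero_of_projective _
  | insert x s hx ih =>
    obtain ⟨n, ih⟩ := ih
    refine ⟨n + 1, fun J ⟨t, ht⟩ => ?_⟩
    rw [Finset.coe_insert, Ideal.span_insert, sup_comm] at ht ⊢
    set I' := Ideal.span (s : Set R)
    obtain ⟨J1, h1, hJ1, H1⟩ := ih (I' ^ t) ⟨t, le_rfl⟩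
    obtain ⟨J2, h2, ⟨k, hk⟩, H2⟩ := ih J1 hJ1
    obtain ⟨c, hc⟩ := Filter.eventually_atTop.1
      (LinearMap.eventually_iSup_ker_pow_eq (LinearMap.lsmul R (R ⧸ J2) x))
    have hle : J2 ⊔ Ideal.span {x ^ (t + c)} ≤ I' ^ t ⊔ Ideal.span {x ^ t} := by
      refine sup_le_sup (h2.trans h1) ?_
      rw [Ideal.span_singleton_le_span_singleton]
      exact pow_dvd_pow _ (by omega)
    have hle' : I' ^ t ⊔ Ideal.span {x ^ t} ≤ J := by
      refine sup_le ((Ideal.pow_right_mono le_sup_left t).trans ht) ?_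
      rw [← Ideal.span_singleton_pow]
      exact (Ideal.pow_right_mono le_sup_right t).trans ht
    refine ⟨J2 ⊔ Ideal.span {x ^ (t + c)}, hle.trans hle', ⟨k + (t + c), ?_⟩, ?_⟩
    · refine (Ideal.sup_pow_add_le_pow_sup_pow).trans (sup_le_sup hk ?_)
      rw [Ideal.span_singleton_pow]
    · refine PSmall.post (small_step h2 h1 n H2 H1 x t c ?_ hle) hle'
      intro a ha
      have hpow : ∀ m b, ((LinearMap.lsmul R (R ⧸ J2) x) ^ m) (Submodule.Quotient.mk b) =
          Submodule.Quotient.mk (x ^ m * b) := by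
        intro m
        induction m with
        | zero => intro b; simp
        | succ m ihm =>
          intro b
          rw [pow_succ', Module.End.mul_apply, ihm, pow_succ', mul_assoc]
          rfl
      have h1 : (Submodule.Quotient.mk a : R ⧸ J2) ∈
          LinearMap.ker ((LinearMap.lsmul R (R ⧸ J2) x) ^ (t + c)) := by
        rw [LinearMap.mem_ker, hpow, Submodule.Quotient.mk_eq_zero]; exact ha
      rw [← hc (t + c) (by omega), hc c le_rfl, LinearMap.mem_ker, hpow,
        Submodule.Quotient.mk_eq_zero] at h1
      exact h1

end PartC

section PartD
open Opposite Abelian.Ext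
variable {R : Type u} [CommRing R]

/-- Ext classes die along the projections -/
def Dies (I : Ideal R) (Y : ModuleCat.{u} R) (n : ℕ) : Prop :=
  ∀ J : Ideal R, (∃ t, I ^ t ≤ J) → ∀ a : Abelian.Ext (ModuleCat.of R (R ⧸ J)) Y n,
    ∃ (J' : Ideal R) (h : J' ≤ J), (∃ k, I ^ k ≤ J') ∧ (mk₀ (prj h)).comp a (zero_add n) = 0

lemma dies_of_lc (I : Ideal R) (Y : ModuleCat.{u} R) (n : ℕ) (h : Subsingleton (LC R I n Y)) :
    Dies I Y n := by
  rintro J ⟨t, ht⟩ a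
  obtain ⟨k, hk, H⟩ := lc_dies I Y n h t ((mk₀ (prj ht)).comp a (zero_add n))
  refine ⟨I ^ k, (Ideal.pow_le_pow_right hk).trans ht, ⟨k, le_rfl⟩, ?_⟩
  rw [mk₀_comp_mk₀_assoc, prj_comp] at H
  exact H

lemma dies_cov₂ {S : ShortComplex (ModuleCat.{u} R)} (hS : S.ShortExact) (I : Ideal R) (n : ℕ)
    (h1 : Dies I S.X₁ n) (h3 : Dies I S.X₃ n) : Dies I S.X₂ n := by
  intro J hJ a
  obtain ⟨J1, hj1, hJ1, H1⟩ := h3 J hJ (a.comp (mk₀ S.g) (add_zero n))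
  obtain ⟨b, hb⟩ := covariant_sequence_exact₂ _ hS ((mk₀ (prj hj1)).comp a (zero_add n)) (by
    rw [comp_assoc_of_third_deg_zero]; exact H1)
  obtain ⟨J2, hj2, hJ2, H2⟩ := h1 J1 hJ1 b
  refine ⟨J2, hj2.trans hj1, hJ2, ?_⟩
  rw [← prj_comp hj2 hj1, ← mk₀_comp_mk₀_assoc, ← hb, ← comp_assoc_of_third_deg_zero, H2,
    Abelian.Ext.zero_comp]

lemma dies_cov₃ {S : ShortComplex (ModuleCat.{u} R)} (hS : S.ShortExact) (I : Ideal R) (n : ℕ)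
    (h2 : Dies I S.X₂ n) (h1 : Dies I S.X₁ (n + 1)) : Dies I S.X₃ n := by
  intro J hJ a
  obtain ⟨J1, hj1, hJ1, H1⟩ := h1 J hJ (a.comp hS.extClass rfl)
  obtain ⟨b, hb⟩ := covariant_sequence_exact₃ _ hS ((mk₀ (prj hj1)).comp a (zero_add n)) rfl (by
    rw [comp_assoc (h := by omega)]
    · exact H1)
  obtain ⟨J2, hj2, hJ2, H2⟩ := h2 J1 hJ1 b
  refine ⟨J2, hj2.trans hj1, hJ2, ?_⟩
  rw [← prj_comp hj2 hj1, ← mk₀_comp_mk₀_assoc, ← hb, ← comp_assoc_of_third_deg_zero, H2,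
    Abelian.Ext.zero_comp]

lemma dies_all [IsNoetherianRing R] (I : Ideal R)
    (hcd : ∀ i : ℕ, 2 ≤ i → Subsingleton (LC R I i (ModuleCat.of R R))) :
    ∀ n, 2 ≤ n → ∀ (Z : Type u) [AddCommGroup Z] [Module R Z] [Module.Finite R Z],
      Dies I (ModuleCat.of R Z) n := by
  obtain ⟨s, rfl⟩ := IsNoetherian.noetherian I
  obtain ⟨N, hN⟩ := exists_small s
  suffices H : ∀ k n, 2 ≤ n → N < n + k → ∀ (Z : Type u) [AddCommGroup Z] [Module R Z]
      [Module.Finite R Z], Dies (Submodule.span R (s : Set R)) (ModuleCat.of R Z) n by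
    intro n hn
    exact H (N + 1) n hn (by omega)
  intro k
  induction k with
  | zero =>
    intro n hn hk Z _ _ _ J hJ a
    obtain ⟨J', h, hJ', HH⟩ := hN J hJ
    exact ⟨J', h, hJ', HH n (by omega) _ a⟩
  | succ k ih =>
    intro n hn hk Z _ _ hZ
    induction hZ using IsNoetherianRing.induction_on_isQuotientEquivQuotientPrime R with
    | subsingleton Z =>
      intro J hJ a
      have := subsingleton_ext_right (ModuleCat.of R (R ⧸ J)) (ModuleCat.of R Z) n
      have ha : a = 0 := Subsingleton.elim _ _
      exact ⟨J, le_rfl, hJ, by rw [ha, Abelian.Ext.comp_zero]⟩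
    | quotient Z p f =>
      let g : R →ₗ[R] Z := f.symm.toLinearMap ∘ₗ Submodule.mkQ p.1
      have hg : Function.Surjective g := f.symm.surjective.comp (Submodule.mkQ_surjective _)
      exact dies_cov₃ (kerS_shortExact g hg) _ n (dies_of_lc _ _ _ (hcd n hn))
        (ih (n + 1) (by omega) (by omega) (LinearMap.ker g))
    | exact N₁ N₂ N₃ f g hf hg hfg h₁ h₃ =>
      exact dies_cov₂ (mkS_shortExact f g hfg hf hg) _ n h₁ h₃

lemma ext_proj_zero (F Y : ModuleCat.{u} R) [Module.Projective R F] (i : ℕ)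
    (hi : 0 < i) (e : Abelian.Ext F Y i) : e = 0 := by
  obtain ⟨i, rfl⟩ : ∃ j, i = j + 1 := ⟨i - 1, by omega⟩
  have : Projective F := (IsProjective.iff_projective _).1 ‹_›
  exact Abelian.Ext.eq_zero_of_projective _

lemma uniform_kill [IsNoetherianRing R] (I : Ideal R)
    (hcd : ∀ i : ℕ, 2 ≤ i → Subsingleton (LC R I i (ModuleCat.of R R))) :
    ∃ (J' : Ideal R) (h : J' ≤ I), (∃ k, I ^ k ≤ J') ∧ PSmall h 1 := by
  obtain ⟨m, f, hf⟩ := Module.Finite.exists_fin' R (LinearMap.ker (Submodule.mkQ I))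
  have h1 := kerS_shortExact (Submodule.mkQ I) (Submodule.mkQ_surjective _)
  have h2 := kerS_shortExact f hf
  obtain ⟨J', h, hJ', H⟩ := dies_all I hcd 2 le_rfl (LinearMap.ker f) I ⟨1, by simp⟩
    (h1.extClass.comp h2.extClass rfl)
  refine ⟨J', h, hJ', fun i hi Y e => ?_⟩
  obtain ⟨j, rfl⟩ : ∃ j, i = 1 + (1 + j) := ⟨i - 2, by omega⟩
  obtain ⟨e', rfl⟩ := contravariant_sequence_exact₃ h1 Y e (by
    exact ext_proj_zero (ModuleCat.of R R) Y _ (by omega) _) rfl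
  obtain ⟨e'', rfl⟩ := contravariant_sequence_exact₃ h2 Y e' (by
    exact ext_proj_zero (ModuleCat.of R (Fin m → R)) Y _ (by omega) _) rfl
  have : h1.extClass.comp (h2.extClass.comp e'' rfl) rfl =
    (h1.extClass.comp h2.extClass rfl).comp e'' (show 2 + j = 1 + (1 + j) by omega) :=
      (comp_assoc _ _ _ _ _ (by omega)).symm
  rw [this]
  have h3 : (mk₀ (prj h)).comp ((h1.extClass.comp h2.extClass rfl).comp e''
      (show 2 + j = 1 + (1 + j) by omega)) (zero_add _) =
      ((mk₀ (prj h)).comp (h1.extClass.comp h2.extClass rfl) (zero_add 2)).comp e''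
      (show 2 + j = 1 + (1 + j) by omega) := (comp_assoc _ _ _ _ _ (by omega)).symm
  exact h3.trans (by rw [H, Abelian.Ext.zero_comp])

lemma criterion [IsNoetherianRing R] (I : Ideal R)
    (hcd : ∀ i : ℕ, 2 ≤ i → Subsingleton (LC R I i (ModuleCat.of R R)))
    (Y : ModuleCat.{u} R) (h0 : FE (ModuleCat.of R (R ⧸ I)) Y 0)
    (h1 : FE (ModuleCat.of R (R ⧸ I)) Y 1) : ∀ i, FE (ModuleCat.of R (R ⧸ I)) Y i := by
  obtain ⟨J', h, ⟨k, hk⟩, H⟩ := uniform_kill I hcd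
  intro i
  induction i using Nat.strong_induction_on with
  | _ i ih =>
    by_cases hi0 : i = 0
    · subst hi0; exact h0
    by_cases hi1 : i = 1
    · subst hi1; exact h1
    obtain ⟨j, rfl⟩ : ∃ j, i = 1 + j := ⟨i - 1, by omega⟩
    have hS := kerS_shortExact (Submodule.mapQ J' I LinearMap.id h) (prj_surj h)
    have hfin : Module.Finite R (Abelian.Ext (kerS (Submodule.mapQ J' I LinearMap.id h)).X₁ Y j) := by
      refine FE_of_supp I Y j (fun j' hj' => ih j' (by omega))
        (LinearMap.ker (Submodule.mapQ J' I LinearMap.id h)) ?_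
      refine (Module.support_subset_of_injective _ (Submodule.subtype_injective _)).trans ?_
      rw [support_quot]
      intro p hp x hx
      exact p.2.le_of_pow_le (hk.trans hp) hx
    refine Module.Finite.of_surjective (hS.extClass.precompOfLinear R Y rfl) ?_
    intro e
    exact contravariant_sequence_exact₃ hS Y e (H _ (by omega) Y e) rfl

end PartD

section PartE
open Opposite Abelian.Ext
variable {R : Type u} [CommRing R]

/-- cofiniteness via Yoneda Ext -/
def Cof (I : Ideal R) (Y : ModuleCat.{u} R) : Prop :=
  Module.support R Y ⊆ PrimeSpectrum.zeroLocus (I : Set R) ∧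
    ∀ i, FE (ModuleCat.of R (R ⧸ I)) Y i

lemma isCofinite_iff (I : Ideal R) (Y : ModuleCat.{u} R) : IsCofinite R I Y ↔ Cof I Y := by
  refine and_congr Iff.rfl (forall_congr' fun i => ?_)
  obtain ⟨e⟩ := exists_extEquiv (ModuleCat.of R (R ⧸ I)) Y i
  exact Module.Finite.equiv_iff e

/-- the standing hypothesis -/
abbrev HCD (I : Ideal R) : Prop := ∀ i : ℕ, 2 ≤ i → Subsingleton (LC R I i (ModuleCat.of R R))

lemma cof_subsingleton (I : Ideal R) (Y : ModuleCat.{u} R) [Subsingleton Y] : Cof I Y := by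
  refine ⟨?_, fun i => ?_⟩
  · rw [Module.support_eq_empty]
    exact Set.empty_subset _
  · have := subsingleton_ext_right (ModuleCat.of R (R ⧸ I)) Y i
    exact Module.Finite.of_finite

lemma Cof.of_equiv {I : Ideal R} {X Y : ModuleCat.{u} R} (h : Cof I X) (e : X ≃ₗ[R] Y) :
    Cof I Y := by
  refine ⟨?_, fun i => ?_⟩
  · rw [← LinearEquiv.support_eq e]; exact h.1
  · have : Module.Finite R (Abelian.Ext (ModuleCat.of R (R ⧸ I)) X i) := h.2 i
    refine Module.Finite.of_surjective
      ((mk₀ (ModuleCat.ofHom e.toLinearMap)).postcompOfLinear R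
        (ModuleCat.of R (R ⧸ I)) (add_zero i)) ?_
    intro y
    refine ⟨y.comp (mk₀ (ModuleCat.ofHom e.symm.toLinearMap)) (add_zero i), ?_⟩
    change (y.comp (mk₀ (ModuleCat.ofHom e.symm.toLinearMap)) (add_zero i)).comp
      (mk₀ (ModuleCat.ofHom e.toLinearMap)) (add_zero i) = y
    rw [comp_assoc_of_third_deg_zero, mk₀_comp_mk₀, ← ModuleCat.ofHom_comp]
    have : e.toLinearMap ∘ₗ e.symm.toLinearMap = LinearMap.id := by ext; simp
    rw [this]
    exact comp_mk₀_id y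

section ses
variable [IsNoetherianRing R] {A B C : Type u} [AddCommGroup A] [Module R A]
  [AddCommGroup B] [Module R B] [AddCommGroup C] [Module R C] {I : Ideal R}
  (f : A →ₗ[R] B) (g : B →ₗ[R] C)

lemma cof_mid (h : Function.Exact f g) (hf : Function.Injective f) (hg : Function.Surjective g)
    (hA : Cof I (ModuleCat.of R A)) (hC : Cof I (ModuleCat.of R C)) : Cof I (ModuleCat.of R B) := by
  refine ⟨?_, fun i => FE_cov₂ (mkS_shortExact f g h hf hg) _ (hA.2 i) (hC.2 i)⟩
  have := Module.support_of_exact h hf hg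
  rw [this]
  exact Set.union_subset hA.1 hC.1

lemma cof_last (h : Function.Exact f g) (hf : Function.Injective f) (hg : Function.Surjective g)
    (hA : Cof I (ModuleCat.of R A)) (hB : Cof I (ModuleCat.of R B)) : Cof I (ModuleCat.of R C) :=
  ⟨(Module.support_subset_of_surjective g hg).trans hB.1,
    fun i => FE_cov₃ (mkS_shortExact f g h hf hg) _ (hB.2 i) (hA.2 (i + 1))⟩

lemma cof_left (hcd : HCD I) (h : Function.Exact f g) (hf : Function.Injective f)
    (hB : Cof I (ModuleCat.of R B)) (hC : Cof I (ModuleCat.of R C)) : Cof I (ModuleCat.of R A) := by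
  refine ⟨(Module.support_subset_of_injective f hf).trans hB.1, ?_⟩
  have hS : (mkS f g.rangeRestrict (fun x => (by rw [← h x]; exact Subtype.ext_iff))).ShortExact :=
    mkS_shortExact _ _ _ hf g.surjective_rangeRestrict
  have hT : (mkS g.range.subtype g.range.mkQ (LinearMap.exact_subtype_mkQ _)).ShortExact :=
    mkS_shortExact _ _ _ (Submodule.subtype_injective _) (Submodule.mkQ_surjective _)
  refine criterion I hcd _ ?_ ?_
  · exact FE_cov₁_zero hS _ (hB.2 0)
  · exact FE_cov₁ hS _ (FE_cov₁_zero hT _ (hC.2 0)) (hB.2 1)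

lemma cof_right (hcd : HCD I) (h : Function.Exact f g) (hg : Function.Surjective g)
    (hA : Cof I (ModuleCat.of R A)) (hB : Cof I (ModuleCat.of R B)) : Cof I (ModuleCat.of R C) := by
  have hK : Cof I (ModuleCat.of R (LinearMap.ker f)) :=
    cof_left _ f hcd (LinearMap.exact_subtype_ker_map f) (Submodule.subtype_injective _) hA hB
  have hr : Cof I (ModuleCat.of R (LinearMap.range f)) := by
    refine cof_last (LinearMap.ker f).subtype f.rangeRestrict ?_ (Submodule.subtype_injective _)
      f.surjective_rangeRestrict hK hA
    intro x
    rw [← LinearMap.exact_subtype_ker_map f x]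
    exact Subtype.ext_iff
  refine cof_last f.range.subtype g ?_ (Submodule.subtype_injective _) hg hr hB
  intro x
  rw [h x]
  simp

end ses

lemma cof_pi [IsNoetherianRing R] {I : Ideal R} {M : Type u} [AddCommGroup M] [Module R M]
    (hM : Cof I (ModuleCat.of R M)) (n : ℕ) : Cof I (ModuleCat.of R (Fin n → M)) := by
  induction n with
  | zero => exact cof_subsingleton _ _
  | succ n ih =>
    have : Cof I (ModuleCat.of R (M × (Fin n → M))) :=
      cof_mid (LinearMap.inl R M (Fin n → M)) (LinearMap.snd R M (Fin n → M))
        Function.Exact.inl_snd LinearMap.inl_injective LinearMap.snd_surjective hM ih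
    exact this.of_equiv (Fin.consLinearEquiv R (fun _ => M))

lemma cof_ext_free [IsNoetherianRing R] {I : Ideal R} {M : Type u} [AddCommGroup M] [Module R M]
    (hM : Cof I (ModuleCat.of R M)) (n i : ℕ) :
    Cof I (ModuleCat.of R (Abelian.Ext (ModuleCat.of R (Fin n → R)) (ModuleCat.of R M) i)) := by
  rcases Nat.eq_zero_or_pos i with rfl | hi
  · refine (cof_pi hM n).of_equiv ?_
    exact (Abelian.Ext.linearEquiv₀ (R := R) |>.trans (ModuleCat.homLinearEquiv (S := R) (R := R)) |>.trans
      (Module.piEquiv (Fin n) R M).symm).symm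
  · have : Subsingleton (Abelian.Ext (ModuleCat.of R (Fin n → R)) (ModuleCat.of R M) i) :=
      ⟨fun a b => (ext_proj_zero _ _ i hi a).trans (ext_proj_zero _ _ i hi b).symm⟩
    exact cof_subsingleton _ _

lemma cof_ext [IsNoetherianRing R] {I : Ideal R} (hcd : HCD I) {M : Type u} [AddCommGroup M]
    [Module R M] (hM : Cof I (ModuleCat.of R M)) (i : ℕ) :
    ∀ (N : Type u) [AddCommGroup N] [Module R N] [Module.Finite R N],
    Cof I (ModuleCat.of R (Abelian.Ext (ModuleCat.of R N) (ModuleCat.of R M) i)) := by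
  induction i with
  | zero =>
    intro N _ _ _
    obtain ⟨n, f, hf⟩ := Module.Finite.exists_fin' R N
    obtain ⟨n', f', hf'⟩ := Module.Finite.exists_fin' R (LinearMap.ker f)
    have hS := kerS_shortExact f hf
    have hT := kerS_shortExact f' hf'
    refine cof_left ((mk₀ (kerS f).g).precompOfLinear R _ (zero_add 0))
      (((mk₀ (kerS f').g).precompOfLinear R _ (zero_add 0)) ∘ₗ
        ((mk₀ (kerS f).f).precompOfLinear R _ (zero_add 0))) hcd ?_ ?_
      (cof_ext_free hM n 0) (cof_ext_free hM n' 0)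
    · intro x
      rw [← exact_contra₂ hS (ModuleCat.of R M) 0 x]
      have := hT.epi_g
      have := precomp_mk₀_injective_of_epi (ModuleCat.of R M) (kerS f').g
      exact (map_eq_zero_iff ((mk₀ (kerS f').g).precompOfLinear R (ModuleCat.of R M) (zero_add 0)) this)
    · have := hS.epi_g
      exact precomp_mk₀_injective_of_epi (ModuleCat.of R M) (kerS f).g
  | succ i ih =>
    intro N _ _ _
    obtain ⟨n, f, hf⟩ := Module.Finite.exists_fin' R N
    have hS := kerS_shortExact f hf
    refine cof_right ((mk₀ (kerS f).f).precompOfLinear R _ (zero_add i))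
      (hS.extClass.precompOfLinear R _ (add_comm 1 i)) hcd
      (exact_contra₁ hS (ModuleCat.of R M) i (i + 1) (add_comm 1 i)) ?_
      (cof_ext_free hM n i) (ih (LinearMap.ker f))
    intro x
    exact contravariant_sequence_exact₃ hS _ x
      (ext_proj_zero (ModuleCat.of R (Fin n → R)) _ _ (by omega) _) (add_comm 1 i)

end PartE

section PartF
open Opposite MonoidalCategory
variable {R : Type u} [CommRing R]

/-- the complex computing Tor -/
abbrev torCx (N : ModuleCat.{u} R) {M : ModuleCat.{u} R} (P : ProjectiveResolution M) :
    ChainComplex (ModuleCat.{u} R) ℕ :=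
  (((tensoringLeft (ModuleCat.{u} R)).obj N).mapHomologicalComplex _).obj P.complex

/-- functoriality -/
abbrev torMap {N N' : ModuleCat.{u} R} (f : N ⟶ N') {M : ModuleCat.{u} R}
    (P : ProjectiveResolution M) : torCx N P ⟶ torCx N' P :=
  (NatTrans.mapHomologicalComplex ((tensoringLeft (ModuleCat.{u} R)).map f) _).app P.complex

/-- the short complex of complexes -/
abbrev torS (S : ShortComplex (ModuleCat.{u} R)) {M : ModuleCat.{u} R}
    (P : ProjectiveResolution M) : ShortComplex (ChainComplex (ModuleCat.{u} R) ℕ) :=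
  ShortComplex.mk (torMap S.f P) (torMap S.g P) (by
    ext i : 1
    change (S.f ▷ P.complex.X i) ≫ (S.g ▷ P.complex.X i) = 0
    rw [← comp_whiskerRight, S.zero]
    exact MonoidalPreadditive.zero_whiskerRight)

lemma torS_exact {S : ShortComplex (ModuleCat.{u} R)} (hS : S.ShortExact) {M : ModuleCat.{u} R}
    (P : ProjectiveResolution M) : (torS S P).ShortExact := by
  refine HomologicalComplex.shortExact_of_degreewise_shortExact _ fun i => ?_
  have hp : Module.Projective R (P.complex.X i) :=
    (IsProjective.iff_projective _).2 (inferInstanceAs (Projective (P.complex.X i)))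
  have hfl : Module.Flat R (P.complex.X i) := Module.Flat.of_projective
  change (S.map (tensorRight (P.complex.X i))).ShortExact
  exact
    { exact := Module.Flat.rTensor_shortComplex_exact _ S hS.exact
      mono_f := (ModuleCat.mono_iff_injective _).2
        (Module.Flat.rTensor_preserves_injective_linearMap S.f.hom
          ((ModuleCat.mono_iff_injective _).1 hS.mono_f))
      epi_g := (ModuleCat.epi_iff_surjective _).2
        (LinearMap.rTensor_surjective _ ((ModuleCat.epi_iff_surjective _).1 hS.epi_g)) }

lemma exists_torEquiv (N : ModuleCat.{u} R) {M : ModuleCat.{u} R} (P : ProjectiveResolution M)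
    (i : ℕ) : Nonempty (TorMod R i N M ≃ₗ[R] (torCx N P).homology i) :=
  ⟨(P.isoLeftDerivedObj ((tensoringLeft (ModuleCat.{u} R)).obj N) i).toLinearEquiv⟩

open TensorProduct in
lemma exists_torZero (N M : Type u) [AddCommGroup N] [Module R N] [AddCommGroup M] [Module R M] :
    Nonempty ((N ⊗[R] M) ≃ₗ[R] TorMod R 0 (ModuleCat.of R N) (ModuleCat.of R M)) := by
  have : Limits.PreservesFiniteColimits
      ((tensoringLeft (ModuleCat.{u} R)).obj (ModuleCat.of R N)) :=
    inferInstanceAs (Limits.PreservesFiniteColimits (tensorLeft (ModuleCat.of R N)))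
  exact ⟨(((tensoringLeft (ModuleCat.{u} R)).obj
    (ModuleCat.of R N)).leftDerivedZeroIsoSelf.app (ModuleCat.of R M)).toLinearEquiv.symm⟩

lemma torCx_isZero (F : ModuleCat.{u} R) [hF : Module.Flat R F] {M : ModuleCat.{u} R}
    (P : ProjectiveResolution M) (i : ℕ) : Limits.IsZero ((torCx F P).homology (i + 1)) := by
  refine (HomologicalComplex.exactAt_iff_isZero_homology (torCx F P) (i + 1)).1 ?_
  have h := (HomologicalComplex.exactAt_iff _ _).1 (P.complex_exactAt_succ i)
  have h' := Module.Flat.lTensor_shortComplex_exact F _ h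
  exact (HomologicalComplex.exactAt_iff _ _).2 h'

lemma cof_tor_free [IsNoetherianRing R] {I : Ideal R} {M : Type u} [AddCommGroup M] [Module R M]
    (hM : Cof I (ModuleCat.of R M)) (n i : ℕ) :
    Cof I (TorMod R i (ModuleCat.of R (Fin n → R)) (ModuleCat.of R M)) := by
  rcases i with _ | i
  · obtain ⟨e⟩ := exists_torZero (R := R) (Fin n → R) M
    exact (cof_pi hM n).of_equiv
      (((TensorProduct.comm R _ _).trans (TensorProduct.piScalarRight R R M (Fin n))).symm.trans e)
  · let P := projectiveResolution (ModuleCat.of R M)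
    obtain ⟨e⟩ := exists_torEquiv (ModuleCat.of R (Fin n → R)) P (i + 1)
    have hz : Limits.IsZero ((torCx (ModuleCat.of R (Fin n → R)) P).homology (i + 1)) := by
      exact torCx_isZero _ P i
    have hs := ModuleCat.subsingleton_of_isZero hz
    exact (cof_subsingleton I _).of_equiv e.symm

lemma cof_tor [IsNoetherianRing R] {I : Ideal R} (hcd : HCD I) {M : Type u} [AddCommGroup M]
    [Module R M] (hM : Cof I (ModuleCat.of R M)) (i : ℕ) :
    ∀ (N : Type u) [AddCommGroup N] [Module R N] [Module.Finite R N],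
    Cof I (TorMod R i (ModuleCat.of R N) (ModuleCat.of R M)) := by
  induction i with
  | zero =>
    intro N _ _ _
    obtain ⟨n, f, hf⟩ := Module.Finite.exists_fin' R N
    obtain ⟨n', f', hf'⟩ := Module.Finite.exists_fin' R (LinearMap.ker f)
    have hex : Function.Exact ((LinearMap.ker f).subtype ∘ₗ f') f := by
      rw [LinearMap.exact_iff, LinearMap.range_comp, LinearMap.range_eq_top.2 hf']
      simp
    have hfree : ∀ n, Cof I (ModuleCat.of R (TensorProduct R (Fin n → R) M)) := by
      intro n
      obtain ⟨e⟩ := exists_torZero (R := R) (Fin n → R) M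
      exact (cof_tor_free hM n 0).of_equiv e.symm
    obtain ⟨e⟩ := exists_torZero (R := R) N M
    exact (cof_right _ _ hcd (rTensor_exact M hex hf) (LinearMap.rTensor_surjective M hf)
      (hfree n') (hfree n)).of_equiv e
  | succ i ih =>
    intro N _ _ _
    obtain ⟨n, f, hf⟩ := Module.Finite.exists_fin' R N
    have hS := kerS_shortExact f hf
    let P := projectiveResolution (ModuleCat.of R M)
    have hT := torS_exact hS P
    have hrel : (ComplexShape.down ℕ).Rel (i + 1) i := rfl
    have hz : Limits.IsZero ((torS (kerS f) P).X₂.homology (i + 1)) := by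
      exact torCx_isZero (ModuleCat.of R (Fin n → R)) P i
    have hmono := hT.mono_δ (i + 1) i hrel hz
    have hex := (ShortComplex.ShortExact.moduleCat_exact_iff_function_exact _).1
      (hT.homology_exact₁ (i + 1) i hrel)
    obtain ⟨e⟩ := exists_torEquiv (ModuleCat.of R N) P (i + 1)
    obtain ⟨e1⟩ := exists_torEquiv (ModuleCat.of R (LinearMap.ker f)) P i
    obtain ⟨e2⟩ := exists_torEquiv (ModuleCat.of R (Fin n → R)) P i
    exact (cof_left _ _ hcd hex ((ModuleCat.mono_iff_injective _).1 hmono)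
      ((ih (LinearMap.ker f)).of_equiv e1) ((cof_tor_free hM n i).of_equiv e2)).of_equiv e.symm

end PartF

theorem stmt7 (R : Type u) [CommRing R] [IsNoetherianRing R] [IsLocalRing R] (I : Ideal R)
    (hcd : ∀ i : ℕ, 2 ≤ i → Subsingleton (LC R I i (ModuleCat.of R R)))
    (M : Type u) [AddCommGroup M] [Module R M] (hM : IsCofinite R I (ModuleCat.of R M))
    (N : Type u) [AddCommGroup N] [Module R N] [Module.Finite R N] :
    ∀ i : ℕ, IsCofinite R I (TorMod R i (ModuleCat.of R N) (ModuleCat.of R M)) ∧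
      IsCofinite R I (ExtMod R i (ModuleCat.of R N) (ModuleCat.of R M)) := by
  intro i
  rw [isCofinite_iff] at hM
  rw [isCofinite_iff, isCofinite_iff]
  obtain ⟨e⟩ := exists_extEquiv (ModuleCat.of R N) (ModuleCat.of R M) i
  exact ⟨cof_tor hcd hM i N, (cof_ext hcd hM i N).of_equiv e.symm⟩
end
end

section
/- Let R be a commutative Noetherian ring, I ⊆ J two ideals of R, M an R-module, and t ≥ 2 an integer such that Tor_j^R(R/J, H^i_I(M)) = 0 for all i > t and all j ≥ 0. Then Tor_j^R(R/J, H^t_I(M)) = 0 for j = 0 and j = 1. -/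
open CategoryTheory

noncomputable section

universe u

structure Cx (R : Type u) [CommRing R] where
  X : ℤ → Type u
  [grp : ∀ i, AddCommGroup (X i)]
  [mod : ∀ i, Module R (X i)]
  d : ∀ i, X i →ₗ[R] X (i + 1)
  dd : ∀ i x, d (i + 1) (d i x) = 0

attribute [instance] Cx.grp Cx.mod

namespace Cx
variable {R : Type u} [CommRing R]

structure Hom (A B : Cx R) where
  f : ∀ i, A.X i →ₗ[R] B.X i
  comm : ∀ i x, f (i + 1) (A.d i x) = B.d i (f i x)

structure Hom.Qis {A B : Cx R} (φ : Hom A B) : Prop where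
  inj : ∀ i (x : A.X (i + 1)) (y : B.X i), A.d _ x = 0 → φ.f _ x = B.d _ y → ∃ x', A.d i x' = x
  surj : ∀ i (y : B.X (i + 1)), B.d _ y = 0 →
    ∃ (x : A.X (i + 1)) (w : B.X i), A.d _ x = 0 ∧ y = φ.f _ x + B.d _ w

def Hom.comp {A B C : Cx R} (φ : Hom A B) (ψ : Hom B C) : Hom A C where
  f i := ψ.f i ∘ₗ φ.f i
  comm i x := by simp [φ.comm, ψ.comm]

lemma Hom.Qis.comp {A B C : Cx R} {φ : Hom A B} {ψ : Hom B C} (h : φ.Qis) (k : ψ.Qis) :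
    (φ.comp ψ).Qis where
  inj i x y hx hy := by
    obtain ⟨y', hy'⟩ := k.inj i (φ.f _ x) y (by rw [← φ.comm, hx, map_zero]) hy
    exact h.inj i x y' hx hy'.symm
  surj i z hz := by
    obtain ⟨y, w, hy, rfl⟩ := k.surj i z hz
    obtain ⟨x, v, hx, rfl⟩ := h.surj i y hy
    refine ⟨x, ψ.f _ v + w, hx, ?_⟩
    simp [Hom.comp, ψ.comm, add_assoc]

@[reducible] def sh (A : Cx R) : Cx R where
  X i := A.X (i + 1)
  d i := A.d (i + 1)
  dd i x := A.dd (i + 1) x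

@[reducible] def Hom.sh {A B : Cx R} (φ : Hom A B) : Hom A.sh B.sh where
  f i := φ.f (i + 1)
  comm i x := φ.comm (i + 1) x

def shn : ℕ → Cx R → Cx R
  | 0, A => A
  | n + 1, A => (shn n A).sh

@[reducible] def Hom.shn {A B : Cx R} (φ : Hom A B) : ∀ n, Hom (shn n A) (shn n B)
  | 0 => φ
  | n + 1 => (Hom.shn φ n).sh

/-- cohomology in degree `i + 1` -/
abbrev Z (A : Cx R) (i : ℤ) : Submodule R (A.X i) := LinearMap.ker (A.d i)
abbrev B (A : Cx R) (i : ℤ) : Submodule R (A.X (i + 1)) := LinearMap.range (A.d i)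
abbrev H (A : Cx R) (i : ℤ) : Type u := A.Z (i + 1) ⧸ (A.B i).comap (A.Z (i + 1)).subtype

lemma H_shn (A : Cx R) (n : ℕ) (i j : ℤ) (h : i + n = j) :
    Nonempty ((shn n A).H i ≃ₗ[R] A.H j) := by
  induction n generalizing i with
  | zero => obtain rfl : i = j := by simpa using h
            exact ⟨LinearEquiv.refl _ _⟩
  | succ n ih => exact ih (i + 1) (by push_cast at h; lia)

lemma Hom.Qis.H {A B : Cx R} {φ : Hom A B} (h : φ.Qis) (i : ℤ) :
    Nonempty (A.H i ≃ₗ[R] B.H i) := by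
  let r : A.Z (i + 1) →ₗ[R] B.Z (i + 1) := (φ.f (i + 1)).restrict (fun x hx => by
    simp only [LinearMap.mem_ker] at hx ⊢
    rw [← φ.comm, hx, map_zero])
  let g : A.Z (i + 1) →ₗ[R] B.H i := (Submodule.mkQ _) ∘ₗ r
  have hs : Function.Surjective g := by
    intro q
    obtain ⟨⟨y, hy⟩, rfl⟩ := Submodule.mkQ_surjective _ q
    obtain ⟨x, w, hx, rfl⟩ := h.surj i y hy
    refine ⟨⟨x, hx⟩, ?_⟩
    refine (Submodule.Quotient.eq _).2 ?_
    refine ⟨-w, ?_⟩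
    simp [r]
  have hk : LinearMap.ker g = (A.B i).comap (A.Z (i + 1)).subtype := by
    ext ⟨x, hx⟩
    simp only [LinearMap.mem_ker] at hx
    simp only [LinearMap.mem_ker, g, LinearMap.comp_apply, Submodule.mkQ_apply,
      Submodule.Quotient.mk_eq_zero, Submodule.mem_comap, Submodule.subtype_apply]
    constructor
    · rintro ⟨y, hy⟩
      exact h.inj i x y hx hy.symm
    · rintro ⟨x', hx'⟩
      exact ⟨φ.f _ x', by rw [← φ.comm, hx']; rfl⟩
  exact ⟨(Submodule.quotEquivOfEq _ _ hk.symm).trans (g.quotKerEquivOfSurjective hs)⟩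

variable (x : R)

abbrev L (M : Type u) [AddCommGroup M] [Module R M] : Type u :=
  LocalizedModule (Submonoid.powers x) M

abbrev ι (M : Type u) [AddCommGroup M] [Module R M] : M →ₗ[R] L x M :=
  LocalizedModule.mkLinearMap (Submonoid.powers x) M

def lmap {M N : Type u} [AddCommGroup M] [Module R M] [AddCommGroup N] [Module R N]
    (f : M →ₗ[R] N) : L x M →ₗ[R] L x N :=
  IsLocalizedModule.map (Submonoid.powers x) (ι x M) (ι x N) f

section
variable {M N P : Type u} [AddCommGroup M] [Module R M] [AddCommGroup N] [Module R N]
  [AddCommGroup P] [Module R P]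

lemma lmap_ι (f : M →ₗ[R] N) (m : M) : lmap x f (ι x M m) = ι x N (f m) :=
  IsLocalizedModule.map_apply _ _ _ _ _

lemma L_inj {y : L x M} {k : ℕ} (h : x ^ k • y = 0) : y = 0 := by
  have := IsLocalizedModule.map_units (S := Submonoid.powers x) (ι x M) ⟨x ^ k, k, rfl⟩
  rw [Module.End.isUnit_iff] at this
  exact this.1 (show x ^ k • y = x ^ k • 0 by rw [h, smul_zero])

lemma L_div (k : ℕ) (y : L x M) : ∃ y', x ^ k • y' = y := by
  have := IsLocalizedModule.map_units (S := Submonoid.powers x) (ι x M) ⟨x ^ k, k, rfl⟩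
  rw [Module.End.isUnit_iff] at this
  obtain ⟨y', h⟩ := this.2 y
  exact ⟨y', h⟩

lemma L_rep (y : L x M) : ∃ (k : ℕ) (m : M), x ^ k • y = ι x M m := by
  obtain ⟨⟨m, ⟨_, k, rfl⟩⟩, h⟩ := IsLocalizedModule.surj (Submonoid.powers x) (ι x M) y
  exact ⟨k, m, h⟩

lemma ι_zero {m : M} (h : ι x M m = 0) : ∃ k : ℕ, x ^ k • m = 0 := by
  obtain ⟨⟨_, k, rfl⟩, h⟩ := (IsLocalizedModule.eq_zero_iff (Submonoid.powers x) (ι x M)).1 h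
  exact ⟨k, h⟩

lemma ι_zero' {m : M} (k : ℕ) (h : x ^ k • m = 0) : ι x M m = 0 :=
  L_inj x (k := k) (by rw [← map_smul, h, map_zero])

lemma lmap_comp (f : M →ₗ[R] N) (g : N →ₗ[R] P) (y : L x M) :
    lmap x g (lmap x f y) = lmap x (g ∘ₗ f) y := by
  obtain ⟨k, m, h⟩ := L_rep x y
  rw [← sub_eq_zero]
  apply L_inj x (k := k)
  rw [smul_sub, ← map_smul, ← map_smul, ← map_smul, h, lmap_ι, lmap_ι, lmap_ι]
  simp

lemma lmap_zero (y : L x M) : lmap x (0 : M →ₗ[R] N) y = 0 := by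
  obtain ⟨k, m, h⟩ := L_rep x y
  apply L_inj x (k := k)
  rw [← map_smul, h, lmap_ι]; simp
end

/-- localized complex -/
@[reducible] def loc (A : Cx R) : Cx R where
  X i := L x (A.X i)
  d i := lmap x (A.d i)
  dd i y := by
    rw [lmap_comp, show A.d (i + 1) ∘ₗ A.d i = 0 from LinearMap.ext (A.dd i), lmap_zero]

@[reducible] def Hom.loc {A B : Cx R} (φ : Hom A B) : Hom (A.loc x) (B.loc x) where
  f i := lmap x (φ.f i)
  comm i y := by
    change lmap x _ (lmap x _ _) = lmap x _ (lmap x _ _)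
    rw [lmap_comp, lmap_comp,
      show φ.f (i + 1) ∘ₗ A.d i = B.d i ∘ₗ φ.f i from LinearMap.ext (φ.comm i)]

lemma Hom.Qis.loc {A B : Cx R} {φ : Hom A B} (h : φ.Qis) : (φ.loc x).Qis where
  inj i y v hy hv := by
    change lmap x _ y = 0 at hy
    change lmap x _ y = lmap x _ v at hv
    obtain ⟨k, c, hc⟩ := L_rep x y
    obtain ⟨j, w, hw⟩ := L_rep x v
    have h1 : ι x _ (A.d _ c) = 0 := by rw [← lmap_ι, ← hc, map_smul, hy, smul_zero]
    obtain ⟨m, hm⟩ := ι_zero x h1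
    have h2 : ι x _ (x ^ j • φ.f _ c - x ^ k • B.d _ w) = 0 := by
      rw [map_sub, map_smul, map_smul, ← lmap_ι, ← lmap_ι, ← hc, ← hw, map_smul, map_smul, hv,
        smul_comm, sub_self]
    obtain ⟨p, hp⟩ := ι_zero x h2
    rw [smul_sub, sub_eq_zero] at hp
    obtain ⟨c', hc'⟩ := h.inj i (x ^ m • x ^ p • x ^ j • c) (x ^ m • x ^ p • x ^ k • w)
      (by rw [map_smul, map_smul, map_smul, smul_comm, smul_comm (x ^ m) (x ^ j), hm]; simp)
      (by simp only [map_smul]; rw [hp])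
    obtain ⟨y', hy'⟩ := L_div x (m + p + j + k) (ι x _ c')
    refine ⟨y', ?_⟩
    change lmap x _ y' = y
    rw [← sub_eq_zero]
    apply L_inj x (k := m + p + j + k)
    rw [smul_sub, ← map_smul, hy', lmap_ι, hc', pow_add, mul_smul, hc]
    simp only [map_smul, pow_add, mul_smul, sub_self]
  surj i v hv := by
    change lmap x _ v = 0 at hv
    obtain ⟨k, w, hw⟩ := L_rep x v
    have h1 : ι x _ (B.d _ w) = 0 := by rw [← lmap_ι, ← hw, map_smul, hv, smul_zero]
    obtain ⟨m, hm⟩ := ι_zero x h1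
    obtain ⟨a, b, ha, hab⟩ := h.surj i (x ^ m • w) (by rw [map_smul, hm])
    obtain ⟨a', ha'⟩ := L_div x (m + k) (ι x _ a)
    obtain ⟨b', hb'⟩ := L_div x (m + k) (ι x _ b)
    refine ⟨a', b', ?_, ?_⟩
    · change lmap x _ a' = 0
      apply L_inj x (k := m + k)
      rw [← map_smul, ha', lmap_ι, ha, map_zero]
    · change v = lmap x _ a' + lmap x _ b'
      rw [← sub_eq_zero]
      apply L_inj x (k := m + k)
      rw [smul_sub, smul_add, ← map_smul, ← map_smul, ha', hb', lmap_ι, lmap_ι, pow_add, mul_smul, hw,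
        ← map_smul, hab, map_add, sub_self]

/-- (shifted) fibre of `A → A_x` -/
@[reducible] def fib (A : Cx R) : Cx R where
  X i := A.X (i + 1) × L x (A.X i)
  d i := LinearMap.prod (A.d (i + 1) ∘ₗ LinearMap.fst _ _ _)
    (ι x _ ∘ₗ LinearMap.fst _ _ _ - lmap x (A.d i) ∘ₗ LinearMap.snd _ _ _)
  dd i := by
    rintro ⟨a, y⟩
    ext
    · simp [A.dd]
    · have := (A.loc x).dd i y
      change lmap x _ (lmap x _ y) = 0 at this
      have h2 := lmap_ι x (A.d (i + 1)) a
      change ι x _ _ - lmap x _ (ι x _ a - lmap x _ y) = 0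
      rw [map_sub, this, h2]; simp

lemma fib_d (A : Cx R) (i) (a : A.X (i + 1)) (y : L x (A.X i)) :
    (A.fib x).d i (a, y) = (A.d (i + 1) a, ι x _ a - lmap x (A.d i) y) := rfl

@[reducible] def Hom.fib {A B : Cx R} (φ : Hom A B) : Hom (A.fib x) (B.fib x) where
  f i := LinearMap.prodMap (φ.f (i + 1)) (lmap x (φ.f i))
  comm i := by
    rintro ⟨a, y⟩
    have h1 := (φ.loc x).comm i y
    change lmap x _ (lmap x _ y) = lmap x _ (lmap x _ y) at h1
    have h2 := lmap_ι x (φ.f (i + 1)) a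
    change (φ.f _ (A.d (i + 1) a), lmap x _ (ι x _ a - lmap x (A.d i) y)) =
      (B.d (i + 1) (φ.f _ a), ι x _ (φ.f _ a) - lmap x (B.d i) (lmap x _ y))
    rw [map_sub, h1, h2, φ.comm]

lemma fib_f {A B : Cx R} (φ : Hom A B) (i) (a : A.X (i + 1)) (y : L x (A.X i)) :
    (φ.fib x).f i (a, y) = (φ.f (i + 1) a, lmap x (φ.f i) y) := rfl

@[reducible] def Hom.toLoc (A : Cx R) : Hom A (A.loc x) where
  f i := ι x _
  comm i a := (lmap_ι x _ a).symm

lemma Hom.Qis.fib {A B : Cx R} {φ : Hom A B} (h : φ.Qis) : (φ.fib x).Qis where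
  inj i := by
    rintro ⟨c, y⟩ ⟨w, v⟩ h1 h2
    have hl := h.loc x
    have e1 : A.d (i + 1 + 1) c = 0 := congrArg Prod.fst h1
    have e2 : ι x _ c - (A.loc x).d (i + 1) y = 0 := congrArg Prod.snd h1
    have e3 : φ.f (i + 1 + 1) c = B.d (i + 1) w := congrArg Prod.fst h2
    have e4 : (φ.loc x).f (i + 1) y = ι x _ w - (B.loc x).d i v := congrArg Prod.snd h2
    obtain ⟨c0, hc0⟩ := h.inj _ c w e1 e3
    obtain ⟨z, u, hz, hu⟩ := h.surj i (φ.f _ c0 - w) (by rw [map_sub, ← φ.comm, hc0, e3, sub_self])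
    have hu' : φ.f _ (c0 - z) = w + B.d _ u := by
      rw [map_sub]; rw [sub_eq_iff_eq_add] at hu; rw [hu]; abel
    obtain ⟨c1, hc1⟩ : ∃ c1, c1 = c0 - z := ⟨_, rfl⟩
    rw [← hc1] at hu'
    have hd : A.d _ c1 = c := by rw [hc1, map_sub, hc0, hz, sub_zero]
    have n1 := (Hom.toLoc x A).comm (i + 1) c1
    have n2 := lmap_ι x (φ.f (i + 1)) c1
    have n3 := (Hom.toLoc x B).comm i u
    change ι x _ _ = (A.loc x).d _ (ι x _ _) at n1
    change (φ.loc x).f (i + 1) (ι x _ _) = ι x _ _ at n2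
    change ι x _ _ = (B.loc x).d _ (ι x _ _) at n3
    obtain ⟨v', hv'⟩ := hl.inj i (y - ι x _ c1) (-v - ι x _ u)
      (by
        have : (A.loc x).d (i + 1) (y - ι x _ c1) =
          (A.loc x).d (i + 1) y - (A.loc x).d (i + 1) (ι x _ c1) := map_sub _ _ _
        rw [this, ← n1, hd, ← sub_eq_zero.1 e2, sub_self])
      (by
        have t1 : (φ.loc x).f (i + 1) (y - ι x _ c1) =
          (φ.loc x).f (i + 1) y - (φ.loc x).f (i + 1) (ι x _ c1) := map_sub _ _ _
        have t2 : (B.loc x).d i (-v - ι x _ u) =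
          - (B.loc x).d i v - (B.loc x).d i (ι x _ u) := by
            rw [← map_neg]; exact map_sub _ _ _
        rw [t1, t2, e4, n2, hu', ← n3, map_add]; abel)
    refine ⟨(c1, -v'), ?_⟩
    rw [fib_d, hd]
    refine Prod.ext rfl ?_
    change ι x _ c1 - (A.loc x).d i (-v') = y
    have : (A.loc x).d i (-v') = -(A.loc x).d i v' := map_neg _ _
    rw [this, hv']; abel
  surj i := by
    rintro ⟨w, v⟩ h1
    have hl := h.loc x
    have e1 : B.d (i + 1 + 1) w = 0 := congrArg Prod.fst h1
    have e2 : ι x _ w - (B.loc x).d (i + 1) v = 0 := congrArg Prod.snd h1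
    obtain ⟨c, u, hc, rfl⟩ := h.surj _ w e1
    have n1 := (Hom.toLoc x B).comm (i + 1) u
    have n2 := lmap_ι x (φ.f (i + 1 + 1)) c
    have n3 := (Hom.toLoc x A).comm (i + 1 + 1) c
    change ι x _ _ = (B.loc x).d _ (ι x _ _) at n1
    change (φ.loc x).f (i + 1 + 1) (ι x _ _) = ι x _ _ at n2
    change ι x _ _ = (A.loc x).d _ (ι x _ _) at n3
    have t1 : (B.loc x).d (i + 1) (v - ι x _ u) =
      (B.loc x).d (i + 1) v - (B.loc x).d (i + 1) (ι x _ u) := map_sub _ _ _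
    have t2 : (B.loc x).d (i + 1) (v - ι x _ u) = (φ.loc x).f (i + 1 + 1) (ι x _ c) := by
      rw [t1, n2, ← sub_eq_zero.1 e2, ← n1, ← map_sub]; congr 1; abel
    obtain ⟨y, hy⟩ := hl.inj (i + 1) (ι x _ c) (v - ι x _ u)
      (by rw [← n3, hc, map_zero]) t2.symm
    obtain ⟨z, s, hz, hzs⟩ := hl.surj i (v - ι x _ u - (φ.loc x).f _ y) (by
      have : (B.loc x).d (i + 1) (v - ι x _ u - (φ.loc x).f _ y) =
        (B.loc x).d (i + 1) (v - ι x _ u) - (B.loc x).d (i + 1) ((φ.loc x).f _ y) := map_sub _ _ _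
      rw [this, t2, ← (φ.loc x).comm, hy, sub_self])
    refine ⟨(c, y + z), (u, -s), ?_, ?_⟩
    · rw [fib_d, hc]
      refine Prod.ext rfl ?_
      change ι x _ c - (A.loc x).d (i + 1) (y + z) = 0
      have : (A.loc x).d (i + 1) (y + z) = (A.loc x).d (i + 1) y + (A.loc x).d (i + 1) z :=
        map_add _ _ _
      rw [this, hy, hz]; simp
    · rw [fib_d, fib_f]
      refine Prod.ext rfl ?_
      change v = (φ.loc x).f _ (y + z) + (ι x _ u - (B.loc x).d i (-s))
      have h1 : (B.loc x).d i (-s) = -(B.loc x).d i s := map_neg _ _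
      have h2 : (φ.loc x).f (i + 1) (y + z) = (φ.loc x).f (i + 1) y + (φ.loc x).f (i + 1) z :=
        map_add _ _ _
      rw [h1, h2]
      have h3 : v = (v - ι x _ u - (φ.loc x).f _ y) + ι x _ u + (φ.loc x).f _ y := by abel
      rw [h3, hzs]; abel

structure Hom.Tors {A B : Cx R} (φ : Hom A B) : Prop where
  inj : ∀ i, Function.Injective (φ.f i)
  tors : ∀ i a, ι x _ (φ.f i a) = 0
  mem : ∀ i b, ι x _ b = 0 → ∃ a, φ.f i a = b
  surj : ∀ i, Function.Surjective (ι x (B.X i))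

lemma Hom.Tors.shn {A B : Cx R} {φ : Hom A B} (h : φ.Tors x) (n : ℕ) : (φ.shn n).Tors x := by
  induction n with
  | zero => exact h
  | succ n ih => exact ⟨fun i => ih.inj _, fun i => ih.tors _, fun i => ih.mem _, fun i => ih.surj _⟩

variable {x} in
@[reducible] def Hom.Tors.fib {A B : Cx R} {φ : Hom A B} (h : φ.Tors x) : Hom A.sh (B.fib x) where
  f i := LinearMap.inl R _ _ ∘ₗ φ.f (i + 1)
  comm i a := by
    refine Prod.ext (φ.comm _ _) ?_
    change 0 = ι x _ (φ.f _ a) - lmap x _ 0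
    rw [h.tors]; simp

lemma Hom.Tors.qis {A B : Cx R} {φ : Hom A B} (h : φ.Tors x) : h.fib.Qis where
  inj i g := by
    rintro ⟨a, b⟩ hg he
    have e1 : φ.f (i + 1 + 1) g = B.d _ a := congrArg Prod.fst he
    have e2 : 0 = ι x _ a - lmap x (B.d i) b := congrArg Prod.snd he
    obtain ⟨b, rfl⟩ := h.surj _ b
    rw [lmap_ι, ← map_sub] at e2
    obtain ⟨a', ha'⟩ := h.mem _ _ e2.symm
    refine ⟨a', ?_⟩
    apply h.inj
    change φ.f _ (A.d _ a') = _
    rw [φ.comm, ha', map_sub, B.dd, sub_zero, e1]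
  surj i := by
    rintro ⟨a, b⟩ he
    have e1 : B.d _ a = 0 := congrArg Prod.fst he
    have e2 : ι x _ a - lmap x (B.d (i + 1)) b = 0 := congrArg Prod.snd he
    obtain ⟨b, rfl⟩ := h.surj _ b
    rw [lmap_ι, ← map_sub] at e2
    obtain ⟨a', ha'⟩ := h.mem _ _ e2
    refine ⟨a', (b, 0), ?_, ?_⟩
    · apply h.inj
      change φ.f _ (A.d _ a') = _
      rw [φ.comm, ha', map_sub, B.dd, sub_zero, e1, map_zero]
    · refine Prod.ext ?_ ?_
      · change a = φ.f _ a' + B.d _ b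
        rw [ha']; abel
      · change ι x _ b = 0 + (ι x _ b - lmap x _ 0)
        simp
end Cx

open Abelian in
def TT {R : Type u} [CommRing R] (D : ModuleCat.{u} R) (N : Type u) [AddCommGroup N] [Module R N]
    (j : ℕ) : Prop := Subsingleton (Abelian.Ext.{u} (ModuleCat.of R N) D j)

namespace TT
variable {R : Type u} [CommRing R] {D : ModuleCat.{u} R}
variable {N N₁ N₂ N₃ : Type u} [AddCommGroup N] [Module R N] [AddCommGroup N₁] [Module R N₁]
  [AddCommGroup N₂] [Module R N₂] [AddCommGroup N₃] [Module R N₃]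
open Abelian

lemma of_equiv (e : N₁ ≃ₗ[R] N₂) {j : ℕ} (h : TT D N₁ j) : TT D N₂ j := by
  unfold TT at *
  let i := e.toModuleIso
  refine ⟨fun a b => ?_⟩
  have h1 : (Ext.mk₀ i.hom).comp a (zero_add j) = (Ext.mk₀ i.hom).comp b (zero_add j) :=
    Subsingleton.elim _ _
  have h2 := congrArg (fun c => (Ext.mk₀ i.inv).comp c (zero_add j)) h1
  simpa using h2

lemma iff_zero {j : ℕ} : TT D N j ↔ ∀ e : Ext.{u} (ModuleCat.of R N) D j, e = 0 :=
  ⟨fun h e => @Subsingleton.elim _ h _ _, fun h => ⟨fun a b => by rw [h a, h b]⟩⟩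

section ses
variable (f : N₁ →ₗ[R] N₂) (g : N₂ →ₗ[R] N₃) (hf : Function.Injective f)
  (hg : Function.Surjective g) (hfg : Function.Exact f g)

include hf hg hfg in
lemma ses : ∃ S : ShortComplex (ModuleCat.{u} R), S.ShortExact ∧
    S = ⟨ModuleCat.ofHom f, ModuleCat.ofHom g, by ext x; exact hfg.apply_apply_eq_zero x⟩ := by
  refine ⟨_, ?_, rfl⟩
  exact { exact := (ShortComplex.ShortExact.moduleCat_exact_iff_function_exact _).2 hfg
          mono_f := (ModuleCat.mono_iff_injective _).2 hf
          epi_g := (ModuleCat.epi_iff_surjective _).2 hg }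

include hf hg hfg

lemma left {j : ℕ} (h2 : TT D N₂ j) (h3 : TT D N₃ (j + 1)) : TT D N₁ j := by
  obtain ⟨S, hS, rfl⟩ := ses f g hf hg hfg
  rw [iff_zero] at *
  intro e
  obtain ⟨y, rfl⟩ := Ext.contravariant_sequence_exact₁ hS D e (add_comm 1 j) (h3 _)
  rw [show y = 0 from h2 y, Ext.comp_zero]

lemma mid {j : ℕ} (h1 : TT D N₁ j) (h3 : TT D N₃ j) : TT D N₂ j := by
  obtain ⟨S, hS, rfl⟩ := ses f g hf hg hfg
  rw [iff_zero] at *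
  intro e
  obtain ⟨y, rfl⟩ := Ext.contravariant_sequence_exact₂ hS D e (h1 _)
  rw [show y = 0 from h3 y, Ext.comp_zero]

lemma right {j : ℕ} (h1 : TT D N₁ j) (h2 : TT D N₂ (j + 1)) : TT D N₃ (j + 1) := by
  obtain ⟨S, hS, rfl⟩ := ses f g hf hg hfg
  rw [iff_zero] at *
  intro e
  obtain ⟨y, rfl⟩ := Ext.contravariant_sequence_exact₃ hS D e (h2 _) (add_comm 1 j)
  rw [show y = 0 from h1 y, Ext.comp_zero]

end ses

lemma quot (g : N₂ →ₗ[R] N₃) (hg : Function.Surjective g) (h2 : TT D N₂ 0) : TT D N₃ 0 := by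
  have : Epi (ModuleCat.ofHom g) := (ModuleCat.epi_iff_surjective _).2 hg
  refine ⟨fun a b => Ext.precomp_mk₀_injective_of_epi D (ModuleCat.ofHom g) ?_⟩
  exact @Subsingleton.elim _ h2 _ _

lemma prod {j : ℕ} (h1 : TT D N₁ j) (h2 : TT D N₂ j) : TT D (N₁ × N₂) j :=
  mid (LinearMap.inl R N₁ N₂) (LinearMap.snd R N₁ N₂) LinearMap.inl_injective
    LinearMap.snd_surjective Function.Exact.inl_snd h1 h2

lemma of_subsingleton [Subsingleton N] (j : ℕ) : TT D N j := by
  rw [iff_zero]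
  intro e
  rw [← Ext.mk₀_id_comp e, show 𝟙 (ModuleCat.of R N) = 0 by ext x; exact Subsingleton.elim _ _,
    Ext.mk₀_zero, Ext.zero_comp]

lemma of_unit (x : R) (hx : ∀ d : D, x • d = 0) (u : N →ₗ[R] N) (hu : ∀ n, x • u n = n) (j : ℕ) :
    TT D N j := by
  rw [iff_zero]
  intro e
  have h1 : 𝟙 (ModuleCat.of R N) = x • ModuleCat.ofHom u := by ext n; exact (hu n).symm
  rw [← Ext.mk₀_id_comp e, h1, Ext.mk₀_smul, Ext.smul_comp, Ext.smul_eq_comp_mk₀,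
    show x • 𝟙 D = 0 by ext d; exact hx d, Ext.mk₀_zero, Ext.comp_zero]

open Cx in
lemma loc (x : R) (hx : ∀ d : D, x • d = 0) (j : ℕ) : TT D (L x N) j := by
  have h := IsLocalizedModule.map_units (S := Submonoid.powers x) (ι x N) ⟨x, 1, pow_one x⟩
  obtain ⟨u, hu⟩ := h
  refine of_unit x hx (↑u⁻¹) (fun n => ?_) j
  have := LinearMap.congr_fun u.mul_inv n
  rw [hu] at this
  exact this

end TT

set_option linter.unusedVariables false

namespace Cx
variable {R : Type u} [CommRing R]

def gamB (A : Cx R) (i : ℤ) : A.X i →ₗ[R] (A.B i).comap (A.Z (i + 1)).subtype :=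
  LinearMap.codRestrict _ (LinearMap.codRestrict (A.Z (i + 1)) (A.d i) (fun x => A.dd i x))
    (fun x => ⟨x, rfl⟩)

lemma gamB_surj (A : Cx R) (i : ℤ) : Function.Surjective (A.gamB i) := by
  rintro ⟨⟨y, hy⟩, x, hx⟩
  exact ⟨x, Subtype.ext (Subtype.ext hx)⟩

lemma gamB_exact (A : Cx R) (i : ℤ) : Function.Exact (A.Z i).subtype (A.gamB i) := by
  intro x
  constructor
  · intro h
    have : A.d i x = 0 := congrArg (fun y => (y.1.1 : A.X (i + 1))) h
    exact ⟨⟨x, this⟩, rfl⟩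
  · rintro ⟨⟨x, hx⟩, rfl⟩
    exact Subtype.ext (Subtype.ext hx)

section
variable (D : ModuleCat.{u} R) (C : Cx R) (a : ℤ) (hC : ∀ i, 0 < i → Subsingleton (C.X i))
  (hT : ∀ i, a ≤ i → ∀ j, TT D (C.X i) j) (hH : ∀ i, a < i → ∀ j, TT D (C.H i) j)
include hC hT hH

lemma TT_Z (k : ℕ) : ∀ i : ℤ, a < i → 1 - (k : ℤ) ≤ i → ∀ j, TT D (C.Z i) j := by
  induction k with
  | zero =>
    intro i _ h j
    have := hC i (by push_cast at h; lia)
    exact TT.of_subsingleton j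
  | succ k ih =>
    intro i hi h j
    have hz := ih (i + 1) (by lia) (by push_cast at h; lia)
    refine TT.left _ _ (Submodule.subtype_injective _) (C.gamB_surj i) (C.gamB_exact i)
      (hT i hi.le j) ?_
    exact TT.left (Submodule.subtype _) (Submodule.mkQ _) (Submodule.subtype_injective _)
      (Submodule.mkQ_surjective _) (LinearMap.exact_subtype_mkQ _) (hz _) (hH i hi _)

lemma TT_final : TT D (C.H a) 0 ∧ TT D (C.H a) 1 := by
  have hz : ∀ j, TT D (C.Z (a + 1)) j :=
    TT_Z D C a hC hT hH (a.natAbs) (a + 1) (by lia) (by lia)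
  refine ⟨TT.quot _ (Submodule.mkQ_surjective _) (hz 0), ?_⟩
  exact TT.right (Submodule.subtype _) (Submodule.mkQ _) (Submodule.subtype_injective _)
      (Submodule.mkQ_surjective _) (LinearMap.exact_subtype_mkQ _)
      (TT.quot _ (C.gamB_surj a) (hT a le_rfl 0)) (hz 1)
end

/-- torsion submodule -/
def Gam (l : List R) (M : Type u) [AddCommGroup M] [Module R M] : Submodule R M where
  carrier := {e | ∀ x ∈ l, ∃ k : ℕ, x ^ k • e = 0}
  zero_mem' x _ := ⟨0, smul_zero _⟩
  add_mem' {a b} ha hb x hx := by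
    obtain ⟨k, hk⟩ := ha x hx
    obtain ⟨m, hm⟩ := hb x hx
    refine ⟨k + m, ?_⟩
    rw [smul_add, pow_add, mul_smul, mul_smul, hm, smul_comm, hk]; simp
  smul_mem' r a ha x hx := by
    obtain ⟨k, hk⟩ := ha x hx
    exact ⟨k, by rw [smul_comm, hk, smul_zero]⟩

lemma Gam_map (l : List R) {M N : Type u} [AddCommGroup M] [Module R M] [AddCommGroup N]
    [Module R N] (f : M →ₗ[R] N) (m : M) (h : m ∈ Gam l M) : f m ∈ Gam l N := by
  intro x hx
  obtain ⟨k, hk⟩ := h x hx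
  exact ⟨k, by rw [← map_smul, hk, map_zero]⟩

@[reducible] def gam (l : List R) (E : Cx R) : Cx R where
  X i := Gam l (E.X i)
  d i := (E.d i).restrict (Gam_map l (E.d i))
  dd i x := Subtype.ext (E.dd i x)

def gamIncl (x : R) (l : List R) (E : Cx R) : Hom (gam (x :: l) E) (gam l E) where
  f i := Submodule.inclusion (fun _ h y hy => h y (List.mem_cons_of_mem _ hy))
  comm i e := rfl

lemma exists_div [IsNoetherianRing R] (Q : Type u) [AddCommGroup Q] [Module R Q]
    [Module.Injective R Q] (e : Q) (x : R) (n : ℕ) :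
    ∃ (e' : Q) (k : ℕ), (∀ a : R, a • e = 0 → a • e' = 0) ∧ x ^ (n + k) • e' = x ^ k • e := by
  let K : ℕ →o Ideal R :=
    { toFun := fun k => LinearMap.ker ((LinearMap.toSpanSingleton R Q e) ∘ₗ
        (LinearMap.mulLeft R (x ^ k)))
      monotone' := by
        intro k m hkm r hr
        obtain ⟨c, rfl⟩ := Nat.exists_eq_add_of_le hkm
        simp only [LinearMap.mem_ker, LinearMap.comp_apply, LinearMap.mulLeft_apply,
          LinearMap.toSpanSingleton_apply] at hr ⊢
        rw [show x ^ (k + c) * r = x ^ c * (x ^ k * r) by ring, mul_smul, hr, smul_zero] }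
  obtain ⟨k, hk⟩ := monotone_stabilizes_iff_noetherian.2 (inferInstanceAs (IsNoetherian R R)) K
  let 𝔞 : Ideal R := LinearMap.ker (LinearMap.toSpanSingleton R Q e)
  let p : R →ₗ[R] R ⧸ 𝔞 := Submodule.mkQ 𝔞 ∘ₗ LinearMap.mulLeft R (x ^ (n + k))
  let q : R →ₗ[R] Q := (LinearMap.toSpanSingleton R Q e) ∘ₗ (LinearMap.mulLeft R (x ^ k))
  have hpq : LinearMap.ker p ≤ LinearMap.ker q := by
    intro r hr
    change r ∈ K k
    rw [hk (n + k) (by lia)]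
    have : x ^ (n + k) * r ∈ 𝔞 := (Submodule.Quotient.mk_eq_zero _).1 hr
    exact this
  obtain ⟨h, hh⟩ := Module.Injective.out (R := R) (Q := Q) ((LinearMap.ker p).liftQ p le_rfl)
    (LinearMap.ker_eq_bot.1 (Submodule.ker_liftQ_eq_bot _ _ _ le_rfl))
    ((LinearMap.ker p).liftQ q hpq)
  refine ⟨h (Submodule.Quotient.mk 1), k, ?_, ?_⟩
  · intro a ha
    rw [← map_smul, ← Submodule.Quotient.mk_smul, smul_eq_mul, mul_one,
      (Submodule.Quotient.mk_eq_zero 𝔞).2 (show a ∈ 𝔞 from ha), map_zero]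
  · have := hh (Submodule.Quotient.mk 1)
    rw [Submodule.liftQ_apply, Submodule.liftQ_apply] at this
    rw [← map_smul, ← Submodule.Quotient.mk_smul]
    simpa [p, q] using this

lemma gamIncl_tors [IsNoetherianRing R] (x : R) (l : List R) (E : Cx R)
    (hE : ∀ i, Module.Injective R (E.X i)) : (gamIncl x l E).Tors x where
  inj i a b h := Subtype.ext (by
    have := congrArg (fun z : Gam l (E.X i) => z.1) h
    exact this)
  tors i a := by
    obtain ⟨k, hk⟩ := a.2 x List.mem_cons_self
    exact ι_zero' x k (Subtype.ext hk)
  mem i b hb := by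
    obtain ⟨k, hk⟩ := ι_zero x hb
    refine ⟨⟨b.1, fun y hy => ?_⟩, rfl⟩
    rcases List.mem_cons.1 hy with rfl | hy
    · exact ⟨k, congrArg Subtype.val hk⟩
    · exact b.2 y hy
  surj i y := by
    obtain ⟨n, m, hm⟩ := L_rep x y
    have := hE i
    obtain ⟨e', k, h1, h2⟩ := exists_div (E.X i) m.1 x n
    let e'' : Gam l (E.X i) := ⟨e', fun z hz => by
      obtain ⟨c, hc⟩ := m.2 z hz
      exact ⟨c, h1 _ hc⟩⟩
    refine ⟨e'', ?_⟩
    rw [← sub_eq_zero]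
    apply L_inj x (k := n + k)
    have h3 : x ^ (n + k) • e'' = x ^ k • m := Subtype.ext h2
    rw [smul_sub, ← map_smul, h3, add_comm, pow_add, mul_smul, hm, map_smul, sub_self]

/-- truncation -/
def tr (E : Cx R) (i : ℤ) : Submodule R (E.X i) where
  carrier := {e | (0 ≤ i → E.d i e = 0) ∧ (0 < i → e = 0)}
  zero_mem' := by simp
  add_mem' {a b} ha hb := by
    refine ⟨fun h => ?_, fun h => ?_⟩
    · rw [map_add, ha.1 h, hb.1 h, add_zero]
    · rw [ha.2 h, hb.2 h, add_zero]
  smul_mem' r a ha := by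
    refine ⟨fun h => ?_, fun h => ?_⟩
    · rw [map_smul, ha.1 h, smul_zero]
    · rw [ha.2 h, smul_zero]

@[reducible] def trunc (E : Cx R) : Cx R where
  X i := tr E i
  d i := (E.d i).restrict (fun e he => ⟨fun _ => E.dd i e, fun h => he.1 (by lia)⟩)
  dd i x := Subtype.ext (E.dd i x)

def truncIncl (E : Cx R) : Hom (trunc E) E where
  f i := (tr E i).subtype
  comm i e := rfl

lemma truncIncl_qis (E : Cx R) (hE : ∀ i, 0 ≤ i → ∀ y, E.d (i + 1) y = 0 → ∃ w, E.d i w = y) :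
    (truncIncl E).Qis where
  inj i x y hx h := by
    by_cases hi : 0 ≤ i
    · refine ⟨0, ?_⟩
      rw [map_zero]
      exact Subtype.ext (x.2.2 (by lia)).symm
    · exact ⟨⟨y, fun h => absurd h hi, fun h => absurd h.le hi⟩, Subtype.ext h.symm⟩
  surj i y hy := by
    by_cases hi : 0 ≤ i
    · obtain ⟨w, hw⟩ := hE i hi y hy
      exact ⟨0, w, map_zero _, by rw [map_zero, zero_add, hw]⟩
    · refine ⟨⟨y, fun _ => hy, fun h => absurd (show 0 ≤ i by lia) hi⟩, 0, Subtype.ext hy, ?_⟩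
      rw [map_zero, add_zero]; rfl

def gamNil (E : Cx R) : Hom (gam [] E) E where
  f i := (Gam [] (E.X i)).subtype
  comm i e := rfl

lemma gamNil_qis (E : Cx R) : (gamNil E).Qis where
  inj i x y hx h := ⟨⟨y, by rintro _ ⟨⟩⟩, Subtype.ext h.symm⟩
  surj i y hy := ⟨⟨y, by rintro _ ⟨⟩⟩, 0, Subtype.ext hy, by rw [map_zero, add_zero]; rfl⟩

lemma main_claim [IsNoetherianRing R] (D : ModuleCat.{u} R) (E : Cx R)
    (hE : ∀ i, Module.Injective R (E.X i))
    (hE' : ∀ i, 0 ≤ i → ∀ y, E.d (i + 1) y = 0 → ∃ w, E.d i w = y)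
    (l : List R) (hl : ∀ x ∈ l, ∀ d : D, x • d = 0) :
    ∃ (C W : Cx R) (φ : Hom C W) (ψ : Hom (shn l.length (gam l E)) W), φ.Qis ∧ ψ.Qis ∧
      (∀ i, 0 < i → Subsingleton (C.X i)) ∧
      ∀ i, -(l.length : ℤ) < i → ∀ j, TT D (C.X i) j := by
  induction l with
  | nil =>
    have hs : ∀ i, 0 < i → Subsingleton ((trunc E).X i) := fun i hi =>
      ⟨fun a b => Subtype.ext (by rw [a.2.2 hi, b.2.2 hi])⟩
    refine ⟨trunc E, E, truncIncl E, gamNil E, truncIncl_qis E hE', gamNil_qis E, hs, ?_⟩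
    intro i hi j
    have := hs i (by simpa using hi)
    exact TT.of_subsingleton j
  | cons x l ih =>
    obtain ⟨C, W, φ, ψ, h1, h2, h3, h4⟩ := ih (fun y hy => hl y (List.mem_cons_of_mem _ hy))
    have ht := (gamIncl_tors x l E hE).shn x l.length
    refine ⟨C.fib x, W.fib x, φ.fib x, ht.fib.comp (ψ.fib x), h1.fib x,
      (ht.qis x).comp (h2.fib x), ?_, ?_⟩
    · intro i hi
      have := h3 i hi
      have := h3 (i + 1) (by lia)
      have : Subsingleton (L x (C.X i)) := ⟨fun a b => by
        rw [← sub_eq_zero]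
        obtain ⟨k, m, hm⟩ := L_rep x (a - b)
        apply L_inj x (k := k)
        rw [hm, Subsingleton.elim m 0, map_zero]⟩
      exact inferInstanceAs (Subsingleton (C.X (i + 1) × L x (C.X i)))
    · intro i hi j
      simp only [List.length_cons, Nat.cast_add, Nat.cast_one] at hi
      exact TT.prod (h4 (i + 1) (by lia) j) (TT.loc x (hl x List.mem_cons_self) j)

lemma main_T [IsNoetherianRing R] (D : ModuleCat.{u} R) (E : Cx R)
    (hE : ∀ i, Module.Injective R (E.X i))
    (hE' : ∀ i, 0 ≤ i → ∀ y, E.d (i + 1) y = 0 → ∃ w, E.d i w = y)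
    (l : List R) (hl : ∀ x ∈ l, ∀ d : D, x • d = 0) (t : ℤ) (ht : 0 < t)
    (h : ∀ i, t < i → ∀ j, TT D ((gam l E).H i) j) :
    TT D ((gam l E).H t) 0 ∧ TT D ((gam l E).H t) 1 := by
  obtain ⟨C, W, φ, ψ, h1, h2, h3, h4⟩ := main_claim D E hE hE' l hl
  have key : ∀ i : ℤ, Nonempty ((gam l E).H i ≃ₗ[R] C.H (i - l.length)) := by
    intro i
    obtain ⟨e1⟩ := H_shn (gam l E) l.length (i - l.length) i (by lia)
    obtain ⟨e2⟩ := h1.H (i - l.length)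
    obtain ⟨e3⟩ := h2.H (i - l.length)
    exact ⟨e1.symm.trans (e3.trans e2.symm)⟩
  obtain ⟨e⟩ := key t
  have := TT_final D C (t - l.length) h3 (fun i hi => h4 i (by lia)) (fun i hi j => by
    obtain ⟨e⟩ := key (i + l.length)
    rw [add_sub_cancel_right] at e
    exact (h _ (by lia) j).of_equiv e)
  exact ⟨this.1.of_equiv e.symm, this.2.of_equiv e.symm⟩
end Cx

namespace TorExt
variable {R : Type u} [CommRing R]

lemma dual_exact_iff {N₁ N₂ N₃ : Type u} [AddCommGroup N₁] [Module R N₁] [AddCommGroup N₂]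
    [Module R N₂] [AddCommGroup N₃] [Module R N₃] (f : N₁ →ₗ[R] N₂) (g : N₂ →ₗ[R] N₃) :
    Function.Exact (CharacterModule.dual g) (CharacterModule.dual f) ↔ Function.Exact f g := by
  constructor
  · intro h
    have hgf : ∀ y, g (f y) = 0 := fun y => CharacterModule.eq_zero_of_character_apply fun c => by
      have := h.apply_apply_eq_zero c
      exact DFunLike.congr_fun this y
    intro x
    refine ⟨fun hx => ?_, by rintro ⟨y, rfl⟩; exact hgf y⟩
    change x ∈ LinearMap.range f
    rw [← Submodule.Quotient.mk_eq_zero]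
    refine CharacterModule.eq_zero_of_character_apply fun c => ?_
    obtain ⟨c', hc'⟩ := (h (CharacterModule.dual (Submodule.mkQ (LinearMap.range f)) c)).1 (by
      ext y
      change c (Submodule.Quotient.mk (f y)) = 0
      rw [(Submodule.Quotient.mk_eq_zero _).2 (LinearMap.mem_range_self f y), map_zero])
    have h2 := DFunLike.congr_fun hc' x
    change c' (g x) = c (Submodule.Quotient.mk x) at h2
    rw [← h2, hx, map_zero]
  · intro h c
    constructor
    · intro hc
      have hk : ∀ x, g x = 0 → c x = 0 := by
        intro x hx
        obtain ⟨y, rfl⟩ := (h x).1 hx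
        exact DFunLike.congr_fun hc y
      let q : (N₂ ⧸ LinearMap.ker g) →ₗ[R] N₃ := (LinearMap.ker g).liftQ g le_rfl
      have hq : Function.Injective q :=
        LinearMap.ker_eq_bot.1 (Submodule.ker_liftQ_eq_bot _ _ _ le_rfl)
      let c0 : CharacterModule (N₂ ⧸ LinearMap.ker g) :=
        QuotientAddGroup.lift (LinearMap.ker g).toAddSubgroup (c : N₂ →+ AddCircle (1 : ℚ))
          (fun x hx => hk x hx)
      obtain ⟨c', hc'⟩ := CharacterModule.dual_surjective_of_injective q hq c0
      refine ⟨c', ?_⟩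
      ext x
      exact DFunLike.congr_fun hc' (Submodule.Quotient.mk x)
    · rintro ⟨c', rfl⟩
      ext y
      change c' (g (f y)) = 0
      rw [h.apply_apply_eq_zero, map_zero]

lemma tensor_exact_iff (B : Type u) [AddCommGroup B] [Module R B]
    {N₁ N₂ N₃ : Type u} [AddCommGroup N₁] [Module R N₁] [AddCommGroup N₂]
    [Module R N₂] [AddCommGroup N₃] [Module R N₃] (f : N₁ →ₗ[R] N₂) (g : N₂ →ₗ[R] N₃) :
    Function.Exact (f.lTensor B) (g.lTensor B) ↔
      Function.Exact (g.lcomp R (CharacterModule B)) (f.lcomp R (CharacterModule B)) := by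
  rw [← LinearMap.rTensor_exact_iff_lTensor_exact, ← dual_exact_iff]
  apply Function.Exact.iff_of_ladder_linearEquiv (e₁ := CharacterModule.homEquiv)
    (e₂ := CharacterModule.homEquiv) (e₃ := CharacterModule.homEquiv)
  · rw [← CharacterModule.dual_rTensor_conj_homEquiv]; ext x : 1; simp; rfl
  · rw [← CharacterModule.dual_rTensor_conj_homEquiv]; ext x : 1; simp; rfl

open Abelian in
lemma main (A N : ModuleCat.{u} R) (n : ℕ) : Subsingleton (TorMod R n A N) ↔
    TT (ModuleCat.of R (CharacterModule A)) N n := by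
  rcases n with _ | p
  · let e1 : TorMod R 0 A N ≅ MonoidalCategory.tensorObj A N :=
      (Functor.leftDerivedZeroIsoSelf ((MonoidalCategory.tensoringLeft (ModuleCat.{u} R)).obj A)).app N
    let e2 : Ext.{u} (ModuleCat.of R N) (ModuleCat.of R (CharacterModule A)) 0 ≃ (N →ₗ[R] CharacterModule A) :=
      Ext.homEquiv₀.trans ModuleCat.homEquiv
    rw [e1.toLinearEquiv.toEquiv.subsingleton_congr, TT, e2.subsingleton_congr,
      CharacterModule.homEquiv.toEquiv.subsingleton_congr]
    change Subsingleton (TensorProduct R A N) ↔ _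
    rw [(TensorProduct.comm R A N).toEquiv.subsingleton_congr]
    constructor
    · intro h
      exact ⟨fun a b => by ext x; rw [Subsingleton.elim x 0, map_zero, map_zero]⟩
    · intro h
      exact subsingleton_of_forall_eq 0 fun x => CharacterModule.eq_zero_of_character_apply fun c =>
        by rw [Subsingleton.elim c 0]; rfl
  · let P := projectiveResolution N
    let F := (MonoidalCategory.tensoringLeft (ModuleCat.{u} R)).obj A
    let e1 : TorMod R (p + 1) A N ≅ _ := P.isoLeftDerivedObj F (p + 1)
    have h1 : Subsingleton (TorMod R (p + 1) A N) ↔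
        Function.Exact ((P.complex.d (p + 2) (p + 1)).hom.lTensor A)
          ((P.complex.d (p + 1) p).hom.lTensor A) := by
      rw [← ModuleCat.isZero_iff_subsingleton, e1.isZero_iff]
      change Limits.IsZero (HomologicalComplex.homology _ (p + 1)) ↔ _
      rw [← HomologicalComplex.exactAt_iff_isZero_homology,
        HomologicalComplex.exactAt_iff' _ (p + 2) (p + 1) p (by simp) (by simp),
        ShortComplex.ShortExact.moduleCat_exact_iff_function_exact]
      rfl
    rw [h1, tensor_exact_iff, TT.iff_zero]
    constructor
    · intro h e
      obtain ⟨f, hf, rfl⟩ := P.extMk_surjective e (p + 2) rfl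
      rw [P.extMk_eq_zero_iff f (p + 2) rfl hf p rfl]
      obtain ⟨g, hg⟩ := (h f.hom).1 (congrArg ModuleCat.Hom.hom hf)
      exact ⟨ModuleCat.ofHom g, ModuleCat.hom_ext hg⟩
    · intro h f
      constructor
      · intro hf
        obtain ⟨g, hg⟩ := (P.extMk_eq_zero_iff (ModuleCat.ofHom f) (p + 2) rfl
          (ModuleCat.hom_ext hf) p rfl).1 (h _)
        exact ⟨g.hom, congrArg ModuleCat.Hom.hom hg⟩
      · rintro ⟨g, rfl⟩
        ext x : 1
        change g ((P.complex.d (p + 2) (p + 1) ≫ P.complex.d (p + 1) p) x) = 0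
        rw [P.complex.d_comp_d]; simp
end TorExt

namespace DExt
variable {R : Type u} [CommRing R]

section opc
variable (K : ChainComplex (ModuleCat.{u} R)ᵒᵖ ℕ)

lemma c_surj (n : ℕ) : Function.Surjective (K.homologyι n).unop :=
  (ModuleCat.epi_iff_surjective _).1 inferInstance

lemma i_inj (n : ℕ) : Function.Injective (K.pOpcycles n).unop :=
  (ModuleCat.mono_iff_injective _).1 inferInstance

lemma i_range (n m : ℕ) (hm : n + 1 = m) :
    Function.Exact (K.pOpcycles n).unop (K.d m n).unop := by
  have h := K.d_pOpcycles m n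
  have h1 : (ShortComplex.mk _ _ h).Exact :=
    ShortComplex.exact_of_g_is_cokernel _ (K.opcyclesIsCokernel m n (by simp [hm]))
  exact (ShortComplex.ShortExact.moduleCat_exact_iff_function_exact _).1 h1.unop

lemma c_ker (n p : ℕ) (hp : p + 1 = n) :
    Function.Exact (K.fromOpcycles n p).unop (K.homologyι n).unop := by
  have h := K.homologyι_comp_fromOpcycles n p
  have h1 : (ShortComplex.mk _ _ h).Exact :=
    ShortComplex.exact_of_f_is_kernel _ (K.homologyIsKernel n p (by simp [← hp]))
  exact (ShortComplex.ShortExact.moduleCat_exact_iff_function_exact _).1 h1.unop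

lemma c_zero (n p : ℕ) (hp : p + 1 = n) (z : (K.opcycles n).unop) :
    (K.homologyι n).unop z = 0 ↔ ∃ g, (K.d n p).unop g = (K.pOpcycles n).unop z := by
  have h : (K.d n p).unop = (K.fromOpcycles n p).unop ≫ (K.pOpcycles n).unop := by
    rw [← unop_comp, K.p_fromOpcycles]
  rw [c_ker K n p hp z, h]
  constructor
  · rintro ⟨g, rfl⟩
    exact ⟨g, rfl⟩
  · rintro ⟨g, hg⟩
    exact ⟨g, i_inj K n hg⟩
end opc

variable (Y : ModuleCat.{u} R) (n : ℕ)

abbrev FY : ModuleCat.{u} R ⥤ (ModuleCat.{u} R)ᵒᵖ := ((linearYoneda R (ModuleCat.{u} R)).obj Y).rightOp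

abbrev dE (X : ModuleCat.{u} R) : ModuleCat.{u} R :=
  ((Ext R (ModuleCat.{u} R) n).obj (Opposite.op X)).obj Y

abbrev dmap {X X' : ModuleCat.{u} R} (a : X' ⟶ X) : dE Y n X ⟶ dE Y n X' :=
  ((Ext R (ModuleCat.{u} R) n).map a.op).app Y

abbrev KP {X : ModuleCat.{u} R} (P : ProjectiveResolution X) : ChainComplex (ModuleCat.{u} R)ᵒᵖ ℕ :=
  ((FY Y).mapHomologicalComplex _).obj P.complex

def ci {X : ModuleCat.{u} R} (P : ProjectiveResolution X) (z : ((KP Y P).opcycles n).unop) :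
    P.complex.X n ⟶ Y := ((KP Y P).pOpcycles n).unop z

def cc {X : ModuleCat.{u} R} (P : ProjectiveResolution X) :
    ((KP Y P).opcycles n).unop ⟶ dE Y n X :=
  ((KP Y P).homologyι n).unop ≫ (P.isoLeftDerivedObj (FY Y) n).hom.unop

section
variable {X : ModuleCat.{u} R} (P : ProjectiveResolution X)

lemma ci_add (z w) : ci Y n P (z + w) = ci Y n P z + ci Y n P w := map_add _ _ _
lemma ci_smul (r : R) (z) : ci Y n P (r • z) = r • ci Y n P z := map_smul _ _ _

lemma ci_d (z) : P.complex.d (n + 1) n ≫ ci Y n P z = 0 :=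
  (i_range (KP Y P) n (n + 1) rfl).apply_apply_eq_zero z

lemma ci_surj (f : P.complex.X n ⟶ Y) (hf : P.complex.d (n + 1) n ≫ f = 0) :
    ∃ z, ci Y n P z = f := (i_range (KP Y P) n (n + 1) rfl f).1 hf

lemma cc_surj (e : dE Y n X) : ∃ z, cc Y n P z = e := by
  obtain ⟨e', he'⟩ : ∃ e', (P.isoLeftDerivedObj (FY Y) n).hom.unop e' = e :=
    ((ModuleCat.epi_iff_surjective (P.isoLeftDerivedObj (FY Y) n).hom.unop).1 inferInstance) e
  obtain ⟨z, rfl⟩ := c_surj (KP Y P) n e'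
  exact ⟨z, he'⟩

lemma cc_zero (p : ℕ) (hp : p + 1 = n) (z) :
    cc Y n P z = 0 ↔ ∃ g, P.complex.d n p ≫ g = ci Y n P z := by
  have h1 : cc Y n P z = 0 ↔ ((KP Y P).homologyι n).unop z = 0 := by
    have hi : Function.Injective (P.isoLeftDerivedObj (FY Y) n).hom.unop :=
      ((ModuleCat.mono_iff_injective (P.isoLeftDerivedObj (FY Y) n).hom.unop).1 inferInstance)
    constructor
    · intro h
      apply hi
      exact h.trans (map_zero (P.isoLeftDerivedObj (FY Y) n).hom.unop.hom).symm
    · intro h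
      change (P.isoLeftDerivedObj (FY Y) n).hom.unop (((KP Y P).homologyι n).unop z) = 0
      rw [h]
      exact map_zero (P.isoLeftDerivedObj (FY Y) n).hom.unop.hom
  rw [h1, c_zero _ n p hp]
  rfl

lemma natural {X' : ModuleCat.{u} R} (P' : ProjectiveResolution X') (a : X' ⟶ X)
    (φ : ProjectiveResolution.Hom P' P a) (z) :
    ∃ z', ci Y n P' z' = φ.hom.f n ≫ ci Y n P z ∧ cc Y n P' z' = dmap Y n a (cc Y n P z) := by
  let Φ : KP Y P' ⟶ KP Y P := ((FY Y).mapHomologicalComplex _).map φ.hom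
  refine ⟨(HomologicalComplex.opcyclesMap Φ n).unop z, ?_, ?_⟩
  · have h := congrArg Quiver.Hom.unop (HomologicalComplex.p_opcyclesMap Φ n)
    exact congrArg (fun q => q.hom z) h
  · have h := P'.isoLeftDerivedObj_hom_naturality a P φ.hom (by simpa using φ.hom_f_zero_comp_π_f_zero) (FY Y) n
    have h' := congrArg Quiver.Hom.unop h
    have h2 := congrArg Quiver.Hom.unop (HomologicalComplex.homologyι_naturality Φ n)
    have h3 := congrArg (fun q => q.hom (((KP Y P).homologyι n).unop z)) h'
    have h4 := congrArg (fun q => q.hom z) h2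
    refine Eq.trans ?_ h3.symm
    change (P'.isoLeftDerivedObj (FY Y) n).hom.unop _ = (P'.isoLeftDerivedObj (FY Y) n).hom.unop _
    congr 1
    exact h4.symm
end
end DExt

namespace DExt
open Abelian
variable {R : Type u} [CommRing R]

lemma smul_P {X Y : ModuleCat.{u} R} (P : ProjectiveResolution X) {n : ℕ} (f : P.complex.X n ⟶ Y)
    (hf : P.complex.d (n + 1) n ≫ f = 0) (r : R) :
    r • P.extMk f (n + 1) rfl hf =
      P.extMk (r • f) (n + 1) rfl (by rw [Linear.comp_smul, hf, smul_zero]) := by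
  rw [Ext.smul_eq_comp_mk₀, P.extMk_comp_mk₀]
  congr 1

lemma smul_E {X Y : ModuleCat.{u} R} (E : InjectiveResolution Y) {n : ℕ} (f : X ⟶ E.cocomplex.X n)
    (hf : f ≫ E.cocomplex.d n (n + 1) = 0) (r : R) :
    r • E.extMk f (n + 1) rfl hf =
      E.extMk (r • f) (n + 1) rfl (by rw [Linear.smul_comp, hf, smul_zero]) := by
  conv_lhs => rw [← Ext.mk₀_id_comp (E.extMk f (n + 1) rfl hf)]
  rw [← Ext.smul_comp, ← Ext.mk₀_smul, E.mk₀_comp_extMk]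
  congr 1
  rw [Linear.smul_comp, Category.id_comp]

variable {Y : ModuleCat.{u} R} (E : InjectiveResolution Y) (n : ℕ)

def Rel {X : ModuleCat.{u} R} (g : X ⟶ E.cocomplex.X n) (e : dE Y n X) : Prop :=
  ∃ (hg : g ≫ E.cocomplex.d n (n + 1) = 0) (z : _),
    (projectiveResolution X).extMk (ci Y n _ z) (n + 1) rfl (ci_d Y n _ z) =
      E.extMk g (n + 1) rfl hg ∧ cc Y n (projectiveResolution X) z = e

section
variable {E n}
variable {X : ModuleCat.{u} R}

lemma Rel.tot (g : X ⟶ E.cocomplex.X n) (hg : g ≫ E.cocomplex.d n (n + 1) = 0) :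
    ∃ e, Rel E n g e := by
  obtain ⟨f, hf, h⟩ := (projectiveResolution X).extMk_surjective (E.extMk g (n + 1) rfl hg) (n + 1) rfl
  obtain ⟨z, rfl⟩ := ci_surj Y n _ f hf
  exact ⟨_, hg, z, h, rfl⟩

lemma Rel.onto (e : dE Y n X) : ∃ g, Rel E n g e := by
  obtain ⟨z, rfl⟩ := cc_surj Y n (projectiveResolution X) e
  obtain ⟨g, hg, h⟩ := E.extMk_surjective
    ((projectiveResolution X).extMk (ci Y n _ z) (n + 1) rfl (ci_d Y n _ z)) (n + 1) rfl
  exact ⟨g, hg, z, h.symm, rfl⟩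

lemma Rel.add {g g' : X ⟶ E.cocomplex.X n} {e e' : dE Y n X} (h : Rel E n g e) (h' : Rel E n g' e') :
    Rel E n (g + g') (e + e') := by
  obtain ⟨hg, z, h1, rfl⟩ := h
  obtain ⟨hg', z', h1', rfl⟩ := h'
  refine ⟨by rw [Preadditive.add_comp, hg, hg', add_zero], z + z', ?_, map_add _ _ _⟩
  rw [← E.add_extMk _ _ _ _ hg hg', ← h1, ← h1', ProjectiveResolution.add_extMk]
  congr 1
  exact ci_add Y n _ z z'

lemma Rel.smul {g : X ⟶ E.cocomplex.X n} {e : dE Y n X} (h : Rel E n g e) (r : R) :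
    Rel E n (r • g) (r • e) := by
  obtain ⟨hg, z, h1, rfl⟩ := h
  refine ⟨by rw [Linear.smul_comp, hg, smul_zero], r • z, ?_, map_smul _ _ _⟩
  rw [← smul_E E g hg, ← h1, smul_P]
  congr 1
  exact ci_smul Y n _ r z

lemma Rel.zero_iff {g : X ⟶ E.cocomplex.X n} {e : dE Y n X} (h : Rel E n g e)
    (p : ℕ) (hp : p + 1 = n) :
    e = 0 ↔ ∃ k : X ⟶ E.cocomplex.X p, k ≫ E.cocomplex.d p n = g := by
  obtain ⟨hg, z, h1, rfl⟩ := h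
  rw [← E.extMk_eq_zero_iff g (n + 1) rfl hg p hp, ← h1,
    ProjectiveResolution.extMk_eq_zero_iff _ _ _ _ _ p hp, cc_zero Y n _ p hp]

lemma Rel.nat {X' : ModuleCat.{u} R} (a : X' ⟶ X) {g : X ⟶ E.cocomplex.X n} {e : dE Y n X}
    (h : Rel E n g e) : Rel E n (a ≫ g) (dmap Y n a e) := by
  obtain ⟨hg, z, h1, rfl⟩ := h
  let φ : ProjectiveResolution.Hom (projectiveResolution X') (projectiveResolution X) a :=
    ⟨ProjectiveResolution.lift a _ _, by simp; exact ProjectiveResolution.lift_commutes_zero _ _ _⟩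
  obtain ⟨z', h2, h3⟩ := natural Y n (projectiveResolution X) (projectiveResolution X') a φ z
  refine ⟨by rw [Category.assoc, hg, Limits.comp_zero], z', ?_, h3⟩
  rw [← E.mk₀_comp_extMk g _ _ hg, ← h1, ProjectiveResolution.mk₀_comp_extMk _ _ _ _ φ]
  congr 1
end

lemma relIso {M N : Type u} [AddCommGroup M] [Module R M] [AddCommGroup N] [Module R N]
    (Q : Submodule R (M × N)) (tot : ∀ m, ∃ n, (m, n) ∈ Q) (onto : ∀ n, ∃ m, (m, n) ∈ Q)
    (S : Submodule R M) (h : ∀ m n, (m, n) ∈ Q → (n = 0 ↔ m ∈ S)) :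
    Nonempty (N ≃ₗ[R] (M ⧸ S)) := by
  let p2 : Q →ₗ[R] N := LinearMap.snd R M N ∘ₗ Q.subtype
  let p1 : Q →ₗ[R] M ⧸ S := S.mkQ ∘ₗ LinearMap.fst R M N ∘ₗ Q.subtype
  have s2 : Function.Surjective p2 := fun n => by
    obtain ⟨m, hm⟩ := onto n
    exact ⟨⟨_, hm⟩, rfl⟩
  have s1 : Function.Surjective p1 := fun m => by
    obtain ⟨m, rfl⟩ := S.mkQ_surjective m
    obtain ⟨n, hn⟩ := tot m
    exact ⟨⟨_, hn⟩, rfl⟩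
  have hk : LinearMap.ker p2 = LinearMap.ker p1 := by
    ext ⟨⟨m, n⟩, hq⟩
    rw [LinearMap.mem_ker, LinearMap.mem_ker]
    change n = 0 ↔ Submodule.Quotient.mk m = 0
    rw [Submodule.Quotient.mk_eq_zero, h m n hq]
  exact ⟨((p2.quotKerEquivOfSurjective s2).symm.trans (Submodule.quotEquivOfEq _ _ hk)).trans
    (p1.quotKerEquivOfSurjective s1)⟩
end DExt

namespace LCx
open DExt
variable {R : Type u} [CommRing R] (I : Ideal R) (t : ℕ) (M : ModuleCat.{u} R)

abbrev q (n : ℕ) : ModuleCat.{u} R := ModuleCat.of R (R ⧸ I ^ n)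
def tr {n m : ℕ} (h : n ≤ m) : q I m ⟶ q I n :=
  ModuleCat.ofHom (Submodule.mapQ _ _ LinearMap.id (Ideal.pow_le_pow_right h))

abbrev dg : (ℕᵒᵖ)ᵒᵖ ⥤ ModuleCat.{u} R ⥤ ModuleCat.{u} R :=
  localCohomology.diagram (localCohomology.idealPowersDiagram I) t

lemma hasC : Limits.HasColimit (dg I t) := inferInstance

abbrev ix (n : ℕ) : (ℕᵒᵖ)ᵒᵖ := Opposite.op (Opposite.op n)

def inc (n : ℕ) : dE M t (q I n) ⟶ LC R I t M :=
  (Limits.colimit.ι (dg I t) (ix n)).app M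

def isC : Limits.IsColimit (((evaluation _ _).obj M).mapCocone (Limits.colimit.cocone (dg I t))) :=
  Limits.isColimitOfPreserves ((evaluation _ _).obj M) (Limits.colimit.isColimit _)

lemma inc_tr {n m : ℕ} (h : n ≤ m) (e) : inc I t M m (dmap M t (tr I h) e) = inc I t M n e := by
  have h1 := Limits.colimit.w (dg I t) (show ix n ⟶ ix m from (homOfLE h).op.op)
  have h2 := congrArg (fun q => (q.app M).hom e) h1
  exact h2

instance : IsFiltered (ℕᵒᵖ)ᵒᵖ := inferInstance

instance : Limits.PreservesColimitsOfShape (ℕᵒᵖ)ᵒᵖ (forget (ModuleCat.{u} R)) := by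
  have : Limits.PreservesFilteredColimitsOfSize.{u, u} (forget (ModuleCat.{u} R)) := inferInstance
  have := Limits.preservesFilteredColimitsOfSize_shrink.{0, u, 0, u} (forget (ModuleCat.{u} R))
  infer_instance

lemma inc_surj (x : LC R I t M) : ∃ n e, inc I t M n e = x := by
  obtain ⟨j, e, h⟩ := Limits.Concrete.isColimit_exists_rep _ (isC I t M) x
  exact ⟨j.unop.unop, e, h⟩

lemma inc_zero {n : ℕ} (e) (h : inc I t M n e = 0) : ∃ (m : ℕ) (hm : n ≤ m), dmap M t (tr I hm) e = 0 := by
  have h0 : inc I t M n e = inc I t M n 0 := h.trans (map_zero (inc I t M n).hom).symm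
  obtain ⟨k, f, g, hfg⟩ := Limits.Concrete.isColimit_exists_of_rep_eq (i := ix n) (j := ix n) _ (isC I t M) e 0 h0
  have hm : n ≤ k.unop.unop := leOfHom f.unop.unop
  refine ⟨k.unop.unop, hm, ?_⟩
  refine Eq.trans ?_ (hfg.trans (map_zero (((dg I t).map g).app M).hom))
  rfl

end LCx

namespace LCx
open DExt
variable {R : Type u} [CommRing R]

section cx
variable (C : CochainComplex (ModuleCat.{u} R) ℕ)

def XX : ℤ → ModuleCat.{u} R
  | Int.ofNat n => C.X n
  | Int.negSucc _ => ModuleCat.of R PUnit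

def dX : ∀ i : ℤ, XX C i →ₗ[R] XX C (i + 1)
  | Int.ofNat n => (C.d n (n + 1)).hom
  | Int.negSucc _ => 0

lemma dXX : ∀ (i : ℤ) (x : XX C i), dX C (i + 1) (dX C i x) = 0
  | Int.ofNat n, x => congrArg (fun f => f.hom x) (C.d_comp_d n (n + 1) (n + 2))
  | Int.negSucc n, x => by
    change dX C _ 0 = 0
    exact map_zero _

def cx : Cx R where
  X i := XX C i
  d := dX C
  dd := dXX C

variable (l : List R) (p : ℕ)

def valL : (Cx.gam l (cx C)).Z (p + 1) →ₗ[R] C.X (p + 1) :=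
  (Cx.Gam l (C.X (p + 1))).subtype ∘ₗ ((Cx.gam l (cx C)).Z (p + 1)).subtype

lemma valL_d (w) : C.d (p + 1) (p + 2) (valL C l p w) = 0 := congrArg Subtype.val w.2
lemma valL_gam (w) : valL C l p w ∈ Cx.Gam l (C.X (p + 1)) := w.1.2
lemma valL_surj (x : C.X (p + 1)) (hx : C.d (p + 1) (p + 2) x = 0) (h : x ∈ Cx.Gam l (C.X (p + 1))) :
    ∃ w, valL C l p w = x := ⟨⟨⟨x, h⟩, Subtype.ext hx⟩, rfl⟩
lemma valL_S (w) : w ∈ ((Cx.gam l (cx C)).B p).comap ((Cx.gam l (cx C)).Z (p + 1)).subtype ↔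
    ∃ y ∈ Cx.Gam l (C.X p), C.d p (p + 1) y = valL C l p w := by
  constructor
  · rintro ⟨y, hy⟩
    exact ⟨y.1, y.2, congrArg Subtype.val hy⟩
  · rintro ⟨y, h, hy⟩
    exact ⟨⟨y, h⟩, Subtype.ext hy⟩
end cx

lemma gam_iff (I : Ideal R) (l : List R) (hl : Ideal.span {x | x ∈ l} = I)
    (M : Type u) [AddCommGroup M] [Module R M] (m : M) :
    m ∈ Cx.Gam l M ↔ ∃ n : ℕ, ∀ a ∈ I ^ n, a • m = 0 := by
  constructor
  · intro h
    classical
    have hfg : I.FG := ⟨l.toFinset, by rw [← hl]; congr 1; ext; simp⟩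
    have hr : I ≤ Ideal.radical (LinearMap.ker (LinearMap.toSpanSingleton R M m)) := by
      rw [← hl, Ideal.span_le]
      intro x hx
      obtain ⟨k, hk⟩ := h x hx
      exact ⟨k, hk⟩
    obtain ⟨n, hn⟩ := Ideal.exists_pow_le_of_le_radical_of_fg hr hfg
    exact ⟨n, fun a ha => hn ha⟩
  · rintro ⟨n, hn⟩ x hx
    refine ⟨n, hn _ (Ideal.pow_mem_pow ?_ n)⟩
    rw [← hl]
    exact Ideal.subset_span hx

section
variable (I : Ideal R)
def one (n : ℕ) : q I n := Submodule.Quotient.mk 1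

lemma one_kill {n : ℕ} {X : ModuleCat.{u} R} (g : q I n ⟶ X) (a : R) (ha : a ∈ I ^ n) :
    a • g (one I n) = 0 := by
  have : a • one I n = 0 := by
    change Submodule.Quotient.mk (a • 1) = _
    rw [Submodule.Quotient.mk_eq_zero]
    simpa using ha
  rw [← map_smul g.hom, this]
  exact map_zero g.hom

lemma one_lift {n : ℕ} {X : ModuleCat.{u} R} (x : X) (h : ∀ a ∈ I ^ n, a • x = 0) :
    ∃ g : q I n ⟶ X, g (one I n) = x := by
  refine ⟨ModuleCat.ofHom ((I ^ n).liftQ (LinearMap.toSpanSingleton R X x) h), ?_⟩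
  change LinearMap.toSpanSingleton R X x 1 = x
  simp

lemma one_ext {n : ℕ} {X : ModuleCat.{u} R} (g g' : q I n ⟶ X) (h : g (one I n) = g' (one I n)) :
    g = g' := by
  refine ModuleCat.hom_ext (LinearMap.ext fun y => ?_)
  obtain ⟨a, rfl⟩ := Submodule.mkQ_surjective _ y
  have : (Submodule.mkQ (I ^ n)) a = a • one I n := by
    change _ = Submodule.Quotient.mk (a • 1)
    simp
  rw [this]
  refine (map_smul g.hom _ _).trans (Eq.trans ?_ (map_smul g'.hom _ _).symm)
  exact congrArg _ h

lemma one_tr {n m : ℕ} (h : n ≤ m) : tr I h (one I m) = one I n := rfl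
end

section main
variable (I : Ideal R) {M : ModuleCat.{u} R} (E : InjectiveResolution M) (t : ℕ)

def Q0 (x : E.cocomplex.X t) (z : LC R I t M) : Prop :=
  ∃ (n : ℕ) (g : q I n ⟶ E.cocomplex.X t) (e : dE M t (q I n)), Rel E t g e ∧ g (one I n) = x ∧
    inc I t M n e = z

variable {I E t}
lemma Q0.lift {x z} {n : ℕ} {g : q I n ⟶ E.cocomplex.X t} {e : dE M t (q I n)} (h : Rel E t g e)
    (hx : g (one I n) = x) (hz : inc I t M n e = z) {m : ℕ} (hm : n ≤ m) :
    ∃ (g : q I m ⟶ E.cocomplex.X t) (e : dE M t (q I m)), Rel E t g e ∧ g (one I m) = x ∧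
    inc I t M m e = z :=
  ⟨_, _, h.nat (tr I hm), by rw [← hx]; rfl, by rw [inc_tr, hz]⟩

lemma Q0.add {x x' z z'} (h : Q0 I E t x z) (h' : Q0 I E t x' z') : Q0 I E t (x + x') (z + z') := by
  obtain ⟨n, g, e, h1, h2, h3⟩ := h
  obtain ⟨n', g', e', h1', h2', h3'⟩ := h'
  obtain ⟨G, e, h, rfl, rfl⟩ := Q0.lift h1 h2 h3 (le_max_left n n')
  obtain ⟨G', e', h', rfl, rfl⟩ := Q0.lift h1' h2' h3' (le_max_right n n')
  exact ⟨_, _, _, h.add h', rfl, map_add _ _ _⟩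

lemma Q0.smul {x z} (r : R) (h : Q0 I E t x z) : Q0 I E t (r • x) (r • z) := by
  obtain ⟨n, g, e, h, rfl, rfl⟩ := h
  exact ⟨_, _, _, h.smul r, rfl, map_smul _ _ _⟩

lemma Q0.tot (x : E.cocomplex.X t) (hx : E.cocomplex.d t (t + 1) x = 0) (n : ℕ)
    (h : ∀ a ∈ I ^ n, a • x = 0) : ∃ z, Q0 I E t x z := by
  obtain ⟨g, rfl⟩ := one_lift I x h
  obtain ⟨e, he⟩ := Rel.tot (E := E) g (one_ext I _ _ hx)
  exact ⟨_, n, g, e, he, rfl, rfl⟩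

lemma Q0.onto (z : LC R I t M) : ∃ x : E.cocomplex.X t, E.cocomplex.d t (t + 1) x = 0 ∧
    (∃ n : ℕ, ∀ a ∈ I ^ n, a • x = 0) ∧ Q0 I E t x z := by
  obtain ⟨n, e, rfl⟩ := inc_surj I t M z
  obtain ⟨g, hg⟩ := Rel.onto (E := E) e
  refine ⟨g (one I n), ?_, ⟨n, one_kill I g⟩, n, g, e, hg, rfl, rfl⟩
  obtain ⟨h, -⟩ := hg
  exact congrArg (fun f => f.hom (one I n)) h

lemma Q0.zero_iff {x z} (h : Q0 I E t x z) (p : ℕ) (hp : p + 1 = t) :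
    z = 0 ↔ ∃ y : E.cocomplex.X p, (∃ n : ℕ, ∀ a ∈ I ^ n, a • y = 0) ∧ E.cocomplex.d p t y = x := by
  obtain ⟨n, g, e, h, rfl, rfl⟩ := h
  constructor
  · intro hz
    obtain ⟨m, hm, h0⟩ := inc_zero I t M e hz
    obtain ⟨k, hk⟩ := ((h.nat (tr I hm)).zero_iff p hp).1 h0
    exact ⟨k (one I m), ⟨m, one_kill I k⟩, congrArg (fun f => f.hom (one I m)) hk⟩
  · rintro ⟨y, ⟨m, hm⟩, hy⟩
    obtain ⟨k, hk⟩ := one_lift I (n := max n m) y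
      (fun a ha => hm a (Ideal.pow_le_pow_right (le_max_right n m) ha))
    have h0 := ((h.nat (tr I (le_max_left n m))).zero_iff p hp).2 ⟨k, one_ext I _ _ ?_⟩
    · rw [← inc_tr I t M (le_max_left n m), h0]
      exact map_zero (inc I t M _).hom
    · refine Eq.trans ?_ hy
      exact congrArg _ hk

end main

theorem lcIso (I : Ideal R) (l : List R) (hl : Ideal.span {x | x ∈ l} = I)
    {M : ModuleCat.{u} R} (E : InjectiveResolution M) (p : ℕ) :
    Nonempty (LC R I (p + 1) M ≃ₗ[R] (Cx.gam l (cx E.cocomplex)).H p) := by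
  refine relIso (M := (Cx.gam l (cx E.cocomplex)).Z (p + 1))
    { carrier := {a | Q0 I E (p + 1) (valL E.cocomplex l p a.1) a.2}
      add_mem' := fun {a b} ha hb => ha.add hb
      zero_mem' := ?_
      smul_mem' := fun r a ha => ha.smul r } ?_ ?_ _ ?_
  · obtain ⟨x, -, -, hx⟩ := Q0.onto (I := I) (E := E) (t := p + 1) 0
    have := hx.smul (0 : R)
    rw [zero_smul, smul_zero] at this
    exact this
  · intro w
    obtain ⟨n, hn⟩ := (gam_iff I l hl _ _).1 (valL_gam E.cocomplex l p w)
    exact Q0.tot _ (valL_d E.cocomplex l p w) n hn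
  · intro z
    obtain ⟨x, h1, h2, h3⟩ := Q0.onto (I := I) (E := E) (t := p + 1) z
    obtain ⟨w, rfl⟩ := valL_surj E.cocomplex l p x h1 ((gam_iff I l hl _ _).2 h2)
    exact ⟨w, h3⟩
  · intro w z h
    rw [valL_S, Q0.zero_iff h p rfl]
    simp only [gam_iff I l hl]

lemma cx_inj {M : ModuleCat.{u} R} (E : InjectiveResolution M) :
    ∀ i : ℤ, Module.Injective R ((cx E.cocomplex).X i)
  | Int.ofNat n => by
    have : Injective (ModuleCat.of R (E.cocomplex.X n)) := E.injective n
    exact Module.injective_module_of_injective_object R (E.cocomplex.X n)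
  | Int.negSucc n => ⟨fun X Y _ _ _ _ f hf g => ⟨0, fun x => Subsingleton.elim (α := PUnit) _ _⟩⟩

lemma cx_exact {M : ModuleCat.{u} R} (E : InjectiveResolution M) : ∀ i : ℤ, 0 ≤ i →
    ∀ y, (cx E.cocomplex).d (i + 1) y = 0 → ∃ w, (cx E.cocomplex).d i w = y
  | Int.ofNat n, _, y, hy =>
    ((ShortComplex.ShortExact.moduleCat_exact_iff_function_exact _).1 (E.exact_succ n) y).1 hy
  | Int.negSucc n, h, _, _ => by
    exact absurd h (by simp)
end LCx

theorem stmt8 (R : Type u) [CommRing R] [IsNoetherianRing R] (I J : Ideal R) (hIJ : I ≤ J)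
    (M : Type u) [AddCommGroup M] [Module R M] (t : ℕ) (ht : 2 ≤ t)
    (h : ∀ i : ℕ, t < i → ∀ j : ℕ,
      Subsingleton (TorMod R j (ModuleCat.of R (R ⧸ J)) (LC R I i (ModuleCat.of R M)))) :
    Subsingleton (TorMod R 0 (ModuleCat.of R (R ⧸ J)) (LC R I t (ModuleCat.of R M))) ∧
      Subsingleton (TorMod R 1 (ModuleCat.of R (R ⧸ J)) (LC R I t (ModuleCat.of R M))) := by
  obtain ⟨s, hs⟩ := IsNoetherian.noetherian I
  have hl : Ideal.span {x | x ∈ s.toList} = I := by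
    rw [← hs]; congr 1; ext; simp
  have E : InjectiveResolution (ModuleCat.of R M) := injectiveResolution _
  have key : ∀ (p j : ℕ), Subsingleton (TorMod R j (ModuleCat.of R (R ⧸ J))
      (LC R I (p + 1) (ModuleCat.of R M))) ↔
      TT (ModuleCat.of R (CharacterModule (R ⧸ J))) ((Cx.gam s.toList (LCx.cx E.cocomplex)).H p) j := by
    intro p j
    obtain ⟨e⟩ := LCx.lcIso I s.toList hl E p
    rw [TorExt.main]
    exact ⟨fun h => TT.of_equiv e h, fun h => TT.of_equiv e.symm h⟩
  obtain ⟨t, rfl⟩ : ∃ t', t = t' + 1 := ⟨t - 1, by lia⟩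
  rw [key, key]
  refine Cx.main_T _ _ (LCx.cx_inj E) (LCx.cx_exact E) s.toList ?_ t (by lia) ?_
  · intro x hx d
    have hxJ : x ∈ J := hIJ (by rw [← hl]; exact Ideal.subset_span hx)
    refine DFunLike.ext (F := CharacterModule (R ⧸ J)) _ _ fun a => ?_
    obtain ⟨a, rfl⟩ := Ideal.Quotient.mk_surjective a
    have : x • (Ideal.Quotient.mk J a) = 0 := by
      change Ideal.Quotient.mk J (x • a) = 0
      rw [Ideal.Quotient.eq_zero_iff_mem]
      exact J.mul_mem_right _ hxJ
    change (d : CharacterModule (R ⧸ J)) (x • (Ideal.Quotient.mk J a)) = 0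
    rw [this]
    exact map_zero (d : CharacterModule (R ⧸ J))
  · intro i hi j
    obtain ⟨p, rfl⟩ := Int.eq_ofNat_of_zero_le (show 0 ≤ i by lia)
    exact (key p j).1 (h _ (by lia) j)
end
end
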